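/- arXiv:1707.06893 — 2 statements merged into one kernel-verified Lean document; each statement's English description precedes it below -/
import Mathlib

section
/- The only pairs of natural numbers (n, m) with n ≥ 4 and m ≥ 6 satisfying C(n, 2) = C(m, 3) (where C denotes the binomial coefficient) are (n, m) = (16, 10), (56, 22), and (120, 36). -/
open NumberField Polynomial

section NumberFieldUnits

variable {K : Type*} [Field K] [NumberField K]

/-- A number field with a non-real complex embedding has fewer infinite places than its degree. -/
theorem card_infinitePlace_lt_finrank (φ : K →+* ℂ) (h : ¬ ComplexEmbedding.IsReal φ) :
    Fintype.card (InfinitePlace K) < Module.finrank ℚ K := by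
  have h1 := InfinitePlace.card_add_two_mul_card_eq_rank K
  have h2 := InfinitePlace.card_eq_nrRealPlaces_add_nrComplexPlaces K
  classical
  have h3 : 0 < InfinitePlace.nrComplexPlaces K :=
    Fintype.card_pos_iff.mpr ⟨⟨InfinitePlace.mk φ, InfinitePlace.isComplex_mk_iff.mpr h⟩⟩
  omega

/-- More units than the unit rank satisfy a nontrivial multiplicative relation. -/
theorem exists_zpow_prod_eq_one {n : ℕ} (hn : Fintype.card (InfinitePlace K) ≤ n)
    (x : Fin n → (𝓞 K)ˣ) : ∃ e : Fin n → ℤ, e ≠ 0 ∧ ∏ i, x i ^ e i = 1 := by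
  have hn0 : 0 < Fintype.card (InfinitePlace K) := Fintype.card_pos
  let y : Fin n → Additive (𝓞 K)ˣ := fun i => Additive.ofMul (x i)
  have hli : ¬ LinearIndependent ℤ y := by
    intro h
    have h1 := h.fintype_card_le_finrank
    rw [Units.finrank_eq, Units.rank, Fintype.card_fin] at h1
    omega
  obtain ⟨g, hg, i, hi⟩ := Fintype.not_linearIndependent_iff.mp hli
  refine ⟨g, fun h => hi (congrFun h i), Additive.ofMul.injective ?_⟩
  rw [ofMul_one, ← hg]
  simp [y, ofMul_prod]

end NumberFieldUnits

/-- A complex root which is not real gives a non-real embedding. -/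
theorem exists_not_isReal_of_root {f : ℚ[X]} [Fact (Irreducible f)] {z : ℂ}
    (hz : aeval z f = 0) (him : z.im ≠ 0) :
    ∃ φ : AdjoinRoot f →+* ℂ, ¬ ComplexEmbedding.IsReal φ := by
  refine ⟨AdjoinRoot.lift (algebraMap ℚ ℂ) z (by simpa [aeval_def] using hz), fun h => him ?_⟩
  have h1 := RingHom.congr_fun (ComplexEmbedding.isReal_iff.mp h) (AdjoinRoot.root f)
  rw [ComplexEmbedding.conjugate_coe_eq] at h1
  erw [AdjoinRoot.lift_root] at h1
  exact Complex.conj_eq_iff_im.mp h1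

instance numberField_adjoinRoot {f : ℚ[X]} [hf : Fact (Irreducible f)] :
    NumberField (AdjoinRoot f) where
  to_charZero := charZero_of_injective_algebraMap (algebraMap ℚ (AdjoinRoot f)).injective
  to_finiteDimensional := (AdjoinRoot.powerBasis hf.out.ne_zero).finite

theorem finrank_adjoinRoot {f : ℚ[X]} (hf : f ≠ 0) :
    Module.finrank ℚ (AdjoinRoot f) = f.natDegree := by
  rw [(AdjoinRoot.powerBasis hf).finrank, AdjoinRoot.powerBasis_dim]

section CommGroupDecomposition

variable {G : Type*} [CommGroup G]

/-- If `u` and `v` are independent modulo `q`-th powers and elements of order dividing two, then a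
relation between `w`, `u` and `v` expresses `w` through `u` and `v` up to such elements. -/
theorem exists_eq_zpow_mul_zpow_mul_pow {u v w : G} {q : ℕ} (hq : q.Prime)
    (hrel : ∃ a b c : ℤ, (w ^ a * u ^ b * v ^ c) ^ 2 = 1 ∧
      ¬ ((q : ℤ) ∣ a ∧ (q : ℤ) ∣ b ∧ (q : ℤ) ∣ c))
    (hind : ∀ (a b : ℤ) (x σ : G), σ ^ 2 = 1 → u ^ a * v ^ b = σ * x ^ q →
      (q : ℤ) ∣ a ∧ (q : ℤ) ∣ b) :
    ∃ (σ : G) (i j : ℤ) (y : G), σ ^ 2 = 1 ∧ w = σ * (u ^ i * v ^ j) * y ^ q := by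
  obtain ⟨a, b, c, h, hnd⟩ := hrel
  set τ := w ^ a * u ^ b * v ^ c with hτ
  have hqa : ¬ (q : ℤ) ∣ a := by
    rintro ⟨k, rfl⟩
    refine hnd ⟨dvd_mul_right _ _, hind b c (w ^ (-k)) τ h ?_⟩
    have hk : (w ^ (-k)) ^ q = (w ^ ((q : ℤ) * k))⁻¹ := by
      rw [← zpow_natCast, ← zpow_mul, ← zpow_neg, neg_mul, mul_comm]
    rw [hτ, hk, eq_mul_inv_iff_mul_eq, mul_comm, mul_assoc]
  have hcop : IsCoprime a (q : ℤ) :=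
    ((Nat.prime_iff_prime_int.mp hq).coprime_iff_not_dvd.mpr hqa).symm
  obtain ⟨m, n, hmn⟩ := hcop
  refine ⟨τ ^ m, -b * m, -c * m, w ^ n, ?_, ?_⟩
  · rw [← zpow_natCast, ← zpow_mul, mul_comm, zpow_mul, zpow_natCast, h, one_zpow]
  · have hw : w = w ^ (m * a + n * q) := by rw [hmn, zpow_one]
    nth_rewrite 1 [hw]
    rw [hτ, ← zpow_natCast (w ^ n), ← zpow_mul]
    simp only [mul_zpow, ← zpow_mul, zpow_add, neg_mul, zpow_neg]
    rw [mul_comm m a, ← mul_inv, mul_assoc (w ^ (a * m)), mul_inv_cancel_right]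

theorem exists_eq_mul_pow_mul {u v : G} {m n : ℕ}
    (hm : ∀ w : G, ∃ (σ : G) (i j : ℤ) (y : G), σ ^ 2 = 1 ∧ w = σ * (u ^ i * v ^ j) * y ^ m)
    (hn : ∀ w : G, ∃ (σ : G) (i j : ℤ) (y : G), σ ^ 2 = 1 ∧ w = σ * (u ^ i * v ^ j) * y ^ n)
    (w : G) :
    ∃ (σ : G) (i j : ℤ) (y : G), σ ^ 2 = 1 ∧ w = σ * (u ^ i * v ^ j) * y ^ (m * n) := by
  obtain ⟨σ, i, j, y, hσ, rfl⟩ := hm w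
  obtain ⟨τ, k, l, z, hτ, rfl⟩ := hn y
  refine ⟨σ * τ ^ m, i + k * m, j + l * m, z, ?_, ?_⟩
  · rw [mul_pow, hσ, ← pow_mul, mul_comm m, pow_mul, hτ, one_pow, one_mul]
  · simp only [mul_pow, zpow_add, zpow_mul, zpow_natCast, ← pow_mul, mul_comm n m]
    simp only [mul_comm, mul_left_comm, mul_assoc]

end CommGroupDecomposition

section OrderUnits

variable {O : Type*} [CommRing O]

theorem isUnit_relation {K : Type*} [Field K] [NumberField K] {n : ℕ} (φ : O →+* K)
    (hφ : Function.Injective φ) (hint : ∀ x, IsIntegral ℤ (φ x))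
    (hn : Fintype.card (InfinitePlace K) ≤ n) (x : Fin n → Oˣ) :
    ∃ e : Fin n → ℤ, e ≠ 0 ∧ ∏ i, x i ^ e i = 1 := by
  let ψ : O →+* 𝓞 K := φ.codRestrict (integralClosure ℤ K).toSubring hint
  have hψ : Function.Injective ψ := fun a b h => hφ (congrArg Subtype.val h)
  obtain ⟨e, he, h⟩ := exists_zpow_prod_eq_one hn fun i => Units.map (ψ : O →* 𝓞 K) (x i)
  refine ⟨e, he, Units.map_injective (f := (ψ : O →* 𝓞 K)) hψ ?_⟩
  simpa using h

theorem eq_one_or_neg_one_of_pow_eq_one (φ : O →+* ℝ) (hφ : Function.Injective φ) {x : O} {n : ℕ}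
    (hn : n ≠ 0) (h : x ^ n = 1) : x = 1 ∨ x = -1 := by
  have h1 : φ x ^ n = 1 := by rw [← map_pow, h, map_one]
  have h2 : |φ x| = 1 := by
    rw [← pow_eq_one_iff_of_nonneg (abs_nonneg _) hn, ← abs_pow, h1, abs_one]
  rcases (abs_eq zero_le_one).mp h2 with h3 | h3
  · exact Or.inl (hφ (by rw [h3, map_one]))
  · exact Or.inr (hφ (by rw [h3, map_neg, map_one]))

theorem units_sq_eq_one_of_pow_eq_one (φ : O →+* ℝ) (hφ : Function.Injective φ) {x : Oˣ} {n : ℕ}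
    (hn : n ≠ 0) (h : x ^ n = 1) : x ^ 2 = 1 := by
  have h1 : (x : O) ^ n = 1 := by rw [← Units.val_pow_eq_pow_val, h, Units.val_one]
  ext
  rcases eq_one_or_neg_one_of_pow_eq_one φ hφ hn h1 with h2 | h2 <;> simp [h2]

/-- The exponents of a relation between units can be made coprime, up to sign. -/
theorem isUnit_relation_coprime {n : ℕ} (φ : O →+* ℝ) (hφ : Function.Injective φ) {x : Fin n → Oˣ}
    (hrel : ∃ e : Fin n → ℤ, e ≠ 0 ∧ ∏ i, x i ^ e i = 1) {q : ℕ} (hq : q.Prime) :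
    ∃ e : Fin n → ℤ, (∏ i, x i ^ e i) ^ 2 = 1 ∧ ¬ ∀ i, (q : ℤ) ∣ e i := by
  obtain ⟨e, he, h⟩ := hrel
  obtain ⟨i, hi⟩ := Function.ne_iff.mp he
  obtain ⟨g, hg, hg1⟩ := Finset.extract_gcd e ⟨i, Finset.mem_univ i⟩
  set d := Finset.univ.gcd e
  have hd : d ≠ 0 := fun h0 => hi (by rw [hg i (Finset.mem_univ i), h0, zero_mul]; rfl)
  refine ⟨g, ?_, fun hall => ?_⟩
  · apply units_sq_eq_one_of_pow_eq_one φ hφ (Int.natAbs_ne_zero.mpr hd)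
    have h1 : (∏ i, x i ^ g i) ^ d = 1 := by
      rw [← h, ← Finset.prod_zpow]
      exact Finset.prod_congr rfl fun j hj => by rw [← zpow_mul, hg j hj, mul_comm]
    rcases Int.natAbs_eq d with h2 | h2
    · rwa [h2, zpow_natCast] at h1
    · rwa [h2, zpow_neg, zpow_natCast, inv_eq_one] at h1
  · have := Finset.dvd_gcd fun j (_ : j ∈ Finset.univ) => hall j
    rw [hg1] at this
    exact (Nat.prime_iff_prime_int.mp hq).not_dvd_one this

end OrderUnits

/-- The ring `R[X] / (X⁴ + s * X³ + t * X² + 2 * X - 2)`, in coordinates for the powers of the class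
of `X`. -/
@[ext]
structure Quartic (R : Type*) (s t : ℤ) where
  c0 : R
  c1 : R
  c2 : R
  c3 : R
  deriving DecidableEq

namespace Quartic

section Ring

variable {R : Type*} [CommRing R] {s t : ℤ}

instance : Zero (Quartic R s t) := ⟨⟨0, 0, 0, 0⟩⟩
instance : One (Quartic R s t) := ⟨⟨1, 0, 0, 0⟩⟩
instance : Add (Quartic R s t) :=
  ⟨fun x y => ⟨x.c0 + y.c0, x.c1 + y.c1, x.c2 + y.c2, x.c3 + y.c3⟩⟩
instance : Neg (Quartic R s t) := ⟨fun x => ⟨-x.c0, -x.c1, -x.c2, -x.c3⟩⟩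
instance : Mul (Quartic R s t) := ⟨fun x y =>
  let e4 := x.c1 * y.c3 + x.c2 * y.c2 + x.c3 * y.c1
  let e5 := x.c2 * y.c3 + x.c3 * y.c2
  let e6 := x.c3 * y.c3
  let f5 := e5 - s * e6
  let f4 := e4 - s * f5 - t * e6
  ⟨x.c0 * y.c0 + 2 * f4,
    x.c0 * y.c1 + x.c1 * y.c0 - 2 * f4 + 2 * f5,
    x.c0 * y.c2 + x.c1 * y.c1 + x.c2 * y.c0 - t * f4 - 2 * f5 + 2 * e6,
    x.c0 * y.c3 + x.c1 * y.c2 + x.c2 * y.c1 + x.c3 * y.c0 - s * f4 - t * f5 - 2 * e6⟩⟩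

@[simp] theorem zero_c0 : (0 : Quartic R s t).c0 = 0 := rfl
@[simp] theorem zero_c1 : (0 : Quartic R s t).c1 = 0 := rfl
@[simp] theorem zero_c2 : (0 : Quartic R s t).c2 = 0 := rfl
@[simp] theorem zero_c3 : (0 : Quartic R s t).c3 = 0 := rfl
@[simp] theorem one_c0 : (1 : Quartic R s t).c0 = 1 := rfl
@[simp] theorem one_c1 : (1 : Quartic R s t).c1 = 0 := rfl
@[simp] theorem one_c2 : (1 : Quartic R s t).c2 = 0 := rfl
@[simp] theorem one_c3 : (1 : Quartic R s t).c3 = 0 := rfl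
@[simp] theorem add_c0 (x y : Quartic R s t) : (x + y).c0 = x.c0 + y.c0 := rfl
@[simp] theorem add_c1 (x y : Quartic R s t) : (x + y).c1 = x.c1 + y.c1 := rfl
@[simp] theorem add_c2 (x y : Quartic R s t) : (x + y).c2 = x.c2 + y.c2 := rfl
@[simp] theorem add_c3 (x y : Quartic R s t) : (x + y).c3 = x.c3 + y.c3 := rfl
@[simp] theorem neg_c0 (x : Quartic R s t) : (-x).c0 = -x.c0 := rfl
@[simp] theorem neg_c1 (x : Quartic R s t) : (-x).c1 = -x.c1 := rfl
@[simp] theorem neg_c2 (x : Quartic R s t) : (-x).c2 = -x.c2 := rfl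
@[simp] theorem neg_c3 (x : Quartic R s t) : (-x).c3 = -x.c3 := rfl

theorem mul_def (x y : Quartic R s t) : x * y =
    ⟨x.c0 * y.c0 + 2 * (x.c1 * y.c3 + x.c2 * y.c2 + x.c3 * y.c1
        - s * (x.c2 * y.c3 + x.c3 * y.c2 - s * (x.c3 * y.c3)) - t * (x.c3 * y.c3)),
      x.c0 * y.c1 + x.c1 * y.c0 - 2 * (x.c1 * y.c3 + x.c2 * y.c2 + x.c3 * y.c1
        - s * (x.c2 * y.c3 + x.c3 * y.c2 - s * (x.c3 * y.c3)) - t * (x.c3 * y.c3))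
        + 2 * (x.c2 * y.c3 + x.c3 * y.c2 - s * (x.c3 * y.c3)),
      x.c0 * y.c2 + x.c1 * y.c1 + x.c2 * y.c0 - t * (x.c1 * y.c3 + x.c2 * y.c2 + x.c3 * y.c1
        - s * (x.c2 * y.c3 + x.c3 * y.c2 - s * (x.c3 * y.c3)) - t * (x.c3 * y.c3))
        - 2 * (x.c2 * y.c3 + x.c3 * y.c2 - s * (x.c3 * y.c3)) + 2 * (x.c3 * y.c3),
      x.c0 * y.c3 + x.c1 * y.c2 + x.c2 * y.c1 + x.c3 * y.c0
        - s * (x.c1 * y.c3 + x.c2 * y.c2 + x.c3 * y.c1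
        - s * (x.c2 * y.c3 + x.c3 * y.c2 - s * (x.c3 * y.c3)) - t * (x.c3 * y.c3))
        - t * (x.c2 * y.c3 + x.c3 * y.c2 - s * (x.c3 * y.c3)) - 2 * (x.c3 * y.c3)⟩ := rfl

instance : CommRing (Quartic R s t) where
  add_assoc x y z := by ext <;> simp [add_assoc]
  zero_add x := by ext <;> simp
  add_zero x := by ext <;> simp
  add_comm x y := by ext <;> simp [add_comm]
  neg_add_cancel x := by ext <;> simp
  nsmul := nsmulRec
  zsmul := zsmulRec
  left_distrib x y z := by ext <;> simp only [mul_def, add_c0, add_c1, add_c2, add_c3] <;> ring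
  right_distrib x y z := by ext <;> simp only [mul_def, add_c0, add_c1, add_c2, add_c3] <;> ring
  zero_mul x := by ext <;> simp [mul_def]
  mul_zero x := by ext <;> simp [mul_def]
  mul_assoc x y z := by ext <;> simp only [mul_def] <;> ring
  one_mul x := by ext <;> simp [mul_def]
  mul_one x := by ext <;> simp [mul_def]
  mul_comm x y := by ext <;> simp only [mul_def] <;> ring

@[simp] theorem sub_c0 (x y : Quartic R s t) : (x - y).c0 = x.c0 - y.c0 := by
  simp [sub_eq_add_neg]
@[simp] theorem sub_c1 (x y : Quartic R s t) : (x - y).c1 = x.c1 - y.c1 := by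
  simp [sub_eq_add_neg]
@[simp] theorem sub_c2 (x y : Quartic R s t) : (x - y).c2 = x.c2 - y.c2 := by
  simp [sub_eq_add_neg]
@[simp] theorem sub_c3 (x y : Quartic R s t) : (x - y).c3 = x.c3 - y.c3 := by
  simp [sub_eq_add_neg]

/-- The constants. -/
def const (R : Type*) [CommRing R] (s t : ℤ) : R →+* Quartic R s t where
  toFun c := ⟨c, 0, 0, 0⟩
  map_one' := rfl
  map_mul' x y := by ext <;> simp [mul_def]
  map_zero' := rfl
  map_add' x y := by ext <;> simp

theorem const_injective : Function.Injective (const R s t) := fun _ _ h => congrArg c0 h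

theorem natCast_def (n : ℕ) : (n : Quartic R s t) = ⟨n, 0, 0, 0⟩ :=
  (map_natCast (const R s t) n).symm

/-- The class of `X`. -/
def gen (R : Type*) [CommRing R] (s t : ℤ) : Quartic R s t := ⟨0, 1, 0, 0⟩

theorem eq_sum (x : Quartic R s t) : x = const R s t x.c0 + const R s t x.c1 * gen R s t +
    const R s t x.c2 * gen R s t ^ 2 + const R s t x.c3 * gen R s t ^ 3 := by
  ext <;> simp [const, gen, pow_succ, mul_def]

/-- Base change. -/
def map {S : Type*} [CommRing S] (f : R →+* S) : Quartic R s t →+* Quartic S s t where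
  toFun x := ⟨f x.c0, f x.c1, f x.c2, f x.c3⟩
  map_one' := by ext <;> simp
  map_mul' x y := by ext <;> simp [mul_def, map_ofNat f 2]
  map_zero' := by ext <;> simp
  map_add' x y := by ext <;> simp

/-- Evaluation at a root of the defining polynomial. -/
def eval {S : Type*} [CommRing S] (f : R →+* S) (r : S)
    (hr : r ^ 4 + s * r ^ 3 + t * r ^ 2 + 2 * r - 2 = 0) : Quartic R s t →+* S where
  toFun x := f x.c0 + f x.c1 * r + f x.c2 * r ^ 2 + f x.c3 * r ^ 3
  map_one' := by simp
  map_mul' x y := by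
    simp only [mul_def, map_add, map_sub, map_mul, map_intCast, map_ofNat f 2]
    set e4 := f x.c1 * f y.c3 + f x.c2 * f y.c2 + f x.c3 * f y.c1 with h4
    set e5 := f x.c2 * f y.c3 + f x.c3 * f y.c2 with h5
    set e6 := f x.c3 * f y.c3 with h6
    linear_combination -(e4 - s * (e5 - s * e6) - t * e6 + (e5 - s * e6) * r + e6 * r ^ 2) * hr -
      r ^ 4 * h4 - r ^ 5 * h5 - r ^ 6 * h6
  map_zero' := by simp
  map_add' x y := by simp; ring

end Ring
end Quartic

namespace Quartic

section Field

variable {s t : ℤ}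

/-- The defining polynomial, over the rationals. -/
noncomputable def poly (s t : ℤ) : ℚ[X] :=
  X ^ 4 + (s : ℚ[X]) * X ^ 3 + (t : ℚ[X]) * X ^ 2 + 2 * X - 2

theorem natDegree_poly : (poly s t).natDegree = 4 := by
  unfold poly
  compute_degree!

theorem monic_poly : (poly s t).Monic := by
  unfold poly
  monicity!

theorem eval₂_poly {F : Type*} [Field F] (f : ℚ →+* F) (r : F) :
    (poly s t).eval₂ f r = r ^ 4 + s * r ^ 3 + t * r ^ 2 + 2 * r - 2 := by
  have h (n : ℤ) : (n : ℚ[X]).eval₂ f r = n := by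
    rw [← C_eq_intCast, eval₂_C, map_intCast]
  simp [poly, h]

theorem eval_injective (hirr : Irreducible (poly s t)) {F : Type*} [Field F] [Algebra ℚ F] {r : F}
    (hr : r ^ 4 + s * r ^ 3 + t * r ^ 2 + 2 * r - 2 = 0) :
    Function.Injective (eval (Int.castRingHom F) r hr) := by
  rw [injective_iff_map_eq_zero]
  intro x hx
  let h : ℚ[X] := C (x.c0 : ℚ) + C (x.c1 : ℚ) * X + C (x.c2 : ℚ) * X ^ 2 + C (x.c3 : ℚ) * X ^ 3
  have h1 : aeval r h = 0 := by
    simpa [h, eval] using hx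
  have h2 : poly s t = minpoly ℚ r :=
    minpoly.eq_of_irreducible_of_monic hirr (by rw [aeval_def, eval₂_poly, hr]) monic_poly
  have h3 : h = 0 := by
    refine eq_zero_of_dvd_of_natDegree_lt (h2 ▸ minpoly.dvd ℚ r h1) ?_
    rw [natDegree_poly]
    have : h.natDegree ≤ 3 := by
      simp only [h]
      compute_degree
    omega
  have hc (n : ℕ) : h.coeff n = 0 := by rw [h3, coeff_zero]
  have h0 := hc 0
  have h1 := hc 1
  have h2 := hc 2
  have h3 := hc 3
  simp only [h, coeff_add, coeff_C_mul, coeff_C, coeff_X, coeff_X_pow] at h0 h1 h2 h3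
  norm_num at h0 h1 h2 h3
  ext <;> simp [*]

theorem exists_real_root (h : 0 ≤ 1 + s + t) :
    ∃ r : ℝ, r ^ 4 + s * r ^ 3 + t * r ^ 2 + 2 * r - 2 = 0 := by
  have hcont : ContinuousOn (fun r : ℝ => r ^ 4 + s * r ^ 3 + t * r ^ 2 + 2 * r - 2)
      (Set.Icc 0 1) := by fun_prop
  have h' : (0 : ℝ) ≤ 1 + s + t := by exact_mod_cast h
  obtain ⟨r, -, hr⟩ := intermediate_value_Icc zero_le_one hcont
    (show (0 : ℝ) ∈ _ from ⟨by norm_num, by norm_num; linarith⟩)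
  exact ⟨r, hr⟩

/-- Four complex roots, with their elementary symmetric functions. -/
theorem exists_complex_roots (s t : ℤ) : ∃ a b c d : ℂ, a + b + c + d = -s ∧
    a * b + a * c + a * d + b * c + b * d + c * d = t ∧
    a * b * c + a * b * d + a * c * d + b * c * d = -2 ∧ a * b * c * d = -2 := by
  set g : ℂ[X] := (poly s t).map (algebraMap ℚ ℂ) with hg
  have hm : g.Monic := monic_poly.map _
  have hs : g.Splits := IsAlgClosed.splits g
  have hcard : g.roots.card = 4 := by
    rw [splits_iff_card_roots.mp hs, hg, natDegree_map, natDegree_poly]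
  obtain ⟨a, b, c, d, hr⟩ := Multiset.card_eq_four.mp hcard
  have hprod := hs.eq_prod_roots
  rw [hm.leadingCoeff, hr] at hprod
  have he (z : ℂ) : z ^ 4 + s * z ^ 3 + t * z ^ 2 + 2 * z - 2 =
      (z - a) * (z - b) * (z - c) * (z - d) := by
    have := congrArg (Polynomial.eval z) hprod
    simpa [hg, poly, mul_assoc] using this
  have h0 := he 0
  have h1 := he 1
  have h2 := he (-1)
  have h3 := he 2
  refine ⟨a, b, c, d, ?_, ?_, ?_, ?_⟩
  · linear_combination h0 / 2 - h1 / 2 - h2 / 6 + h3 / 6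
  · linear_combination h0 - h1 / 2 - h2 / 2
  · linear_combination h1 - h2 / 3 - h3 / 6 - h0 / 2
  · linear_combination -h0

theorem exists_nonreal_root (h : ∀ a b c d : ℝ, a + b + c + d = -s →
    a * b + a * c + a * d + b * c + b * d + c * d = t →
    a * b * c + a * b * d + a * c * d + b * c * d = -2 → a * b * c * d = -2 → False) :
    ∃ z : ℂ, z ^ 4 + s * z ^ 3 + t * z ^ 2 + 2 * z - 2 = 0 ∧ z.im ≠ 0 := by
  obtain ⟨a, b, c, d, h1, h2, h3, h4⟩ := exists_complex_roots s t
  have he (z : ℂ) : z ^ 4 + s * z ^ 3 + t * z ^ 2 + 2 * z - 2 =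
      (z - a) * (z - b) * (z - c) * (z - d) := by
    linear_combination z ^ 3 * h1 + z ^ 2 * h2 * (-1) + z * h3 - h4
  by_contra! hall
  have ha := Complex.ext (z := a) (w := (a.re : ℂ)) rfl (hall a (by rw [he]; ring))
  have hb := Complex.ext (z := b) (w := (b.re : ℂ)) rfl (hall b (by rw [he]; ring))
  have hc := Complex.ext (z := c) (w := (c.re : ℂ)) rfl (hall c (by rw [he]; ring))
  have hd := Complex.ext (z := d) (w := (d.re : ℂ)) rfl (hall d (by rw [he]; ring))
  rw [ha, hb, hc, hd] at h1 h2 h3 h4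
  exact h a.re b.re c.re d.re (by exact_mod_cast h1) (by exact_mod_cast h2)
    (by exact_mod_cast h3) (by exact_mod_cast h4)

theorem unit_relation_of_root (hirr : Irreducible (poly s t)) {K : Type*} [Field K]
    [NumberField K] (hK : Fintype.card (InfinitePlace K) ≤ 3) {ω : K}
    (hω : ω ^ 4 + s * ω ^ 3 + t * ω ^ 2 + 2 * ω - 2 = 0)
    (x : Fin 3 → (Quartic ℤ s t)ˣ) : ∃ e : Fin 3 → ℤ, e ≠ 0 ∧ ∏ i, x i ^ e i = 1 := by
  have hint : IsIntegral ℤ ω := by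
    refine ⟨X ^ 4 + C s * X ^ 3 + C t * X ^ 2 + C 2 * X - C 2, by monicity!, ?_⟩
    simp only [eval₂_sub, eval₂_add, eval₂_mul, eval₂_pow, eval₂_X, eval₂_C]
    simpa using hω
  refine isUnit_relation (eval (Int.castRingHom _) _ hω) (eval_injective hirr hω) (fun x => ?_) hK x
  have hc (n : ℤ) : IsIntegral ℤ (Int.castRingHom K n) := isIntegral_algebraMap (R := ℤ)
  exact (((hc _).add ((hc _).mul hint)).add ((hc _).mul (hint.pow 2))).add
    ((hc _).mul (hint.pow 3))

/-- Three units satisfy a nontrivial relation, when there is a non-real root. -/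
theorem unit_relation (hirr : Irreducible (poly s t)) {z : ℂ}
    (hz : z ^ 4 + s * z ^ 3 + t * z ^ 2 + 2 * z - 2 = 0) (him : z.im ≠ 0)
    (x : Fin 3 → (Quartic ℤ s t)ˣ) : ∃ e : Fin 3 → ℤ, e ≠ 0 ∧ ∏ i, x i ^ e i = 1 := by
  have : Fact (Irreducible (poly s t)) := ⟨hirr⟩
  obtain ⟨φ, hφ⟩ := exists_not_isReal_of_root (f := poly s t) (z := z)
    (by rw [aeval_def, eval₂_poly, hz]) him
  refine unit_relation_of_root hirr (K := AdjoinRoot (poly s t)) ?_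
    (ω := AdjoinRoot.root (poly s t)) ?_ x
  · have := card_infinitePlace_lt_finrank φ hφ
    rw [finrank_adjoinRoot hirr.ne_zero, natDegree_poly] at this
    omega
  · rw [← eval₂_poly (AdjoinRoot.of (poly s t)), AdjoinRoot.eval₂_root]

end Field
end Quartic

section Binomial

variable {A : Type*} [CommRing A]

theorem one_add_pow_eq (y : A) (n : ℕ) :
    ∃ z, (1 + y) ^ n = 1 + n * y + n.choose 2 * y ^ 2 + z * y ^ 3 := by
  induction n with
  | zero => exact ⟨0, by simp⟩
  | succ n ih =>
    obtain ⟨z, hz⟩ := ih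
    refine ⟨z + n.choose 2 + z * y, ?_⟩
    rw [pow_succ, hz, Nat.choose_succ_succ' n 1, Nat.choose_one_right]
    push_cast
    ring

/-- Powers of `1 + pγ` with exponent a power of the odd prime `p`. -/
theorem one_add_mul_pow_prime_pow {p : ℕ} (hodd : Odd p) (γ : A) (k : ℕ) :
    ∃ δ, (1 + p * γ) ^ p ^ k = 1 + p ^ (k + 1) * γ + p ^ (k + 2) * δ := by
  induction k with
  | zero => exact ⟨0, by simp⟩
  | succ k ih =>
    obtain ⟨δ, hδ⟩ := ih
    obtain ⟨z, hz⟩ := one_add_pow_eq (p ^ (k + 1) * (γ + p * δ)) p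
    obtain ⟨m, rfl⟩ := hodd
    have hc : (2 * m + 1).choose 2 = (2 * m + 1) * m := by
      rw [Nat.choose_two_right, Nat.add_sub_cancel, mul_left_comm,
        Nat.mul_div_cancel_left _ two_pos]
    generalize 2 * m + 1 = p at *
    refine ⟨δ + m * (p : A) ^ k * (γ + p * δ) ^ 2 + z * p ^ (2 * k) * (γ + p * δ) ^ 3, ?_⟩
    rw [pow_succ p k, pow_mul, hδ]
    have : (1 : A) + p ^ (k + 1) * γ + p ^ (k + 2) * δ = 1 + p ^ (k + 1) * (γ + p * δ) := by ring
    rw [this, hz, hc]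
    push_cast
    ring

theorem val_zpow_eq_one_add {U : Aˣ} {p g : A} (hp : p ^ 2 = 0) (hU : (U : A) = 1 + p * g) (i : ℤ) :
    ((U ^ i : Aˣ) : A) = 1 + p * (i * g) := by
  have hinv : ((U⁻¹ : Aˣ) : A) = 1 - p * g := by
    refine Units.inv_eq_of_mul_eq_one_right ?_
    rw [hU]
    linear_combination -g ^ 2 * hp
  induction i with
  | zero => simp
  | succ i ih =>
    rw [zpow_add_one, Units.val_mul, ih, hU]
    push_cast
    linear_combination (i * g ^ 2) * hp
  | pred i ih =>
    rw [zpow_sub_one, Units.val_mul, ih, hinv]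
    push_cast
    linear_combination (i * g ^ 2) * hp

end Binomial

theorem dvd_and_dvd_of_det {p : ℕ} (hp : p.Prime) {a b α₁ β₁ α₂ β₂ : ℤ}
    (h1 : (p : ℤ) ∣ a * α₁ + b * β₁) (h2 : (p : ℤ) ∣ a * α₂ + b * β₂)
    (hdet : ¬ (p : ℤ) ∣ α₁ * β₂ - β₁ * α₂) : (p : ℤ) ∣ a ∧ (p : ℤ) ∣ b := by
  have hp' := Nat.prime_iff_prime_int.mp hp
  constructor
  · refine (hp'.dvd_or_dvd (a := a) (b := α₁ * β₂ - β₁ * α₂) ?_).resolve_right hdet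
    have : a * (α₁ * β₂ - β₁ * α₂) = (a * α₁ + b * β₁) * β₂ - (a * α₂ + b * β₂) * β₁ := by ring
    rw [this]
    exact dvd_sub (h1.mul_right _) (h2.mul_right _)
  · refine (hp'.dvd_or_dvd (a := b) (b := α₁ * β₂ - β₁ * α₂) ?_).resolve_right hdet
    have : b * (α₁ * β₂ - β₁ * α₂) = (a * α₂ + b * β₂) * α₁ - (a * α₁ + b * β₁) * α₂ := by ring
    rw [this]
    exact dvd_sub (h2.mul_right _) (h1.mul_right _)

namespace Quartic

variable {s t : ℤ}

theorem natCast_mul_eq {R : Type*} [CommRing R] (n : ℕ) (x : Quartic R s t) :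
    (n : Quartic R s t) * x = ⟨n * x.c0, n * x.c1, n * x.c2, n * x.c3⟩ := by
  rw [natCast_def]
  ext <;> simp [mul_def]

theorem natCast_dvd_iff {n : ℕ} {x : Quartic ℤ s t} : (n : Quartic ℤ s t) ∣ x ↔
    (n : ℤ) ∣ x.c0 ∧ (n : ℤ) ∣ x.c1 ∧ (n : ℤ) ∣ x.c2 ∧ (n : ℤ) ∣ x.c3 := by
  constructor
  · rintro ⟨y, rfl⟩
    simp [natCast_mul_eq]
  · rintro ⟨⟨a, ha⟩, ⟨b, hb⟩, ⟨c, hc⟩, ⟨d, hd⟩⟩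
    exact ⟨⟨a, b, c, d⟩, by rw [natCast_mul_eq]; ext <;> assumption⟩

/-- Reduction modulo `n`. -/
def red (s t : ℤ) (n : ℕ) : Quartic ℤ s t →+* Quartic (ZMod n) s t := map (Int.castRingHom _)

theorem red_eq_zero_iff {n : ℕ} {x : Quartic ℤ s t} :
    red s t n x = 0 ↔ (n : Quartic ℤ s t) ∣ x := by
  rw [natCast_dvd_iff, Quartic.ext_iff]
  simp [red, map, ← CharP.intCast_eq_zero_iff (ZMod n) n]

theorem dvd_of_mul_dvd_mul {m n : ℕ} (hm : m ≠ 0) {x : Quartic ℤ s t}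
    (h : ((m * n : ℕ) : Quartic ℤ s t) ∣ m * x) : (n : Quartic ℤ s t) ∣ x := by
  rw [natCast_dvd_iff, natCast_mul_eq] at h
  rw [natCast_dvd_iff]
  have hm' : (m : ℤ) ≠ 0 := by exact_mod_cast hm
  simpa [mul_dvd_mul_iff_left hm'] using h

theorem natCast_dvd_map {n : ℕ} {x : Quartic ℤ s t} (f : Quartic ℤ s t →+ ℤ)
    (h : (n : Quartic ℤ s t) ∣ x) : (n : ℤ) ∣ f x := by
  obtain ⟨y, rfl⟩ := h
  exact ⟨f y, by rw [← nsmul_eq_mul, map_nsmul, nsmul_eq_mul]⟩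

theorem eq_zero_of_forall_dvd {p : ℕ} (hp : 1 < p) {x : Quartic ℤ s t}
    (h : ∀ k : ℕ, ((p ^ k : ℕ) : Quartic ℤ s t) ∣ x) : x = 0 := by
  have key (a : ℤ) (ha : ∀ k : ℕ, ((p ^ k : ℕ) : ℤ) ∣ a) : a = 0 := by
    by_contra ha0
    have h1 := Nat.le_of_dvd (Int.natAbs_pos.mpr ha0) (Int.natCast_dvd.mp (ha a.natAbs))
    exact absurd (Nat.lt_pow_self hp (n := a.natAbs)) (by omega)
  simp only [natCast_dvd_iff] at h
  ext
  · exact key _ fun k => (h k).1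
  · exact key _ fun k => (h k).2.1
  · exact key _ fun k => (h k).2.2.1
  · exact key _ fun k => (h k).2.2.2

/-- Fermat's little theorem, when all roots modulo `p` are rational and distinct. -/
theorem pow_prime_eq_self {p : ℕ} [Fact p.Prime]
    (hgen : gen (ZMod p) s t ^ p = gen (ZMod p) s t) (x : Quartic (ZMod p) s t) : x ^ p = x := by
  have : CharP (Quartic (ZMod p) s t) p :=
    charP_of_injective_ringHom (const_injective (R := ZMod p) (s := s) (t := t)) p
  have hc (c : ZMod p) : const (ZMod p) s t c ^ p = const (ZMod p) s t c := by
    rw [← map_pow, ZMod.pow_card]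
  rw [eq_sum x]
  simp only [add_pow_char, mul_pow, hc, ← pow_mul, mul_comm _ p]
  simp only [pow_mul, hgen]

theorem red_units_pow {p : ℕ} [Fact p.Prime]
    (hgen : gen (ZMod p) s t ^ p = gen (ZMod p) s t) (x : (Quartic ℤ s t)ˣ) :
    red s t p x ^ (p - 1) = 1 := by
  have hu : IsUnit (red s t p x) := x.isUnit.map _
  refine hu.mul_right_cancel ?_
  rw [one_mul, ← pow_succ, Nat.sub_add_cancel (Fact.out : p.Prime).one_le, pow_prime_eq_self hgen]

end Quartic

theorem exists_unit_decomposition {O : Type*} [CommRing O] (φ : O →+* ℝ)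
    (hφ : Function.Injective φ)
    (hrel : ∀ x : Fin 3 → Oˣ, ∃ e : Fin 3 → ℤ, e ≠ 0 ∧ ∏ i, x i ^ e i = 1) {u v : Oˣ} {q : ℕ}
    (hq : q.Prime) (hind : ∀ (a b : ℤ) (x σ : Oˣ), σ ^ 2 = 1 → u ^ a * v ^ b = σ * x ^ q →
      (q : ℤ) ∣ a ∧ (q : ℤ) ∣ b) (w : Oˣ) :
    ∃ (σ : Oˣ) (i j : ℤ) (y : Oˣ), σ ^ 2 = 1 ∧ w = σ * (u ^ i * v ^ j) * y ^ q := by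
  refine exists_eq_zpow_mul_zpow_mul_pow hq ?_ hind
  obtain ⟨e, he, hd⟩ := isUnit_relation_coprime φ hφ (hrel ![w, u, v]) hq
  rw [Fin.prod_univ_three] at he
  exact ⟨e 0, e 1, e 2, he, fun h => hd (Fin.forall_fin_succ.mpr ⟨h.1, Fin.forall_fin_two.mpr h.2⟩)⟩

namespace Quartic

variable {s t : ℤ}

/-- The data needed for Skolem's `p`-adic method with the pair of units `u`, `v`: the prime `p`
splits completely, `u ^ (p - 1) ≡ 1 + p gu` and `v ^ (p - 1) ≡ 1 + p gv` modulo `p ^ 2`, and the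
unit group has rank at most two and a real embedding. -/
structure IsSkolemPair (p : ℕ) (u v : (Quartic ℤ s t)ˣ) (gu gv : Quartic ℤ s t) : Prop where
  prime : p.Prime
  odd : Odd p
  gen_pow : gen (ZMod p) s t ^ p = gen (ZMod p) s t
  u_pow : red s t (p ^ 2) u ^ (p - 1) = 1 + (p : Quartic (ZMod (p ^ 2)) s t) * red s t (p ^ 2) gu
  v_pow : red s t (p ^ 2) v ^ (p - 1) = 1 + (p : Quartic (ZMod (p ^ 2)) s t) * red s t (p ^ 2) gv
  real : ∃ φ : Quartic ℤ s t →+* ℝ, Function.Injective φ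
  rel : ∀ x : Fin 3 → (Quartic ℤ s t)ˣ, ∃ e : Fin 3 → ℤ, e ≠ 0 ∧ ∏ i, x i ^ e i = 1

namespace IsSkolemPair

variable {p : ℕ} {u v : (Quartic ℤ s t)ˣ} {gu gv : Quartic ℤ s t}

theorem eq_one_or_neg_one_of_sq (S : IsSkolemPair p u v gu gv) {σ : (Quartic ℤ s t)ˣ}
    (h : σ ^ 2 = 1) : σ = 1 ∨ σ = -1 := by
  obtain ⟨φ, hφ⟩ := S.real
  have h' : (σ : Quartic ℤ s t) ^ 2 = 1 := by rw [← Units.val_pow_eq_pow_val, h, Units.val_one]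
  refine (eq_one_or_neg_one_of_pow_eq_one φ hφ two_ne_zero h').imp (fun h => ?_) fun h => ?_ <;>
    ext1 <;> simpa using h

theorem exists_decomposition (S : IsSkolemPair p u v gu gv) {q : ℕ} (hq : q.Prime)
    (hind : ∀ (a b : ℤ) (x σ : (Quartic ℤ s t)ˣ), σ ^ 2 = 1 → u ^ a * v ^ b = σ * x ^ q →
      (q : ℤ) ∣ a ∧ (q : ℤ) ∣ b) (w : (Quartic ℤ s t)ˣ) :
    ∃ (σ : (Quartic ℤ s t)ˣ) (i j : ℤ) (y : (Quartic ℤ s t)ˣ),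
      σ ^ 2 = 1 ∧ w = σ * (u ^ i * v ^ j) * y ^ q := by
  obtain ⟨φ, hφ⟩ := S.real
  exact exists_unit_decomposition φ hφ S.rel hq hind w

theorem exists_eq_one_add (n : ℕ) {x : Quartic ℤ s t} (h : red s t n x = 1) :
    ∃ γ, x = 1 + n * γ := by
  obtain ⟨γ, hγ⟩ := red_eq_zero_iff.mp
    (show red s t n (x - 1) = 0 by rw [map_sub, h, map_one, sub_self])
  exact ⟨γ, by rw [← hγ]; ring⟩

theorem dvd_sub_of_eq (S : IsSkolemPair p u v gu gv) {w σ y : (Quartic ℤ s t)ˣ} {i j : ℤ}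
    {γ : Quartic ℤ s t} (hσ : σ ^ 2 = 1) (hw : w = σ * (u ^ i * v ^ j) * y ^ p)
    (hγ : (w : Quartic ℤ s t) = 1 + p * γ) :
    (p : Quartic ℤ s t) ∣ (p - 1 : ℕ) * γ - (i * gu + j * gv) := by
  have : Fact p.Prime := ⟨S.prime⟩
  obtain ⟨δ, hδ⟩ := exists_eq_one_add p (x := (y : Quartic ℤ s t) ^ (p - 1)) <| by
    rw [map_pow, red_units_pow S.gen_pow]
  set f := red s t (p ^ 2) with hf
  have hp2 : (p : Quartic (ZMod (p ^ 2)) s t) ^ 2 = 0 := by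
    rw [← Nat.cast_pow, natCast_def, ZMod.natCast_self]
    rfl
  have heven : Even (p - 1) := by
    obtain ⟨m, hm⟩ := S.odd
    exact ⟨m, by omega⟩
  have hσN : σ ^ (p - 1) = 1 := by
    obtain ⟨m, hm⟩ := heven
    rw [hm, ← two_mul, pow_mul, hσ, one_pow]
  have hwN : w ^ (p - 1) = (u ^ (p - 1)) ^ i * (v ^ (p - 1)) ^ j * (y ^ (p - 1)) ^ p := by
    rw [hw, mul_pow, mul_pow, mul_pow, hσN, one_mul]
    simp only [← zpow_natCast, ← zpow_mul, mul_comm]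
  have hE := congrArg (fun z : (Quartic ℤ s t)ˣ =>
    (Units.map (f : Quartic ℤ s t →* Quartic (ZMod (p ^ 2)) s t) z).val) hwN
  simp only [map_mul, map_zpow, Units.val_mul] at hE
  rw [val_zpow_eq_one_add hp2 (g := f gu) (by simpa using S.u_pow),
    val_zpow_eq_one_add hp2 (g := f gv) (by simpa using S.v_pow), map_pow,
    ← zpow_natCast, val_zpow_eq_one_add hp2 (g := f γ) (by simp [hγ]),
    map_pow, map_pow, Units.val_pow_eq_pow_val, Units.val_pow_eq_pow_val, Units.coe_map] at hE
  have hy : (f y ^ (p - 1)) ^ p = 1 := by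
    obtain ⟨z, hz⟩ := one_add_mul_pow_prime_pow S.odd (f δ) 1
    rw [← map_pow, hδ, map_add, map_mul, map_one, map_natCast]
    rw [pow_one] at hz
    rw [hz]
    linear_combination (f δ + p * z) * hp2
  simp only [MonoidHom.coe_coe] at hE
  rw [hy, mul_one] at hE
  refine dvd_of_mul_dvd_mul S.prime.ne_zero (m := p) ?_
  rw [← pow_two, ← red_eq_zero_iff, ← hf]
  simp only [map_mul, map_sub, map_add, map_natCast, map_intCast]
  push_cast at hE
  linear_combination hE + (i * f gu * j * f gv) * hp2

section Functionals

variable {ℓ₁ ℓ₂ : Quartic ℤ s t →+ ℤ}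

theorem dvd_and_dvd_of_functionals (S : IsSkolemPair p u v gu gv)
    (hdet : ¬ (p : ℤ) ∣ ℓ₁ gu * ℓ₂ gv - ℓ₁ gv * ℓ₂ gu) {w σ y : (Quartic ℤ s t)ˣ} {i j : ℤ}
    {γ : Quartic ℤ s t} (hσ : σ ^ 2 = 1) (hw : w = σ * (u ^ i * v ^ j) * y ^ p)
    (hγ : (w : Quartic ℤ s t) = 1 + p * γ) (h₁ : (p : ℤ) ∣ ℓ₁ γ) (h₂ : (p : ℤ) ∣ ℓ₂ γ) :
    (p : ℤ) ∣ i ∧ (p : ℤ) ∣ j := by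
  have hdvd := S.dvd_sub_of_eq hσ hw hγ
  have key (ℓ : Quartic ℤ s t →+ ℤ) (h : (p : ℤ) ∣ ℓ γ) : (p : ℤ) ∣ i * ℓ gu + j * ℓ gv := by
    have h3 := natCast_dvd_map ℓ hdvd
    rw [← nsmul_eq_mul, ← zsmul_eq_mul, ← zsmul_eq_mul, map_sub, map_add, map_nsmul, map_zsmul,
      map_zsmul, nsmul_eq_mul, zsmul_eq_mul, zsmul_eq_mul] at h3
    exact (dvd_sub_right (h.mul_left _)).mp h3
  exact dvd_and_dvd_of_det S.prime (key ℓ₁ h₁) (key ℓ₂ h₂) hdet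

theorem exists_decomposition_prime (S : IsSkolemPair p u v gu gv)
    (hdet : ¬ (p : ℤ) ∣ ℓ₁ gu * ℓ₂ gv - ℓ₁ gv * ℓ₂ gu) (w : (Quartic ℤ s t)ˣ) :
    ∃ (σ : (Quartic ℤ s t)ˣ) (i j : ℤ) (y : (Quartic ℤ s t)ˣ),
      σ ^ 2 = 1 ∧ w = σ * (u ^ i * v ^ j) * y ^ p := by
  refine S.exists_decomposition S.prime (fun a b x σ hσ h => ?_) w
  refine S.dvd_and_dvd_of_functionals hdet (w := 1) (σ := σ⁻¹) (y := x⁻¹) (γ := 0)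
    (by rw [inv_pow, hσ, inv_one]) ?_ (by simp) (by simp) (by simp)
  rw [h, inv_mul_cancel_left, inv_pow, mul_inv_cancel]

theorem exists_eq_mul_pow_prime_pow (S : IsSkolemPair p u v gu gv)
    (hdet : ¬ (p : ℤ) ∣ ℓ₁ gu * ℓ₂ gv - ℓ₁ gv * ℓ₂ gu) (h₁ : ℓ₁ 1 = 0) (h₂ : ℓ₂ 1 = 0)
    {x : (Quartic ℤ s t)ˣ} (hx : red s t p x = 1 ∨ red s t p x = -1) (hx₁ : ℓ₁ x = 0)
    (hx₂ : ℓ₂ x = 0) (k : ℕ) :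
    ∃ σ w : (Quartic ℤ s t)ˣ, σ ^ 2 = 1 ∧ x = σ * w ^ p ^ k ∧ red s t p w = 1 := by
  induction k with
  | zero =>
    rcases hx with hx | hx
    · exact ⟨1, x, by simp, by simp, hx⟩
    · exact ⟨-1, -x, by simp, by simp, by simp [hx]⟩
  | succ k ih =>
    have : Fact p.Prime := ⟨S.prime⟩
    obtain ⟨σ, w, hσ, hxw, hw⟩ := ih
    obtain ⟨γ, hγ⟩ := exists_eq_one_add p hw
    obtain ⟨δ, hδ⟩ := one_add_mul_pow_prime_pow S.odd γ k
    have key (ℓ : Quartic ℤ s t →+ ℤ) (h : ℓ 1 = 0) (hℓ : ℓ x = 0) : (p : ℤ) ∣ ℓ γ := by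
      have h3 : ℓ (w ^ p ^ k : (Quartic ℤ s t)ˣ) = 0 := by
        rcases S.eq_one_or_neg_one_of_sq hσ with rfl | rfl
        · rw [one_mul] at hxw; rwa [← hxw]
        · have : w ^ p ^ k = -x := by rw [hxw]; simp
          rw [this, Units.val_neg, map_neg, hℓ, neg_zero]
      have h4 : (1 : Quartic ℤ s t) + p ^ (k + 1) * γ + p ^ (k + 2) * δ =
          1 + (p ^ (k + 1) : ℕ) • (γ + p • δ) := by
        simp only [nsmul_eq_mul]; push_cast; ring
      rw [Units.val_pow_eq_pow_val, hγ, hδ, h4, map_add, h, zero_add, map_nsmul, nsmul_eq_mul,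
        mul_eq_zero, map_add, map_nsmul, nsmul_eq_mul] at h3
      have h5 := h3.resolve_left (by exact_mod_cast (pow_pos S.prime.pos _).ne')
      exact ⟨-ℓ δ, by linarith⟩
    obtain ⟨τ, i, j, y, hτ, hwτ⟩ := S.exists_decomposition_prime hdet w
    obtain ⟨⟨i, rfl⟩, ⟨j, rfl⟩⟩ :=
      S.dvd_and_dvd_of_functionals hdet hτ hwτ hγ (key ℓ₁ h₁ hx₁) (key ℓ₂ h₂ hx₂)
    have hτp : τ ^ p = τ := by
      rcases S.eq_one_or_neg_one_of_sq hτ with rfl | rfl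
      · simp
      · exact S.odd.neg_one_pow
    have hw' : w = (τ * (u ^ i * v ^ j * y)) ^ p := by
      rw [mul_pow, hτp, mul_pow, mul_pow, hwτ, mul_comm (p : ℤ) i, mul_comm (p : ℤ) j, zpow_mul,
        zpow_mul, zpow_natCast, zpow_natCast, mul_assoc]
    refine ⟨σ, τ * (u ^ i * v ^ j * y), hσ, ?_, ?_⟩
    · rw [hxw, hw', ← pow_mul, ← pow_succ']
    · rw [← pow_prime_eq_self S.gen_pow (red s t p _), ← map_pow, ← Units.val_pow_eq_pow_val,
        ← hw', hw]

/-- Skolem's method: a unit congruent to `±1` modulo `p` and killed by two functionals killing `1`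
is `±1`, if the functionals are independent on the logarithms of `u` and `v` modulo `p`. -/
theorem eq_one_or_neg_one (S : IsSkolemPair p u v gu gv)
    (hdet : ¬ (p : ℤ) ∣ ℓ₁ gu * ℓ₂ gv - ℓ₁ gv * ℓ₂ gu) (h₁ : ℓ₁ 1 = 0) (h₂ : ℓ₂ 1 = 0)
    {x : (Quartic ℤ s t)ˣ} (hx : red s t p x = 1 ∨ red s t p x = -1) (hx₁ : ℓ₁ x = 0)
    (hx₂ : ℓ₂ x = 0) : x = 1 ∨ x = -1 := by
  refine S.eq_one_or_neg_one_of_sq ?_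
  have h0 : (x : Quartic ℤ s t) ^ 2 - 1 = 0 := by
    refine eq_zero_of_forall_dvd S.prime.one_lt fun k => ?_
    obtain ⟨σ, w, hσ, hxw, hw⟩ := S.exists_eq_mul_pow_prime_pow hdet h₁ h₂ hx hx₁ hx₂ k
    obtain ⟨γ, hγ⟩ := exists_eq_one_add p hw
    obtain ⟨δ, hδ⟩ := one_add_mul_pow_prime_pow S.odd γ k
    have h3 : (x : Quartic ℤ s t) ^ 2 = ((w : Quartic ℤ s t) ^ p ^ k) ^ 2 := by
      have := congrArg (fun z : (Quartic ℤ s t)ˣ => (z : Quartic ℤ s t))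
        (show x ^ 2 = (w ^ p ^ k) ^ 2 by rw [hxw, mul_pow, hσ, one_mul])
      simpa using this
    rw [h3, hγ, hδ]
    refine ⟨(p * γ + p ^ 2 * δ) * (2 + p ^ (k + 1) * γ + p ^ (k + 2) * δ), ?_⟩
    push_cast
    ring
  ext1
  simpa [sub_eq_zero] using h0

end Functionals
end IsSkolemPair
end Quartic

/-- Detecting exponents divisible by `q` with a `q`-th power residue character. -/
theorem dvd_of_residue {O : Type*} [CommRing O] {q l E : ℕ} [Fact l.Prime] (hq : q.Prime)
    (hE : l - 1 = q * E) (hEven : Even E) (f : O →+* ZMod l) {u v x σ : Oˣ} {a b : ℤ}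
    (hu : f u ^ E = 1) (hv : f v ^ E ≠ 1) (hσ : σ ^ 2 = 1) (h : u ^ a * v ^ b = σ * x ^ q) :
    (q : ℤ) ∣ b := by
  have hpow (y : Oˣ) : (Units.map (f : O →* ZMod l) y ^ E) ^ q = 1 := by
    rw [← pow_mul, mul_comm, ← hE, ZMod.units_pow_card_sub_one_eq_one]
  have hu' : Units.map (f : O →* ZMod l) u ^ E = 1 := by
    ext1
    simpa using hu
  have hv' : Units.map (f : O →* ZMod l) v ^ E ≠ 1 := fun h1 => hv <| by
    simpa using congrArg Units.val h1
  have hσ' : σ ^ E = 1 := by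
    obtain ⟨m, hm⟩ := hEven
    rw [hm, ← two_mul, pow_mul, hσ, one_pow]
  have : Fact q.Prime := ⟨hq⟩
  rw [← orderOf_eq_prime (hpow v) hv', orderOf_dvd_iff_zpow_eq_one]
  have h1 := congrArg (fun z => Units.map (f : O →* ZMod l) z ^ E) h
  simp only [map_mul, mul_pow, map_zpow, map_pow] at h1
  rw [← map_pow _ σ, hσ', map_one, one_mul, ← pow_mul, mul_comm q, pow_mul, hpow] at h1
  have hcomm (z : (ZMod l)ˣ) (c : ℤ) : (z ^ c) ^ E = (z ^ E) ^ c := by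
    rw [← zpow_natCast, ← zpow_mul, mul_comm, zpow_mul, zpow_natCast]
  rwa [hcomm, hcomm, hu', one_zpow, one_mul] at h1

namespace Quartic

/-- The kernel-friendly product modulo `p`, where `S` and `T` represent `-s` and `-t`. -/
def natMul {s t : ℤ} (p S T : ℕ) (x y : Quartic ℕ s t) : Quartic ℕ s t :=
  let e4 := x.c1 * y.c3 + x.c2 * y.c2 + x.c3 * y.c1
  let e5 := x.c2 * y.c3 + x.c3 * y.c2
  let e6 := x.c3 * y.c3
  let f5 := e5 + S * e6
  let f4 := e4 + S * f5 + T * e6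
  ⟨(x.c0 * y.c0 + 2 * f4) % p,
    (x.c0 * y.c1 + x.c1 * y.c0 + (p - 2) * f4 + 2 * f5) % p,
    (x.c0 * y.c2 + x.c1 * y.c1 + x.c2 * y.c0 + T * f4 + (p - 2) * f5 + 2 * e6) % p,
    (x.c0 * y.c3 + x.c1 * y.c2 + x.c2 * y.c1 + x.c3 * y.c0 + S * f4 + T * f5 + (p - 2) * e6) % p⟩

/-- Evaluate the argument before passing it on. -/
def forceNat {α : Type*} (n : ℕ) (f : ℕ → α) : α := Nat.rec (f 0) (fun k _ => f k.succ) n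

theorem forceNat_eq {α : Type*} (n : ℕ) (f : ℕ → α) : forceNat n f = f n := by
  cases n <;> rfl

def force {α : Type*} {s t : ℤ} (x : Quartic ℕ s t) (f : Quartic ℕ s t → α) : α :=
  forceNat x.c0 fun a => forceNat x.c1 fun b => forceNat x.c2 fun c => forceNat x.c3 fun d =>
    f ⟨a, b, c, d⟩

theorem force_eq {α : Type*} {s t : ℤ} (x : Quartic ℕ s t) (f : Quartic ℕ s t → α) :
    force x f = f x := by
  simp [force, forceNat_eq]

/-- The elements `y, y * v, …, y * v ^ (n - 1)`, in front of a list. -/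
def natPowers {s t : ℤ} (p S T : ℕ) (v : Quartic ℕ s t) :
    ℕ → Quartic ℕ s t → List (Quartic ℕ s t) → List (Quartic ℕ s t)
  | 0, _, l => l
  | n + 1, y, l => force (natMul p S T y v) fun y' => natPowers p S T v n y' (y :: l)

/-- The linear form with coefficients `l`. -/
def natForm {s t : ℤ} (p : ℕ) (l y : Quartic ℕ s t) : ℕ :=
  (l.c0 * y.c0 + l.c1 * y.c1 + l.c2 * y.c2 + l.c3 * y.c3) % p

/-- The linear form `y ↦ l (x * y)`. -/
def natFormMul {s t : ℤ} (p S T : ℕ) (l x : Quartic ℕ s t) : Quartic ℕ s t :=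
  ⟨natForm p l x, natForm p l (natMul p S T x ⟨0, 1, 0, 0⟩),
    natForm p l (natMul p S T x ⟨0, 0, 1, 0⟩), natForm p l (natMul p S T x ⟨0, 0, 0, 1⟩)⟩

def natCheck {s t : ℤ} (p S T : ℕ) (l₁ l₂ : Quartic ℕ s t) (good : List (Quartic ℕ s t))
    (xs ys : List (Quartic ℕ s t)) : Bool :=
  xs.all fun x => force (natFormMul p S T l₁ x) fun l => ys.all fun y =>
    Nat.rec (Nat.rec (good.contains (natMul p S T x y)) (fun _ _ => true)
      (natForm p l₂ (natMul p S T x y))) (fun _ _ => true) (natForm p l y)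

/-- The standard bilinear form. -/
def form {R : Type*} [CommRing R] {s t : ℤ} (l : Quartic R s t) : Quartic R s t →+ R where
  toFun y := l.c0 * y.c0 + l.c1 * y.c1 + l.c2 * y.c2 + l.c3 * y.c3
  map_zero' := by simp
  map_add' x y := by simp; ring

theorem form_apply {R : Type*} [CommRing R] {s t : ℤ} (l y : Quartic R s t) :
    form l y = l.c0 * y.c0 + l.c1 * y.c1 + l.c2 * y.c2 + l.c3 * y.c3 := rfl

/-- Reduction of natural number coordinates. -/
def natRed {s t : ℤ} (p : ℕ) (x : Quartic ℕ s t) : Quartic (ZMod p) s t :=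
  ⟨x.c0, x.c1, x.c2, x.c3⟩

section NatCheck

variable {s t : ℤ} {p S T : ℕ}

theorem form_red (l y : Quartic ℤ s t) :
    form (red s t p l) (red s t p y) = (form l y : ZMod p) := by
  simp [form_apply, red, map]

theorem natRed_natMul (hp : 2 ≤ p) (hS : (S : ZMod p) = -s) (hT : (T : ZMod p) = -t)
    (x y : Quartic ℕ s t) : natRed p (natMul p S T x y) = natRed p x * natRed p y := by
  ext <;> simp only [natRed, natMul, mul_def, ZMod.natCast_mod] <;> push_cast [hp] <;>
    simp only [hS, hT, CharP.cast_eq_zero] <;> ring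

theorem mem_natPowers_of_mem {v x : Quartic ℕ s t} (n : ℕ) (y : Quartic ℕ s t)
    (l : List (Quartic ℕ s t)) (h : x ∈ l) : x ∈ natPowers p S T v n y l := by
  induction n generalizing y l with
  | zero => exact h
  | succ n ih =>
    rw [natPowers, force_eq]
    exact ih _ _ (List.mem_cons_of_mem _ h)

theorem exists_mem_natPowers (hp : 2 ≤ p) (hS : (S : ZMod p) = -s) (hT : (T : ZMod p) = -t)
    (v : Quartic ℕ s t) {k n : ℕ} (hk : k < n) (y : Quartic ℕ s t) (l : List (Quartic ℕ s t)) :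
    ∃ x ∈ natPowers p S T v n y l, natRed p x = natRed p y * natRed p v ^ k := by
  induction n generalizing y l k with
  | zero => omega
  | succ n ih =>
    rw [natPowers, force_eq]
    cases k with
    | zero => exact ⟨y, mem_natPowers_of_mem _ _ _ List.mem_cons_self, by simp⟩
    | succ k =>
      obtain ⟨x, hx, h⟩ := ih (k := k) (by omega) (natMul p S T y v) (y :: l)
      exact ⟨x, hx, by rw [h, natRed_natMul hp hS hT, pow_succ']; ring⟩

theorem natCast_natForm (l y : Quartic ℕ s t) :
    (natForm p l y : ZMod p) = form (natRed p l) (natRed p y) := by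
  simp [natForm, form_apply, natRed]

theorem natForm_eq_zero {l y : Quartic ℕ s t} (h : form (natRed p l) (natRed p y) = 0) :
    natForm p l y = 0 := by
  rw [← natCast_natForm, ZMod.natCast_eq_zero_iff] at h
  rw [natForm] at h ⊢
  rwa [Nat.dvd_mod_iff dvd_rfl, Nat.dvd_iff_mod_eq_zero] at h

theorem form_natFormMul (hp : 2 ≤ p) (hS : (S : ZMod p) = -s) (hT : (T : ZMod p) = -t)
    (l x : Quartic ℕ s t) (y : Quartic (ZMod p) s t) :
    form (natRed p (natFormMul p S T l x)) y = form (natRed p l) (natRed p x * y) := by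
  rw [form_apply]
  simp only [natFormMul]
  conv_lhs => simp only [natRed]
  simp only [natCast_natForm, natRed_natMul hp hS hT]
  simp only [form_apply, natRed, mul_def]
  push_cast
  ring

theorem exists_of_natCheck (hp : 2 ≤ p) (hS : (S : ZMod p) = -s) (hT : (T : ZMod p) = -t)
    {l₁ l₂ : Quartic ℕ s t} {good xs ys : List (Quartic ℕ s t)}
    (h : natCheck p S T l₁ l₂ good xs ys = true) {x y : Quartic ℕ s t} (hx : x ∈ xs) (hy : y ∈ ys)
    (h₁ : form (natRed p l₁) (natRed p x * natRed p y) = 0)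
    (h₂ : form (natRed p l₂) (natRed p x * natRed p y) = 0) :
    ∃ g ∈ good, natRed p x * natRed p y = natRed p g := by
  have h := List.all_eq_true.mp h x hx
  rw [force_eq] at h
  have h := List.all_eq_true.mp h y hy
  rw [← form_natFormMul hp hS hT] at h₁
  rw [← natRed_natMul hp hS hT] at h₂ ⊢
  rw [natForm_eq_zero h₁, natForm_eq_zero h₂] at h
  exact ⟨_, List.contains_iff_mem.mp h, rfl⟩

end NatCheck

section Parity

variable {s t : ℤ}

theorem c0_units (x : (Quartic ℤ s t)ˣ) : ((x : Quartic ℤ s t).c0 : ZMod 2) = 1 := by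
  have h := congrArg (fun z : Quartic ℤ s t => (z.c0 : ZMod 2)) x.mul_inv
  have h2 : (2 : ZMod 2) = 0 := rfl
  simp only [mul_def, one_c0] at h
  push_cast [h2] at h
  rw [zero_mul, add_zero] at h
  generalize ((x : Quartic ℤ s t).c0 : ZMod 2) = a at h ⊢
  revert h
  generalize (((x⁻¹ : (Quartic ℤ s t)ˣ) : Quartic ℤ s t).c0 : ZMod 2) = b
  revert a b
  decide

/-- The parity of the coefficient `c1` of a unit. -/
def parity : (Quartic ℤ s t)ˣ →* Multiplicative (ZMod 2) where
  toFun x := .ofAdd ((x : Quartic ℤ s t).c1 : ZMod 2)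
  map_one' := by simp
  map_mul' x y := by
    have h2 : (2 : ZMod 2) = 0 := rfl
    rw [← ofAdd_add, Units.val_mul, mul_def]
    push_cast [h2, c0_units]
    congr 1
    ring

theorem parity_eq_one_of_sq {σ : (Quartic ℤ s t)ˣ} (h : σ = 1 ∨ σ = -1) : parity σ = 1 := by
  rcases h with rfl | rfl
  · exact map_one _
  · simp [parity]

theorem c1_eq {σ u v y : (Quartic ℤ s t)ˣ} {i j : ℤ} {N : ℕ} (hσ : σ = 1 ∨ σ = -1) (hN : Even N) :
    (((σ * (u ^ i * v ^ j) * y ^ N : (Quartic ℤ s t)ˣ) : Quartic ℤ s t).c1 : ZMod 2) =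
      i * (u : Quartic ℤ s t).c1 + j * (v : Quartic ℤ s t).c1 := by
  have h : parity (σ * (u ^ i * v ^ j) * y ^ N) = parity u ^ i * parity v ^ j := by
    obtain ⟨m, rfl⟩ := hN
    have h2 (z : Multiplicative (ZMod 2)) : z ^ (m + m) = 1 := by
      rw [pow_add, ← mul_pow]
      have : z * z = 1 := by revert z; decide
      rw [this, one_pow]
    rw [map_mul, map_mul, parity_eq_one_of_sq hσ, one_mul, map_pow, h2, mul_one, map_mul, map_zpow,
      map_zpow]
  have h' := congrArg Multiplicative.toAdd h
  simpa [parity] using h'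

end Parity

end Quartic

/-- The units `u` and `v` generate all units modulo `n`-th powers and elements of order two. -/
def GeneratesModPow {O : Type*} [CommRing O] (u v : Oˣ) (n : ℕ) : Prop :=
  ∀ w : Oˣ, ∃ (σ : Oˣ) (i j : ℤ) (y : Oˣ), σ ^ 2 = 1 ∧ w = σ * (u ^ i * v ^ j) * y ^ n

theorem GeneratesModPow.mul {O : Type*} [CommRing O] {u v : Oˣ} {m n : ℕ}
    (hm : GeneratesModPow u v m) (hn : GeneratesModPow u v n) : GeneratesModPow u v (m * n) :=
  exists_eq_mul_pow_mul hm hn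

theorem exists_map_zpow_eq {O R : Type*} [CommRing O] [CommRing R] (f : O →+* R) {w : Oˣ} {m : ℕ}
    (hm : m ≠ 0) (h : f w ^ m = 1) (k : ℤ) :
    ∃ k' < m, f (w ^ k : Oˣ) = f w ^ k' := by
  have hm' : (m : ℤ) ≠ 0 := by exact_mod_cast hm
  have hnn := Int.emod_nonneg k hm'
  have hlt := Int.emod_lt_of_pos k (by omega : (0 : ℤ) < m)
  refine ⟨(k % m).toNat, by omega, ?_⟩
  have hU : Units.map (f : O →* R) w ^ m = 1 := by
    ext1
    simpa using h
  have hk : Units.map (f : O →* R) (w ^ k) = Units.map (f : O →* R) w ^ (k % m).toNat := by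
    rw [map_zpow, ← zpow_natCast, Int.toNat_of_nonneg hnn]
    nth_rewrite 1 [← Int.emod_add_mul_ediv k m]
    rw [zpow_add, zpow_mul, zpow_natCast, hU, one_zpow, mul_one]
  have := congrArg Units.val hk
  rwa [Units.val_pow_eq_pow_val] at this

namespace Quartic

namespace IsSkolemPair

variable {s t : ℤ} {p : ℕ} {u v : (Quartic ℤ s t)ˣ} {gu gv : Quartic ℤ s t}

/-- A unit killed by two functionals is determined, up to sign, by its residue. -/
theorem eq_or_eq_neg (S : IsSkolemPair p u v gu gv) {l₁ l₂ : Quartic ℤ s t}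
    {x y : (Quartic ℤ s t)ˣ} (hdet : ¬ (p : ℤ) ∣ form l₁ (y * gu) * form l₂ (y * gv) -
      form l₁ (y * gv) * form l₂ (y * gu)) (hx₁ : form l₁ x = 0) (hx₂ : form l₂ x = 0)
    (hy₁ : form l₁ y = 0) (hy₂ : form l₂ y = 0)
    (h : red s t p x = red s t p y ∨ red s t p x = -red s t p y) : x = y ∨ x = -y := by
  have hred : red s t p (y⁻¹ * x : (Quartic ℤ s t)ˣ) = 1 ∨
      red s t p (y⁻¹ * x : (Quartic ℤ s t)ˣ) = -1 := by
    rw [Units.val_mul, map_mul]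
    refine h.imp (fun h => ?_) fun h => ?_ <;> rw [h]
    · rw [← map_mul, Units.inv_mul, map_one]
    · rw [mul_neg, ← map_mul, Units.inv_mul, map_one]
  have := S.eq_one_or_neg_one (ℓ₁ := (form l₁).comp (AddMonoidHom.mulLeft (y : Quartic ℤ s t)))
    (ℓ₂ := (form l₂).comp (AddMonoidHom.mulLeft (y : Quartic ℤ s t))) hdet (by simpa using hy₁)
    (by simpa using hy₂) hred (by simpa using hx₁) (by simpa using hx₂)
  refine this.imp (fun h => ?_) fun h => ?_
  · exact (inv_mul_eq_one.mp h).symm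
  · rw [inv_mul_eq_iff_eq_mul] at h
    simpa using h

/-- The residues of units killed by two functionals, from a finite computation. -/
theorem exists_red_eq (S : IsSkolemPair p u v gu gv) {A B : ℕ} (hA : (A : ZMod p) = -s)
    (hB : (B : ZMod p) = -t) {L₁ L₂ X₀ Y₀ X₁ Y₁ : Quartic ℕ s t} {good : List (Quartic ℕ s t)}
    {m n : ℕ} (hcheck : natCheck p A B L₁ L₂ good (natPowers p A B X₁ m X₀ [])
      (natPowers p A B Y₁ n Y₀ []) = true)
    {l₁ l₂ : Quartic ℤ s t} {x₀ y₀ x₁ y₁ : (Quartic ℤ s t)ˣ} (hL₁ : natRed p L₁ = red s t p l₁)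
    (hL₂ : natRed p L₂ = red s t p l₂) (hX₀ : natRed p X₀ = red s t p x₀)
    (hY₀ : natRed p Y₀ = red s t p y₀) (hX₁ : natRed p X₁ = red s t p x₁)
    (hY₁ : natRed p Y₁ = red s t p y₁) (hm : m ≠ 0) (hxm : red s t p x₁ ^ m = 1) (hn : n ≠ 0)
    (hyn : red s t p y₁ ^ n = 1) {x σ y : (Quartic ℤ s t)ˣ} {k l : ℤ} (hσ : σ ^ 2 = 1)
    (hx : x = σ * (x₀ * x₁ ^ k * (y₀ * y₁ ^ l)) * y ^ (p - 1)) (h₁ : form l₁ x = 0)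
    (h₂ : form l₂ x = 0) :
    ∃ g ∈ good, red s t p x = natRed p g ∨ red s t p x = -natRed p g := by
  have : Fact p.Prime := ⟨S.prime⟩
  have hp := S.prime.two_le
  obtain ⟨k', hk', hk⟩ := exists_map_zpow_eq (red s t p) hm hxm k
  obtain ⟨l', hl', hl⟩ := exists_map_zpow_eq (red s t p) hn hyn l
  obtain ⟨a, ha, hak⟩ := exists_mem_natPowers hp hA hB X₁ hk' X₀ []
  obtain ⟨b, hb, hbl⟩ := exists_mem_natPowers hp hA hB Y₁ hl' Y₀ []
  have hab : red s t p x = natRed p a * natRed p b ∨ red s t p x = -(natRed p a * natRed p b) := by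
    have h : red s t p x = red s t p σ * (natRed p a * natRed p b) := by
      rw [hx, hak, hbl, hX₀, hY₀, hX₁, hY₁, ← hk, ← hl]
      simp only [Units.val_mul, Units.val_pow_eq_pow_val, map_mul, map_pow,
        red_units_pow S.gen_pow, mul_one]
    rw [h]
    rcases S.eq_one_or_neg_one_of_sq hσ with rfl | rfl <;> simp
  have key (l : Quartic ℤ s t) (L : Quartic ℕ s t) (hL : natRed p L = red s t p l)
      (h : form l x = 0) : form (natRed p L) (natRed p a * natRed p b) = 0 := by
    have h0 : form (red s t p l) (red s t p x) = 0 := by rw [form_red, h, Int.cast_zero]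
    rw [hL]
    rcases hab with h3 | h3 <;> simpa [h3] using h0
  obtain ⟨g, hg, hgab⟩ := exists_of_natCheck hp hA hB hcheck ha hb (key _ _ hL₁ h₁)
    (key _ _ hL₂ h₂)
  exact ⟨g, hg, by rwa [hgab] at hab⟩

end IsSkolemPair

end Quartic

namespace Quartic

section Irreducible

variable {s t : ℤ}

/-- Irreducibility of the defining polynomial, by excluding monic factors of degree at most two. -/
theorem irreducible_poly (h1 : ∀ r : ℤ, r ^ 4 + s * r ^ 3 + t * r ^ 2 + 2 * r - 2 ≠ 0)
    (h2 : ∀ a b c d : ℤ, a + c = s → b + d + a * c = t → a * d + b * c = 2 → b * d ≠ -2) :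
    Irreducible (poly s t) := by
  let f : ℤ[X] := X ^ 4 + C s * X ^ 3 + C t * X ^ 2 + 2 * X - 2
  have hf : f.Monic := by
    simp only [f]
    monicity!
  have hdeg : f.natDegree = 4 := by
    simp only [f]
    compute_degree!
  have hmap : poly s t = f.map (algebraMap ℤ ℚ) := by
    simp [poly, f]
  have heval (r : ℤ) : f.eval r = r ^ 4 + s * r ^ 3 + t * r ^ 2 + 2 * r - 2 := by
    simp [f]
  have hf1 : f ≠ 1 := fun h => by
    rw [h, natDegree_one] at hdeg
    omega
  rw [hmap, ← hf.irreducible_iff_irreducible_map_fraction_map,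
    hf.irreducible_iff_lt_natDegree_lt hf1, hdeg]
  intro q hq hqd
  rintro ⟨r, hr⟩
  have hrm : r.Monic := hq.of_mul_monic_left (hr ▸ hf)
  have hdr : q.natDegree + r.natDegree = 4 := by rw [← hq.natDegree_mul hrm, ← hr, hdeg]
  rw [Finset.mem_Ioc] at hqd
  obtain hq1 | hq2 : q.natDegree = 1 ∨ q.natDegree = 2 := by omega
  · have := hq.as_sum
    rw [hq1, Finset.sum_range_one, pow_one, pow_zero, mul_one] at this
    apply h1 (-q.coeff 0)
    rw [← heval, hr, eval_mul, this]
    simp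
  · have hr2 : r.natDegree = 2 := by omega
    have hqs := hq.as_sum
    have hrs := hrm.as_sum
    rw [hq2, Finset.sum_range_succ, Finset.sum_range_one, pow_one, pow_zero, mul_one] at hqs
    rw [hr2, Finset.sum_range_succ, Finset.sum_range_one, pow_one, pow_zero, mul_one] at hrs
    have hev (z : ℤ) : z ^ 4 + s * z ^ 3 + t * z ^ 2 + 2 * z - 2 =
        (z ^ 2 + (q.coeff 0 + q.coeff 1 * z)) * (z ^ 2 + (r.coeff 0 + r.coeff 1 * z)) := by
      rw [← heval, hr, eval_mul]
      nth_rewrite 1 [hqs]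
      nth_rewrite 1 [hrs]
      simp
    have e0 := hev 0
    have e1 := hev 1
    have e2 := hev (-1)
    have e3 := hev 2
    ring_nf at e0 e1 e2 e3
    refine h2 (q.coeff 1) (q.coeff 0) (r.coeff 1) (r.coeff 0) ?_ ?_ ?_ ?_ <;> linarith

end Irreducible

/-- The least natural representatives of the coordinates modulo `p`. -/
def residue {s t : ℤ} (p : ℕ) (x : Quartic ℤ s t) : Quartic ℕ s t :=
  ⟨(x.c0 % p).toNat, (x.c1 % p).toNat, (x.c2 % p).toNat, (x.c3 % p).toNat⟩

theorem natRed_residue {s t : ℤ} {p : ℕ} (hp : p ≠ 0) (x : Quartic ℤ s t) :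
    natRed p (residue p x) = red s t p x := by
  have h (n : ℤ) : (((n % p).toNat : ℕ) : ZMod p) = n := by
    rw [← Int.cast_natCast, Int.toNat_of_nonneg (Int.emod_nonneg n (by exact_mod_cast hp))]
    simp
  ext <;> simp [natRed, residue, red, map, h]

/-- The product of `y` and the `n`-th power of `x` modulo `p`. -/
def natPow {s t : ℤ} (p A B : ℕ) (x : Quartic ℕ s t) : ℕ → Quartic ℕ s t → Quartic ℕ s t
  | 0, y => y
  | n + 1, y => force (natMul p A B y x) (natPow p A B x n)

theorem natRed_natPow {s t : ℤ} {p A B : ℕ} (hp : 2 ≤ p) (hA : (A : ZMod p) = -s)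
    (hB : (B : ZMod p) = -t) (x : Quartic ℕ s t) (n : ℕ) (y : Quartic ℕ s t) :
    natRed p (natPow p A B x n y) = natRed p y * natRed p x ^ n := by
  induction n generalizing y with
  | zero => simp [natPow]
  | succ n ih => rw [natPow, force_eq, ih, natRed_natMul hp hA hB, pow_succ', mul_assoc]

theorem red_pow_eq_of_natPow {s t : ℤ} {p A B : ℕ} (hp : 2 ≤ p) (hA : (A : ZMod p) = -s)
    (hB : (B : ZMod p) = -t) {x y : Quartic ℤ s t} {n : ℕ}
    (h : natPow p A B (residue p x) n ⟨1, 0, 0, 0⟩ = residue p y) :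
    red s t p x ^ n = red s t p y := by
  rw [← natRed_residue (by omega), ← natRed_residue (by omega), ← h, natRed_natPow hp hA hB]
  rw [show natRed p (⟨1, 0, 0, 0⟩ : Quartic ℕ s t) = 1 by ext <;> simp [natRed], one_mul]

theorem natCast_eq_neg_of_dvd {p n A : ℕ} {s : ℤ} (h : (A : ℤ) = n - s) (hn : p ∣ n) :
    (A : ZMod p) = -s := by
  rw [← Int.cast_natCast, h, Int.cast_sub, Int.cast_natCast,
    (ZMod.natCast_eq_zero_iff n p).mpr hn, zero_sub]

theorem red_sq_pow_of_natPow {s t : ℤ} {p A B : ℕ} {x g : Quartic ℤ s t} {n : ℕ} (hp : 2 ≤ p)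
    (hA : (A : ℤ) = (p ^ 2 : ℕ) - s) (hB : (B : ℤ) = (p ^ 2 : ℕ) - t)
    (h : natPow (p ^ 2) A B (residue (p ^ 2) x) n ⟨1, 0, 0, 0⟩ =
      residue (p ^ 2) ⟨1 + p * g.c0, p * g.c1, p * g.c2, p * g.c3⟩) :
    red s t (p ^ 2) x ^ n = 1 + (p : Quartic (ZMod (p ^ 2)) s t) * red s t (p ^ 2) g := by
  rw [red_pow_eq_of_natPow (hp.trans (Nat.le_self_pow two_ne_zero p))
    (natCast_eq_neg_of_dvd hA dvd_rfl) (natCast_eq_neg_of_dvd hB dvd_rfl) h, natCast_mul_eq]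
  ext <;> simp [red, map]

theorem isSkolemPair_of_natPow {s t : ℤ} {p A B : ℕ} {u v : (Quartic ℤ s t)ˣ}
    {gu gv : Quartic ℤ s t} (hp : p.Prime) (hodd : Odd p) (hA : (A : ℤ) = (p ^ 2 : ℕ) - s)
    (hB : (B : ℤ) = (p ^ 2 : ℕ) - t)
    (hgen : natPow p A B (residue p (gen ℤ s t)) p ⟨1, 0, 0, 0⟩ = residue p (gen ℤ s t))
    (hu : natPow (p ^ 2) A B (residue (p ^ 2) (u : Quartic ℤ s t)) (p - 1) ⟨1, 0, 0, 0⟩ =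
      residue (p ^ 2) ⟨1 + p * gu.c0, p * gu.c1, p * gu.c2, p * gu.c3⟩)
    (hv : natPow (p ^ 2) A B (residue (p ^ 2) (v : Quartic ℤ s t)) (p - 1) ⟨1, 0, 0, 0⟩ =
      residue (p ^ 2) ⟨1 + p * gv.c0, p * gv.c1, p * gv.c2, p * gv.c3⟩)
    (hirr : Irreducible (poly s t)) (hreal : 0 ≤ 1 + s + t)
    (hnonreal : ∀ a b c d : ℝ, a + b + c + d = -s →
      a * b + a * c + a * d + b * c + b * d + c * d = t →
      a * b * c + a * b * d + a * c * d + b * c * d = -2 → a * b * c * d = -2 → False) :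
    IsSkolemPair p u v gu gv where
  prime := hp
  odd := hodd
  gen_pow := by
    simpa [red, map, gen] using red_pow_eq_of_natPow hp.two_le
      (natCast_eq_neg_of_dvd hA (dvd_pow_self p two_ne_zero))
      (natCast_eq_neg_of_dvd hB (dvd_pow_self p two_ne_zero)) hgen
  u_pow := red_sq_pow_of_natPow hp.two_le hA hB hu
  v_pow := red_sq_pow_of_natPow hp.two_le hA hB hv
  real := by
    obtain ⟨r, hr⟩ := exists_real_root hreal
    exact ⟨_, eval_injective hirr hr⟩
  rel := by
    obtain ⟨z, hz, him⟩ := exists_nonreal_root hnonreal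
    exact unit_relation hirr hz him

end Quartic

namespace Quartic

variable {s t : ℤ}

/-- The value at `r` of the polynomial representing `x`. -/
def evalInt (r : ℤ) (x : Quartic ℤ s t) : ℤ := x.c0 + x.c1 * r + x.c2 * r ^ 2 + x.c3 * r ^ 3

namespace IsSkolemPair

variable {p : ℕ} {u v : (Quartic ℤ s t)ˣ} {gu gv : Quartic ℤ s t}

/-- Two residue characters showing that `u` and `v` generate all units modulo `q`-th powers. -/
theorem generatesModPow (S : IsSkolemPair p u v gu gv) {q l l' E E' : ℕ} (r r' : ℤ)
    (hq : q.Prime) (hl : l.Prime) (hl' : l'.Prime) (hE : l - 1 = q * E) (hE' : l' - 1 = q * E')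
    (hEven : Even E) (hEven' : Even E')
    (hr : (l : ℤ) ∣ r ^ 4 + s * r ^ 3 + t * r ^ 2 + 2 * r - 2)
    (hr' : (l' : ℤ) ∣ r' ^ 4 + s * r' ^ 3 + t * r' ^ 2 + 2 * r' - 2)
    (hu : (l : ℤ) ∣ evalInt r (u : Quartic ℤ s t) ^ E - 1)
    (hv : ¬ (l : ℤ) ∣ evalInt r (v : Quartic ℤ s t) ^ E - 1)
    (hu' : ¬ (l' : ℤ) ∣ evalInt r' (u : Quartic ℤ s t) ^ E' - 1)
    (hv' : (l' : ℤ) ∣ evalInt r' (v : Quartic ℤ s t) ^ E' - 1) :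
    GeneratesModPow u v q := by
  have key {l : ℕ} {r : ℤ} (hr : (l : ℤ) ∣ r ^ 4 + s * r ^ 3 + t * r ^ 2 + 2 * r - 2) :
      ∃ f : Quartic ℤ s t →+* ZMod l, ∀ (x : Quartic ℤ s t) (E : ℕ),
        f x ^ E = 1 ↔ (l : ℤ) ∣ evalInt r x ^ E - 1 := by
    rw [← ZMod.intCast_zmod_eq_zero_iff_dvd] at hr
    have hr0 : (r : ZMod l) ^ 4 + s * (r : ZMod l) ^ 3 + t * (r : ZMod l) ^ 2 + 2 * r - 2 = 0 := by
      exact_mod_cast hr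
    refine ⟨eval (Int.castRingHom (ZMod l)) r hr0, fun x E => ?_⟩
    rw [← ZMod.intCast_zmod_eq_zero_iff_dvd, Int.cast_sub, sub_eq_zero]
    simp [eval, evalInt]
  have : Fact l.Prime := ⟨hl⟩
  have : Fact l'.Prime := ⟨hl'⟩
  obtain ⟨f, hf⟩ := key hr
  obtain ⟨f', hf'⟩ := key hr'
  rw [← hf] at hu hv
  rw [← hf'] at hu' hv'
  refine S.exists_decomposition hq fun a b x σ hσ h => ⟨?_, ?_⟩
  · exact dvd_of_residue hq hE' hEven' f' hv' hu' hσ (by rw [mul_comm, h])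
  · exact dvd_of_residue hq hE hEven f hu hv hσ h

end IsSkolemPair

/-- The finite computation for Skolem's method: `sols` is the list of all units, up to sign, which
are killed by `l₁` and `l₂` and whose residues modulo `p` are among `±x₀ x₁ ^ k y₀ y₁ ^ l` with
`k < m` and `l < n`. -/
def unitCheck (p A B : ℕ) (gu gv l₁ l₂ : Quartic ℤ s t) (sols : List (Quartic ℤ s t)ˣ)
    (x₀ x₁ y₀ y₁ : Quartic ℤ s t) (m n : ℕ) : Bool :=
  (sols.all fun (y : (Quartic ℤ s t)ˣ) => decide (form l₁ y = 0 ∧ form l₂ y = 0 ∧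
    ¬ (p : ℤ) ∣ form l₁ (y * gu) * form l₂ (y * gv) - form l₁ (y * gv) * form l₂ (y * gu))) &&
  force (residue p l₁) fun L₁ => force (residue p l₂) fun L₂ =>
    force (residue p x₀) fun X₀ => force (residue p x₁) fun X₁ =>
      force (residue p y₀) fun Y₀ => force (residue p y₁) fun Y₁ =>
        natCheck p A B L₁ L₂ (sols.flatMap fun (y : (Quartic ℤ s t)ˣ) =>
          [residue p (y : Quartic ℤ s t), residue p (-y : Quartic ℤ s t)])
          (natPowers p A B X₁ m X₀ []) (natPowers p A B Y₁ n Y₀ [])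

theorem IsSkolemPair.exists_eq_or_eq_neg {p : ℕ} {u v : (Quartic ℤ s t)ˣ} {gu gv : Quartic ℤ s t}
    (S : IsSkolemPair p u v gu gv) {A B : ℕ} (hA : (A : ℤ) = p - s) (hB : (B : ℤ) = p - t)
    {l₁ l₂ : Quartic ℤ s t} {sols : List (Quartic ℤ s t)ˣ} {x₀ y₀ x₁ y₁ : (Quartic ℤ s t)ˣ}
    {m n : ℕ} (hcheck : unitCheck p A B gu gv l₁ l₂ sols x₀ x₁ y₀ y₁ m n = true) (hm : m ≠ 0)
    (hxm : red s t p x₁ ^ m = 1) (hn : n ≠ 0) (hyn : red s t p y₁ ^ n = 1)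
    {x σ y : (Quartic ℤ s t)ˣ} {k l : ℤ} (hσ : σ ^ 2 = 1)
    (hx : x = σ * (x₀ * x₁ ^ k * (y₀ * y₁ ^ l)) * y ^ (p - 1)) (h₁ : form l₁ x = 0)
    (h₂ : form l₂ x = 0) : ∃ z ∈ sols, x = z ∨ x = -z := by
  have hp := S.prime.ne_zero
  simp only [unitCheck, force_eq, Bool.and_eq_true, List.all_eq_true, decide_eq_true_eq] at hcheck
  obtain ⟨hsols, hcheck⟩ := hcheck
  obtain ⟨g, hg, h⟩ := S.exists_red_eq (natCast_eq_neg_of_dvd hA dvd_rfl)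
    (natCast_eq_neg_of_dvd hB dvd_rfl) hcheck (natRed_residue hp _) (natRed_residue hp _)
    (natRed_residue hp _) (natRed_residue hp _) (natRed_residue hp _) (natRed_residue hp _)
    hm hxm hn hyn hσ hx h₁ h₂
  obtain ⟨z, hz, hgz⟩ := List.mem_flatMap.mp hg
  obtain ⟨hz₁, hz₂, hdet⟩ := hsols z hz
  refine ⟨z, hz, S.eq_or_eq_neg hdet h₁ h₂ hz₁ hz₂ ?_⟩
  simp only [List.mem_cons, List.not_mem_nil, or_false] at hgz
  rcases hgz with rfl | rfl
  · rwa [natRed_residue hp] at h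
  · rw [natRed_residue hp, map_neg, neg_neg] at h
    exact h.symm

/-- Skolem's method for units with even second coordinate. -/
theorem IsSkolemPair.exists_eq_or_eq_neg_of_even_right {p : ℕ} {u v : (Quartic ℤ s t)ˣ}
    {gu gv : Quartic ℤ s t} (S : IsSkolemPair p u v gu gv) (hgen : GeneratesModPow u v (p - 1))
    {A B N : ℕ} (hN : p - 1 = N + N) (hN0 : N ≠ 0)
    (hA : (A : ℤ) = p - s) (hB : (B : ℤ) = p - t) (hu : ¬ Even (u : Quartic ℤ s t).c1)
    (hv : Even (v : Quartic ℤ s t).c1)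
    {l₁ l₂ : Quartic ℤ s t} {sols : List (Quartic ℤ s t)ˣ}
    (hcheck : unitCheck p A B gu gv l₁ l₂ sols 1 (u * u) 1 v N (p - 1) = true)
    {x : (Quartic ℤ s t)ˣ} (hx : Even (x : Quartic ℤ s t).c1)
    (h₁ : form l₁ x = 0) (h₂ : form l₂ x = 0) : ∃ z ∈ sols, x = z ∨ x = -z := by
  have : Fact p.Prime := ⟨S.prime⟩
  obtain ⟨σ, i, j, y, hσ, h⟩ := hgen x
  have hc := c1_eq (u := u) (v := v) (y := y) (i := i) (j := j) (S.eq_one_or_neg_one_of_sq hσ)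
    ⟨N, hN⟩
  rw [← h, (ZMod.intCast_eq_zero_iff_even).mpr hx, ZMod.intCast_eq_zero_iff_even.mpr hv,
    ZMod.intCast_eq_one_iff_odd.mpr (Int.not_even_iff_odd.mp hu), mul_one, mul_zero, add_zero,
    eq_comm, ZMod.intCast_eq_zero_iff_even] at hc
  obtain ⟨k, rfl⟩ := hc
  refine S.exists_eq_or_eq_neg hA hB (x₀ := 1) (y₀ := 1) (x₁ := u * u) (y₁ := v) (y := y) (k := k)
    (l := j) hcheck hN0 ?_ (by omega) (red_units_pow S.gen_pow v) hσ ?_ h₁ h₂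
  · rw [Units.val_mul, map_mul, mul_pow, ← pow_add, ← hN, red_units_pow S.gen_pow]
  · rw [h, mul_zpow, zpow_add, one_mul, one_mul]

/-- Skolem's method for units with even second coordinate. -/
theorem IsSkolemPair.exists_eq_or_eq_neg_of_not_even {p : ℕ} {u v : (Quartic ℤ s t)ˣ}
    {gu gv : Quartic ℤ s t} (S : IsSkolemPair p u v gu gv) (hgen : GeneratesModPow u v (p - 1))
    {A B N : ℕ} (hN : p - 1 = N + N) (hN0 : N ≠ 0)
    (hA : (A : ℤ) = p - s) (hB : (B : ℤ) = p - t) (hu : ¬ Even (u : Quartic ℤ s t).c1)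
    (hv : ¬ Even (v : Quartic ℤ s t).c1)
    {l₁ l₂ : Quartic ℤ s t} {sols : List (Quartic ℤ s t)ˣ}
    (hcheck : unitCheck p A B gu gv l₁ l₂ sols 1 (u * u) 1 (v * v) N N = true)
    (hcheck' : unitCheck p A B gu gv l₁ l₂ sols u (u * u) v (v * v) N N = true)
    {x : (Quartic ℤ s t)ˣ} (hx : Even (x : Quartic ℤ s t).c1)
    (h₁ : form l₁ x = 0) (h₂ : form l₂ x = 0) : ∃ z ∈ sols, x = z ∨ x = -z := by
  have : Fact p.Prime := ⟨S.prime⟩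
  obtain ⟨σ, i, j, y, hσ, h⟩ := hgen x
  have hc := c1_eq (u := u) (v := v) (y := y) (i := i) (j := j) (S.eq_one_or_neg_one_of_sq hσ)
    ⟨N, hN⟩
  rw [← h, (ZMod.intCast_eq_zero_iff_even).mpr hx,
    ZMod.intCast_eq_one_iff_odd.mpr (Int.not_even_iff_odd.mp hu),
    ZMod.intCast_eq_one_iff_odd.mpr (Int.not_even_iff_odd.mp hv), mul_one, mul_one, eq_comm,
    ← Int.cast_add, ZMod.intCast_eq_zero_iff_even] at hc
  have hred (w : (Quartic ℤ s t)ˣ) : red s t p (w * w : (Quartic ℤ s t)ˣ) ^ N = 1 := by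
    rw [Units.val_mul, map_mul, mul_pow, ← pow_add, ← hN, red_units_pow S.gen_pow]
  rcases Int.even_or_odd i with hi | hi
  · obtain ⟨l, rfl⟩ := (Int.even_add.mp hc).mp hi
    obtain ⟨k, rfl⟩ := hi
    refine S.exists_eq_or_eq_neg hA hB (x₀ := 1) (y₀ := 1) (x₁ := u * u) (y₁ := v * v) (y := y)
      (k := k) (l := l) hcheck hN0 (hred u) hN0 (hred v) hσ ?_ h₁ h₂
    rw [h, mul_zpow, mul_zpow, zpow_add, zpow_add, one_mul, one_mul]
  · obtain ⟨l, rfl⟩ : Odd j := by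
      rw [← Int.not_even_iff_odd] at hi ⊢
      rwa [← Int.even_add.mp hc]
    obtain ⟨k, rfl⟩ := hi
    refine S.exists_eq_or_eq_neg hA hB (x₀ := u) (y₀ := v) (x₁ := u * u) (y₁ := v * v) (y := y)
      (k := k) (l := l) hcheck' hN0 (hred u) hN0 (hred v) hσ ?_ h₁ h₂
    rw [h, mul_zpow, mul_zpow, two_mul, two_mul, zpow_add_one, zpow_add_one, zpow_add, zpow_add,
      mul_comm _ u, mul_comm _ v]

end Quartic

namespace Quartic

theorem irreducible_poly_of_mod_three {s t : ℤ} (k : ℤ) (hs : s = 3 * k + 1)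
    (ht : t ≠ 1 + 2 * k * (k + 1)) (h1 : 1 + s + t ≠ 0) (h2 : t ≠ s + 3) :
    Irreducible (poly s t) := by
  have hdvd {b : ℤ} (h : b ∣ 2) : b = 1 ∨ b = -1 ∨ b = 2 ∨ b = -2 := by
    have h1 := Int.le_of_dvd two_pos h
    have h2 := Int.le_of_dvd two_pos (neg_dvd.mpr h)
    have h3 : b ≠ 0 := by rintro rfl; simp at h
    omega
  refine irreducible_poly (fun r hr => ?_) fun a b c d hac hbd hadbc h => ?_
  · rcases hdvd (b := r) ⟨r ^ 3 + s * r ^ 2 + t * r + 2, by linear_combination -hr⟩ with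
      rfl | rfl | rfl | rfl <;> omega
  · obtain rfl : a = s - c := by linarith
    rcases hdvd (b := b) ⟨-d, by linear_combination h⟩ with rfl | rfl | rfl | rfl
    · obtain rfl : d = -2 := by omega
      omega
    · obtain rfl : d = 2 := by omega
      obtain rfl : c = 2 * k := by omega
      subst hs
      apply ht
      linear_combination -hbd
    · obtain rfl : d = -1 := by omega
      obtain rfl : c = k + 1 := by omega
      subst hs
      apply ht
      linear_combination -hbd
    · obtain rfl : d = 1 := by omega
      omega

end Quartic

namespace Quartic

/-- A fundamental unit of `ℤ[X] / (X⁴ + 4 * X³ + 8 * X² + 2 * X - 2)`. -/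
def unitA₁ : (Quartic ℤ 4 8)ˣ := ⟨⟨1, 1, 0, 0⟩, ⟨3, -5, -3, -1⟩, by decide, by decide⟩

/-- A fundamental unit of `ℤ[X] / (X⁴ + 4 * X³ + 8 * X² + 2 * X - 2)`. -/
def unitA₂ : (Quartic ℤ 4 8)ˣ := ⟨⟨3, -7, -3, -1⟩, ⟨121, 211, 96, 22⟩, by decide, by decide⟩

theorem isSkolemPair_unitA :
    IsSkolemPair 173 unitA₁ unitA₂ ⟨108, 71, 3, 154⟩ ⟨34, 63, 138, 71⟩ := by
  refine isSkolemPair_of_natPow (A := 29925) (B := 29921) (by norm_num) (by decide) (by norm_num)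
    (by norm_num) (by decide +kernel) (by decide +kernel) (by decide +kernel)
    (irreducible_poly_of_mod_three 1 (by norm_num) (by norm_num) (by norm_num) (by norm_num))
    (by norm_num) fun a b c d h1 h2 _ _ => ?_
  push_cast at h1 h2
  nlinarith [sq_nonneg (a + 1), sq_nonneg (b + 1), sq_nonneg (c + 1), sq_nonneg (d + 1),
    congrArg (· ^ 2) h1]

theorem generatesModPow_unitA : GeneratesModPow unitA₁ unitA₂ (173 - 1) := by
  have h2 : GeneratesModPow unitA₁ unitA₂ 2 :=
    isSkolemPair_unitA.generatesModPow (l := 5) (l' := 17) (E := 2) (E' := 8) 3 4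
      (by norm_num) (by norm_num) (by norm_num) (by norm_num) (by norm_num) (by decide)
      (by decide) (by norm_num) (by norm_num) (by decide +kernel) (by decide +kernel)
      (by decide +kernel) (by decide +kernel)
  have h43 : GeneratesModPow unitA₁ unitA₂ 43 :=
    isSkolemPair_unitA.generatesModPow (l := 9461) (l' := 173) (E := 220) (E' := 4) 4400 116
      (by norm_num) (by norm_num) (by norm_num) (by norm_num) (by norm_num) (by decide)
      (by decide) (by norm_num) (by norm_num) (by decide +kernel) (by decide +kernel)
      (by decide +kernel) (by decide +kernel)
  rw [show 173 - 1 = 2 * 2 * 43 by norm_num]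
  exact (h2.mul h2).mul h43

theorem exists_eq_or_eq_neg_unitA {l₁ l₂ : Quartic ℤ 4 8} {sols : List (Quartic ℤ 4 8)ˣ}
    (hcheck : unitCheck 173 169 165 ⟨108, 71, 3, 154⟩ ⟨34, 63, 138, 71⟩ l₁ l₂ sols 1
      (unitA₁ * unitA₁) 1 (unitA₂ * unitA₂) 86 86 = true)
    (hcheck' : unitCheck 173 169 165 ⟨108, 71, 3, 154⟩ ⟨34, 63, 138, 71⟩ l₁ l₂ sols unitA₁
      (unitA₁ * unitA₁) unitA₂ (unitA₂ * unitA₂) 86 86 = true)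
    {x : (Quartic ℤ 4 8)ˣ} (hx : Even (x : Quartic ℤ 4 8).c1) (h₁ : form l₁ x = 0)
    (h₂ : form l₂ x = 0) :
    ∃ z ∈ sols, x = z ∨ x = -z :=
  isSkolemPair_unitA.exists_eq_or_eq_neg_of_not_even generatesModPow_unitA (by norm_num)
    (by norm_num) (by norm_num) (by norm_num) (by decide) (by decide) hcheck hcheck' hx h₁ h₂

theorem quarticA₁ {a b : ℤ} (h : a ^ 4 - 36 * a * b ^ 3 + 36 * b ^ 4 = 1) :
    b = 0 ∨ a = b := by
  let x : (Quartic ℤ 4 8)ˣ := Units.mkOfMulEqOne ⟨a - 2 * b, -2 * b, -b, 0⟩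
    ⟨a ^ 3 + 2 * a ^ 2 * b + 6 * a * b ^ 2 - 24 * b ^ 3,
      2 * a ^ 2 * b + 6 * a * b ^ 2 + 24 * b ^ 3,
      a ^ 2 * b + 18 * b ^ 3,
      6 * b ^ 3⟩ (by
    rw [mul_def]
    ext <;> simp only [one_c0, one_c1, one_c2, one_c3]
    · linear_combination h
    all_goals ring)
  obtain ⟨z, hz, h⟩ := exists_eq_or_eq_neg_unitA (l₁ := ⟨0, 0, 0, 1⟩) (l₂ := ⟨0, 1, -2, -2⟩)
    (sols := [1,
      ⟨⟨-1, -2, -1, 0⟩, ⟨-15, 32, 19, 6⟩, by decide, by decide⟩])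
    (by decide +kernel) (by decide +kernel) (x := x) (by simp [x])
    (by simp [x, form_apply]) (by simp [x, form_apply])
  simp only [List.mem_cons, List.not_mem_nil, or_false] at hz
  rcases hz with rfl | rfl
  all_goals
    simp [Units.ext_iff, Quartic.ext_iff, x] at h
    omega

theorem quarticA₂ {a b : ℤ} (h : 9 * a ^ 4 - 12 * a * b ^ 3 + 4 * b ^ 4 = 1) :
    a = b := by
  let x : (Quartic ℤ 4 8)ˣ := Units.mkOfMulEqOne ⟨a, -2 * a, -a - b, 0⟩
    ⟨39 * a ^ 3 + 36 * a ^ 2 * b + 34 * a * b ^ 2 - 20 * b ^ 3,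
      60 * a ^ 3 + 60 * a ^ 2 * b + 58 * a * b ^ 2 - 24 * b ^ 3,
      27 * a ^ 3 + 27 * a ^ 2 * b + 26 * a * b ^ 2 - 10 * b ^ 3,
      6 * a ^ 3 + 6 * a ^ 2 * b + 6 * a * b ^ 2 - 2 * b ^ 3⟩ (by
    rw [mul_def]
    ext <;> simp only [one_c0, one_c1, one_c2, one_c3]
    · linear_combination h
    all_goals ring)
  obtain ⟨z, hz, h⟩ := exists_eq_or_eq_neg_unitA (l₁ := ⟨0, 0, 0, 1⟩) (l₂ := ⟨2, 1, 0, -2⟩)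
    (sols := [⟨⟨1, -2, -2, 0⟩, ⟨89, 154, 70, 16⟩, by decide, by decide⟩])
    (by decide +kernel) (by decide +kernel) (x := x) (by simp [x])
    (by simp [x, form_apply]) (by simp [x, form_apply])
  simp only [List.mem_cons, List.not_mem_nil, or_false] at hz
  subst hz
  simp [Units.ext_iff, Quartic.ext_iff, x] at h
  omega

/-- A fundamental unit of `ℤ[X] / (X⁴ + 4 * X³ + 2 * X² + 2 * X - 2)`. -/
def unitB₁ : (Quartic ℤ 4 2)ˣ := ⟨⟨1, -1, -4, -1⟩, ⟨-1, -1, -1, 0⟩, by decide, by decide⟩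

/-- A fundamental unit of `ℤ[X] / (X⁴ + 4 * X³ + 2 * X² + 2 * X - 2)`. -/
def unitB₂ : (Quartic ℤ 4 2)ˣ := ⟨⟨1, -2, 0, 0⟩, ⟨33, 34, 36, 8⟩, by decide, by decide⟩

theorem isSkolemPair_unitB :
    IsSkolemPair 149 unitB₁ unitB₂ ⟨4, 66, 141, 148⟩ ⟨140, 42, 64, 90⟩ := by
  refine isSkolemPair_of_natPow (A := 22197) (B := 22199) (by norm_num) (by decide) (by norm_num)
    (by norm_num) (by decide +kernel) (by decide +kernel) (by decide +kernel)
    (irreducible_poly_of_mod_three 1 (by norm_num) (by norm_num) (by norm_num) (by norm_num))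
    (by norm_num) fun a b c d h1 h2 h3 h4 => ?_
  push_cast at h1 h2
  have h : (1 + 4 * a + a ^ 2) ^ 2 + (1 + 4 * b + b ^ 2) ^ 2 + (1 + 4 * c + c ^ 2) ^ 2 +
      (1 + 4 * d + d ^ 2) ^ 2 = -4 := by
    linear_combination ((a + b + c + d) ^ 3 + 4 * (a + b + c + d) ^ 2 - 6 * (a + b + c + d) - 24) *
      h1 + (2 * (a * b + a * c + a * d + b * c + b * d + c * d) + 4 - 4 * (a + b + c + d) ^ 2 -
      24 * (a + b + c + d) - 36) * h2 + (4 * (a + b + c + d) + 24) * h3 - 4 * h4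
  linarith [sq_nonneg (1 + 4 * a + a ^ 2), sq_nonneg (1 + 4 * b + b ^ 2),
    sq_nonneg (1 + 4 * c + c ^ 2), sq_nonneg (1 + 4 * d + d ^ 2)]

theorem generatesModPow_unitB : GeneratesModPow unitB₁ unitB₂ (149 - 1) := by
  have h2 : GeneratesModPow unitB₁ unitB₂ 2 :=
    isSkolemPair_unitB.generatesModPow (l := 5) (l' := 13) (E := 2) (E' := 6) 4 5
      (by norm_num) (by norm_num) (by norm_num) (by norm_num) (by norm_num) (by decide)
      (by decide) (by norm_num) (by norm_num) (by decide +kernel) (by decide +kernel)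
      (by decide +kernel) (by decide +kernel)
  have h37 : GeneratesModPow unitB₁ unitB₂ 37 :=
    isSkolemPair_unitB.generatesModPow (l := 18353) (l' := 5107) (E := 496) (E' := 138) 9522 4841
      (by norm_num) (by norm_num) (by norm_num) (by norm_num) (by norm_num) (by decide)
      (by decide) (by norm_num) (by norm_num) (by decide +kernel) (by decide +kernel)
      (by decide +kernel) (by decide +kernel)
  rw [show 149 - 1 = 2 * 2 * 37 by norm_num]
  exact (h2.mul h2).mul h37

theorem exists_eq_or_eq_neg_unitB {l₁ l₂ : Quartic ℤ 4 2} {sols : List (Quartic ℤ 4 2)ˣ}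
    (hcheck : unitCheck 149 145 147 ⟨4, 66, 141, 148⟩ ⟨140, 42, 64, 90⟩ l₁ l₂ sols 1
      (unitB₁ * unitB₁) 1 unitB₂ 74 148 = true) {x : (Quartic ℤ 4 2)ˣ}
    (hx : Even (x : Quartic ℤ 4 2).c1) (h₁ : form l₁ x = 0) (h₂ : form l₂ x = 0) :
    ∃ z ∈ sols, x = z ∨ x = -z :=
  isSkolemPair_unitB.exists_eq_or_eq_neg_of_even_right generatesModPow_unitB (by norm_num)
    (by norm_num) (by norm_num) (by norm_num) (by decide) (by decide) hcheck hx h₁ h₂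

theorem quarticB₁ {a b : ℤ} (h : 9 * a ^ 4 - 18 * a ^ 2 * b ^ 2 - 12 * a * b ^ 3 + b ^ 4 = 1) :
    a = 0 := by
  let x : (Quartic ℤ 4 2)ˣ := Units.mkOfMulEqOne ⟨-7 * a + b, -8 * a, -9 * a, -2 * a⟩
    ⟨3 * a ^ 3 - 3 * a ^ 2 * b - 5 * a * b ^ 2 + b ^ 3,
      -6 * a ^ 3 + 6 * a ^ 2 * b + 8 * a * b ^ 2,
      -3 * a ^ 3 + 9 * a * b ^ 2,
      2 * a * b ^ 2⟩ (by
    rw [mul_def]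
    ext <;> simp only [one_c0, one_c1, one_c2, one_c3]
    · linear_combination h
    all_goals ring)
  obtain ⟨z, hz, h⟩ := exists_eq_or_eq_neg_unitB (l₁ := ⟨0, 2, -2, 1⟩) (l₂ := ⟨0, 3, -2, -3⟩)
    (sols := [1]) (by decide +kernel) (x := x)
    ⟨-4 * a, by simp only [x, Units.val_mkOfMulEqOne]; ring⟩
    (by simp [x, form_apply]; ring) (by simp [x, form_apply]; ring)
  simp only [List.mem_cons, List.not_mem_nil, or_false] at hz
  subst hz
  simp [Units.ext_iff, Quartic.ext_iff, x] at h
  omega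

theorem quarticB₂ {a b : ℤ} (h : a ^ 4 - 18 * a ^ 2 * b ^ 2 - 36 * a * b ^ 3 + 9 * b ^ 4 = 1) :
    b = 0 := by
  let x : (Quartic ℤ 4 2)ˣ := Units.mkOfMulEqOne ⟨a + b, -2 * b, -b, 0⟩
    ⟨a ^ 3 - a ^ 2 * b - 15 * a * b ^ 2 - 21 * b ^ 3,
      2 * a ^ 2 * b - 6 * a * b ^ 2 - 24 * b ^ 3,
      a ^ 2 * b - 27 * b ^ 3,
      -6 * b ^ 3⟩ (by
    rw [mul_def]
    ext <;> simp only [one_c0, one_c1, one_c2, one_c3]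
    · linear_combination h
    all_goals ring)
  obtain ⟨z, hz, h⟩ := exists_eq_or_eq_neg_unitB (l₁ := ⟨0, 0, 0, 1⟩) (l₂ := ⟨0, 1, -2, -2⟩)
    (sols := [1]) (by decide +kernel) (x := x)
    (by simp [x]) (by simp [x, form_apply]) (by simp [x, form_apply])
  simp only [List.mem_cons, List.not_mem_nil, or_false] at hz
  subst hz
  simp [Units.ext_iff, Quartic.ext_iff, x] at h
  omega

/-- A fundamental unit of `ℤ[X] / (X⁴ + X³ + 2 * X² + 2 * X - 2)`. -/
def unitC₁ : (Quartic ℤ 1 2)ˣ := ⟨⟨3, 3, 2, 1⟩, ⟨3, -5, 1, -2⟩, by decide, by decide⟩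

/-- A fundamental unit of `ℤ[X] / (X⁴ + X³ + 2 * X² + 2 * X - 2)`. -/
def unitC₂ : (Quartic ℤ 1 2)ˣ := ⟨⟨1, -2, 1, -1⟩, ⟨25, 20, 11, 7⟩, by decide, by decide⟩

theorem isSkolemPair_unitC :
    IsSkolemPair 193 unitC₁ unitC₂ ⟨19, 29, 71, 27⟩ ⟨173, 93, 53, 54⟩ := by
  refine isSkolemPair_of_natPow (A := 37248) (B := 37247) (by norm_num) (by decide) (by norm_num)
    (by norm_num) (by decide +kernel) (by decide +kernel) (by decide +kernel)
    (irreducible_poly_of_mod_three 0 (by norm_num) (by norm_num) (by norm_num) (by norm_num))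
    (by norm_num) fun a b c d h1 h2 _ _ => ?_
  push_cast at h1 h2
  nlinarith [sq_nonneg a, sq_nonneg b, sq_nonneg c, sq_nonneg d, congrArg (· ^ 2) h1]

theorem generatesModPow_unitC : GeneratesModPow unitC₁ unitC₂ (193 - 1) := by
  have h2 : GeneratesModPow unitC₁ unitC₂ 2 :=
    isSkolemPair_unitC.generatesModPow (l := 17) (l' := 13) (E := 8) (E' := 6) 2 3
      (by norm_num) (by norm_num) (by norm_num) (by norm_num) (by norm_num) (by decide)
      (by decide) (by norm_num) (by norm_num) (by decide +kernel) (by decide +kernel)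
      (by decide +kernel) (by decide +kernel)
  have h3 : GeneratesModPow unitC₁ unitC₂ 3 :=
    isSkolemPair_unitC.generatesModPow (l := 13) (l' := 19) (E := 4) (E' := 6) 3 8
      (by norm_num) (by norm_num) (by norm_num) (by norm_num) (by norm_num) (by decide)
      (by decide) (by norm_num) (by norm_num) (by decide +kernel) (by decide +kernel)
      (by decide +kernel) (by decide +kernel)
  rw [show 193 - 1 = 2 * 2 * 2 * 2 * 2 * 2 * 3 by norm_num]
  exact (((((h2.mul h2).mul h2).mul h2).mul h2).mul h2).mul h3

theorem exists_eq_or_eq_neg_unitC {l₁ l₂ : Quartic ℤ 1 2} {sols : List (Quartic ℤ 1 2)ˣ}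
    (hcheck : unitCheck 193 192 191 ⟨19, 29, 71, 27⟩ ⟨173, 93, 53, 54⟩ l₁ l₂ sols 1
      (unitC₁ * unitC₁) 1 unitC₂ 96 192 = true) {x : (Quartic ℤ 1 2)ˣ}
    (hx : Even (x : Quartic ℤ 1 2).c1) (h₁ : form l₁ x = 0) (h₂ : form l₂ x = 0) :
    ∃ z ∈ sols, x = z ∨ x = -z :=
  isSkolemPair_unitC.exists_eq_or_eq_neg_of_even_right generatesModPow_unitC (by norm_num)
    (by norm_num) (by norm_num) (by norm_num) (by decide) (by decide) hcheck hx h₁ h₂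

theorem quarticC₁ {a b : ℤ} (h : a ^ 4 + 18 * a ^ 2 * b ^ 2 - 36 * a * b ^ 3 + 9 * b ^ 4 = 1) :
    b = 0 := by
  let x : (Quartic ℤ 1 2)ˣ := Units.mkOfMulEqOne ⟨a - b, 0, -b, -b⟩
    ⟨a ^ 3 + a ^ 2 * b + 15 * a * b ^ 2 - 9 * b ^ 3,
      6 * a * b ^ 2 + 6 * b ^ 3,
      a ^ 2 * b + 6 * a * b ^ 2 - 3 * b ^ 3,
      a ^ 2 * b + 3 * b ^ 3⟩ (by
    rw [mul_def]
    ext <;> simp only [one_c0, one_c1, one_c2, one_c3]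
    · linear_combination h
    all_goals ring)
  obtain ⟨z, hz, h⟩ := exists_eq_or_eq_neg_unitC (l₁ := ⟨0, 0, 1, -1⟩) (l₂ := ⟨0, 1, -1, 1⟩)
    (sols := [1]) (by decide +kernel) (x := x)
    (by simp [x]) (by simp [x, form_apply]) (by simp [x, form_apply])
  simp only [List.mem_cons, List.not_mem_nil, or_false] at hz
  subst hz
  simp [Units.ext_iff, Quartic.ext_iff, x] at h
  omega

theorem quarticC₂ {a b : ℤ} (h : 9 * a ^ 4 + 18 * a ^ 2 * b ^ 2 - 12 * a * b ^ 3 + b ^ 4 = 1) :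
    a = 0 ∨ b = 2 * a := by
  let x : (Quartic ℤ 1 2)ˣ := Units.mkOfMulEqOne ⟨-3 * a + b, 2 * a, -a, a⟩
    ⟨-3 * a ^ 3 + 3 * a ^ 2 * b - 9 * a * b ^ 2 + b ^ 3,
      -6 * a ^ 2 * b - 2 * a * b ^ 2,
      -3 * a ^ 3 - 6 * a ^ 2 * b + a * b ^ 2,
      -3 * a ^ 3 - a * b ^ 2⟩ (by
    rw [mul_def]
    ext <;> simp only [one_c0, one_c1, one_c2, one_c3]
    · linear_combination h
    all_goals ring)
  obtain ⟨z, hz, h⟩ := exists_eq_or_eq_neg_unitC (l₁ := ⟨0, 0, 1, 1⟩) (l₂ := ⟨0, 1, 1, -1⟩)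
    (sols := [1,
      unitC₂]) (by decide +kernel) (x := x)
    (by simp [x]) (by simp [x, form_apply]) (by simp [x, form_apply]; ring)
  simp only [List.mem_cons, List.not_mem_nil, or_false] at hz
  rcases hz with rfl | rfl
  all_goals
    simp [Units.ext_iff, Quartic.ext_iff, x, unitC₂] at h
    omega

end Quartic

namespace CubicField

theorem irreducible_poly : Irreducible (X ^ 3 - 4 * X + 6 : ℚ[X]) := by
  have hdeg : (X ^ 3 - 4 * X + 6 : ℤ[X]).degree = 3 := by compute_degree!
  have hmonic : (X ^ 3 - 4 * X + 6 : ℤ[X]).Monic := by monicity!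
  have hnat := natDegree_eq_of_degree_eq_some hdeg
  have h : (X ^ 3 - 4 * X + 6 : ℤ[X]).IsEisensteinAt (Ideal.span {2}) := by
    refine ⟨?_, fun {n} hn => ?_, ?_⟩
    · rw [hmonic.leadingCoeff, Ideal.mem_span_singleton]
      norm_num
    · rw [hnat] at hn
      rw [Ideal.mem_span_singleton]
      interval_cases n <;> simp [coeff_X, coeff_ofNat_mul, coeff_X_pow, coeff_ofNat_zero,
        coeff_ofNat_succ]
    · rw [Ideal.span_singleton_pow, Ideal.mem_span_singleton]
      simp [coeff_ofNat_zero, coeff_X_pow]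
  have h2 : (Ideal.span {(2 : ℤ)}).IsPrime :=
    (Ideal.span_singleton_prime two_ne_zero).mpr Int.prime_two
  have := (hmonic.irreducible_iff_irreducible_map_fraction_map (K := ℚ)).mp
    (h.irreducible h2 hmonic.isPrimitive (by rw [hnat]; norm_num))
  simpa using this

section Field

variable {K : Type*} [Field K] [NumberField K] {x : K}

theorem minpoly_eq (hx : x ^ 3 = 4 * x - 6) : minpoly ℚ x = X ^ 3 - 4 * X + 6 := by
  refine (minpoly.eq_of_irreducible_of_monic irreducible_poly ?_ (by monicity!)).symm
  simp [hx, map_ofNat]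

theorem linearIndependent (hx : x ^ 3 = 4 * x - 6) :
    LinearIndependent ℚ (fun i : Fin 3 => x ^ (i : ℕ)) := by
  have h := linearIndependent_pow (K := ℚ) x
  have hd : (minpoly ℚ x).natDegree = 3 := by
    rw [minpoly_eq hx]
    compute_degree!
  exact h.comp (finCongr hd.symm) (finCongr hd.symm).injective

theorem trace_eq (hx : x ^ 3 = 4 * x - 6) (hK : Module.finrank ℚ K = 3) :
    Algebra.trace ℚ K x = 0 ∧ Algebra.trace ℚ K (x ^ 2) = 8 := by
  obtain ⟨b, hb⟩ : ∃ b : Module.Basis (Fin 3) ℚ K, ∀ i, b i = x ^ (i : ℕ) :=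
    ⟨basisOfLinearIndependentOfCardEqFinrank (linearIndependent hx) (by simp [hK]), by simp⟩
  have h0 : b.repr 1 = Finsupp.single 0 1 := by simpa [hb] using b.repr_self 0
  have h1 : b.repr x = Finsupp.single 1 1 := by simpa [hb] using b.repr_self 1
  have h2 : b.repr (x ^ 2) = Finsupp.single 2 1 := by simpa [hb] using b.repr_self 2
  have h3 : b.repr (x ^ 3) = (4 : ℚ) • Finsupp.single 1 1 - (6 : ℚ) • Finsupp.single 0 1 := by
    rw [← h0, ← h1, ← map_smul, ← map_smul, ← map_sub, hx, Algebra.smul_def, Algebra.smul_def]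
    simp
  have h4 : b.repr (x ^ 4) = (4 : ℚ) • Finsupp.single 2 1 - (6 : ℚ) • Finsupp.single 1 1 := by
    rw [← h2, ← h1, ← map_smul, ← map_smul, ← map_sub, Algebra.smul_def, Algebra.smul_def]
    congr 1
    simp only [map_ofNat]
    linear_combination x * hx
  simp only [Algebra.trace_eq_matrix_trace b, Matrix.trace, Matrix.diag_apply,
    Algebra.leftMulMatrix_eq_repr_mul, Fin.sum_univ_three, hb, ← pow_succ', ← pow_add]
  constructor <;> simp [h1, h2, h3, h4]
  norm_num

end Field

end CubicField

namespace CubicField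

section Integers

variable {K : Type*} [Field K] [NumberField K] {θ : 𝓞 K}

theorem eq_zero_of_add_eq_zero (hθ : θ ^ 3 = 4 * θ - 6) {r s t : ℤ}
    (h : r + s * θ + t * θ ^ 2 = 0) : r = 0 ∧ s = 0 ∧ t = 0 := by
  have hx : (θ : K) ^ 3 = 4 * θ - 6 := by
    simpa [map_ofNat] using congrArg (algebraMap (𝓞 K) K) hθ
  have hli := linearIndependent hx
  rw [Fintype.linearIndependent_iff] at hli
  specialize hli ![(r : ℚ), s, t]
  have h1 := congrArg (algebraMap (𝓞 K) K) h
  simp only [Fin.sum_univ_three, Algebra.smul_def] at hli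
  replace hli := hli (by simpa using h1)
  exact ⟨by simpa using hli 0, by simpa using hli 1, by simpa using hli 2⟩

theorem discr_pow (hθ : θ ^ 3 = 4 * θ - 6) (hK : Module.finrank ℚ K = 3) :
    Algebra.discr ℤ ![1, θ, θ ^ 2] = -716 := by
  have hx : (θ : K) ^ 3 = 4 * θ - 6 := by
    simpa [map_ofNat] using congrArg (algebraMap (𝓞 K) K) hθ
  obtain ⟨h1, h2⟩ := trace_eq hx hK
  have t0 : Algebra.trace ℤ (𝓞 K) 1 = 3 := by
    rw [← map_one (algebraMap ℤ (𝓞 K)), Algebra.trace_algebraMap, RingOfIntegers.rank, hK]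
    rfl
  have t1 : Algebra.trace ℤ (𝓞 K) θ = 0 := by
    have := Algebra.coe_trace_int (K := K) θ
    rw [h1] at this
    exact_mod_cast this
  have t2 : Algebra.trace ℤ (𝓞 K) (θ ^ 2) = 8 := by
    have := Algebra.coe_trace_int (K := K) (θ ^ 2)
    rw [show ((θ ^ 2 : 𝓞 K) : K) = (θ : K) ^ 2 from map_pow _ _ _, h2] at this
    exact_mod_cast this
  have t3 : Algebra.trace ℤ (𝓞 K) (θ ^ 3) = -18 := by
    have : θ ^ 3 = (4 : ℤ) • θ - (6 : ℤ) • 1 := by simp [hθ]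
    rw [this, map_sub, map_smul, map_smul, t0, t1]
    norm_num
  have t4 : Algebra.trace ℤ (𝓞 K) ((θ ^ 2) ^ 2) = 32 := by
    have : (θ ^ 2) ^ 2 = (4 : ℤ) • θ ^ 2 - (6 : ℤ) • θ := by
      simp only [zsmul_eq_mul, Int.cast_ofNat]
      linear_combination θ * hθ
    rw [this, map_sub, map_smul, map_smul, t1, t2]
    norm_num
  rw [Algebra.discr_def, Matrix.det_fin_three]
  simp [Algebra.traceMatrix_apply, Algebra.traceForm_apply, ← sq, ← pow_succ, ← pow_succ',
    t0, t1, t2, t3, t4]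

theorem index (hθ : θ ^ 3 = 4 * θ - 6) (hK : Module.finrank ℚ K = 3) :
    |discr K| ≤ 716 ∧ ∀ z : 𝓞 K, ∃ r s t : ℤ, 2 * z = r + s * θ + t * θ ^ 2 := by
  have hc : Fintype.card (Module.Free.ChooseBasisIndex ℤ (𝓞 K)) = Fintype.card (Fin 3) := by
    rw [← Module.finrank_eq_card_chooseBasisIndex, RingOfIntegers.rank, hK, Fintype.card_fin]
  obtain ⟨b⟩ : Nonempty (Module.Basis (Fin 3) ℤ (𝓞 K)) :=
    ⟨(RingOfIntegers.basis K).reindex (Fintype.equivOfCardEq hc)⟩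
  set P := b.toMatrix ![1, θ, θ ^ 2] with hP
  have hd := Algebra.discr_of_matrix_vecMul (A := ℤ) b P
  rw [hP, b.toMatrix_map_vecMul, discr_pow hθ hK, ← hP, discr_eq_discr] at hd
  have hdet : P.det ∣ 2 := by
    have h0 : P.det ^ 2 ∣ 716 := ⟨-discr K, by linarith⟩
    have h1 : P.det ≤ 26 := by
      have := Int.le_of_dvd (by norm_num) h0
      nlinarith
    have h2 : -26 ≤ P.det := by
      have := Int.le_of_dvd (by norm_num) h0
      nlinarith
    generalize P.det = d at *
    clear hd hP hc
    revert h0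
    interval_cases d <;> decide
  have hd0 : P.det ≠ 0 := by rintro h; simp [h] at hd
  constructor
  · have h1 : 0 < P.det ^ 2 := by positivity
    have h2 : (716 : ℤ) = P.det ^ 2 * |discr K| := by
      rw [← abs_of_nonneg (sq_nonneg P.det), ← abs_mul, ← hd]
      rfl
    nlinarith [abs_nonneg (discr K)]
  · obtain ⟨e, he⟩ := hdet
    intro z
    set v : Fin 3 → 𝓞 K := ![1, θ, θ ^ 2] with hv
    set c := e • P.adjugate.mulVec (b.repr z) with hc
    have h1 : P.mulVec c = (2 : ℤ) • (b.repr z : Fin 3 → ℤ) := by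
      rw [hc, Matrix.mulVec_smul, Matrix.mulVec_mulVec, Matrix.mul_adjugate, Matrix.smul_mulVec,
        Matrix.one_mulVec, smul_smul, mul_comm, ← he]
    have h2 : (2 : ℤ) • z = ∑ i, c i • v i := by
      apply b.repr.injective
      ext i
      have h3 := congrFun h1 i
      simp only [map_smul, map_sum, Finsupp.smul_apply, Finsupp.finsetSum_apply]
      simp only [Pi.smul_apply] at h3
      rw [← h3, Matrix.mulVec, dotProduct]
      exact Finset.sum_congr rfl fun j _ => by rw [hP, Module.Basis.toMatrix_apply, mul_comm]; rfl
    refine ⟨c 0, c 1, c 2, ?_⟩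
    simpa [Fin.sum_univ_three, hv] using h2

end Integers

end CubicField

namespace CubicField

variable {K : Type*} [Field K] [NumberField K] {θ : 𝓞 K}

theorem even_of_two_dvd_mul_sq (hθ : θ ^ 3 = 4 * θ - 6) (hK : Module.finrank ℚ K = 3) {n : ℤ}
    (h : 2 ∣ n * θ ^ 2) : Even n := by
  by_contra hn
  obtain ⟨k, rfl⟩ := Int.not_even_iff_odd.mp hn
  obtain ⟨w, hw⟩ := h
  push_cast at hw
  have h1 : θ * (2 - (w - k * θ ^ 2)) = 3 := by
    refine mul_left_cancel₀ (two_ne_zero (α := 𝓞 K)) ?_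
    linear_combination θ * hw - hθ
  have h2 : (2 : 𝓞 K) ∣ 1 :=
    ⟨(2 * θ - 3) * (2 - (w - k * θ ^ 2)) ^ 3 - 13, by
      linear_combination
        (-(θ ^ 2 * (2 - (w - k * θ ^ 2)) ^ 2 + θ * (2 - (w - k * θ ^ 2)) * 3 + 9)) * h1 +
          (2 - (w - k * θ ^ 2)) ^ 3 * hθ⟩
  have h3 := map_dvd (Algebra.norm ℤ) h2
  rw [map_one, show (2 : 𝓞 K) = algebraMap ℤ (𝓞 K) 2 by simp, Algebra.norm_algebraMap,
    RingOfIntegers.rank, hK] at h3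
  norm_num at h3

/-- The ring of integers is generated by `θ`. -/
theorem exists_eq (hθ : θ ^ 3 = 4 * θ - 6) (hK : Module.finrank ℚ K = 3) (z : 𝓞 K) :
    ∃ r s t : ℤ, z = r + s * θ + t * θ ^ 2 := by
  obtain ⟨r, s, t, h⟩ := (index hθ hK).2 z
  have heven {n : ℤ} := even_of_two_dvd_mul_sq hθ hK (n := n)
  obtain ⟨r, rfl⟩ := heven (n := r)
    ⟨z * θ ^ 2 - s * (2 * θ - 3) - t * (2 * θ - 3) * θ, by
      linear_combination (-θ ^ 2) * h - (s + t * θ) * hθ⟩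
  push_cast at h
  obtain ⟨s, rfl⟩ := heven (n := s)
    ⟨z * θ - r * θ - t * (2 * θ - 3), by linear_combination (-θ) * h - t * hθ⟩
  push_cast at h
  obtain ⟨t, rfl⟩ := heven (n := t) ⟨z - r - s * θ, by linear_combination -h⟩
  push_cast at h
  exact ⟨r, s, t, mul_left_cancel₀ (two_ne_zero (α := 𝓞 K)) (by linear_combination h)⟩

/-- A proper ideal containing an element `π` that divides a prime `p` is generated by `π` if `θ` is
congruent to an integer modulo `π`. -/
theorem isPrincipal_of_mem (hθ : θ ^ 3 = 4 * θ - 6) (hK : Module.finrank ℚ K = 3)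
    {I : Ideal (𝓞 K)} (hI : I ≠ ⊤) {π : 𝓞 K} {p c : ℤ} (hp : Prime p) (hπ : π ∈ I)
    (hdvd : π ∣ p) (hc : π ∣ θ - c) : Submodule.IsPrincipal I := by
  have hpI : (p : 𝓞 K) ∈ I := I.mem_of_dvd hdvd hπ
  refine ⟨π, le_antisymm (fun z hz => ?_) ((Ideal.span_singleton_le_iff_mem I).mpr hπ)⟩
  rw [Ideal.submodule_span_eq, Ideal.mem_span_singleton]
  obtain ⟨r, s, t, rfl⟩ := exists_eq hθ hK z
  obtain ⟨w, hw⟩ := hc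
  have h1 : (r + s * θ + t * θ ^ 2 : 𝓞 K) =
      ((r + s * c + t * c ^ 2 : ℤ) : 𝓞 K) + π * (w * (s + t * (θ + c))) := by
    push_cast
    linear_combination (s + t * (θ + c)) * hw
  rw [h1] at hz ⊢
  have h2 : ((r + s * c + t * c ^ 2 : ℤ) : 𝓞 K) ∈ I :=
    (I.add_mem_iff_left (I.mul_mem_right _ hπ)).mp hz
  refine dvd_add (hdvd.trans (map_dvd (Int.castRingHom (𝓞 K)) ?_)) (dvd_mul_right _ _)
  by_contra h3
  obtain ⟨a, b, hab⟩ := (hp.coprime_iff_not_dvd.mpr h3)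
  apply hI
  rw [Ideal.eq_top_iff_one, ← Int.cast_one, ← hab, Int.cast_add, Int.cast_mul, Int.cast_mul]
  exact I.add_mem (I.mul_mem_left _ hpI) (I.mul_mem_left _ h2)

end CubicField

namespace CubicField

variable {K : Type*} [Field K] [NumberField K] {θ : 𝓞 K}

theorem pow_absNorm_sub_mem {I : Ideal (𝓞 K)} [I.IsMaximal] (hI : Ideal.absNorm I ≠ 0)
    (x : 𝓞 K) : x ^ Ideal.absNorm I - x ∈ I := by
  have := (Ideal.absNorm_ne_zero_iff I).mp hI
  let := Ideal.Quotient.field I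
  have := Fintype.ofFinite (𝓞 K ⧸ I)
  have h := FiniteField.pow_card (Ideal.Quotient.mk I x)
  rw [← Nat.card_eq_fintype_card, ← Submodule.cardQuot_apply, ← Ideal.absNorm_apply,
    ← map_pow] at h
  exact Ideal.Quotient.eq.mp h

theorem isPrincipal_of_absNorm_lt_eight (hθ : θ ^ 3 = 4 * θ - 6) (hK : Module.finrank ℚ K = 3)
    {I : Ideal (𝓞 K)} [hI : I.IsPrime] (h0 : I ≠ ⊥) (h : Ideal.absNorm I < 8) :
    Submodule.IsPrincipal I := by
  have hmax : I.IsMaximal := hI.isMaximal h0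
  have hN0 : Ideal.absNorm I ≠ 0 := Ideal.absNorm_eq_zero_iff.not.mpr h0
  have hN1 : Ideal.absNorm I ≠ 1 := Ideal.absNorm_eq_one_iff.not.mpr hI.ne_top
  have hmem : ((Ideal.absNorm I : ℕ) : 𝓞 K) ∈ I := Ideal.absNorm_mem I
  have hfrob := pow_absNorm_sub_mem hN0 θ
  have two (h2 : 2 ∈ I) : Submodule.IsPrincipal I := by
    have h3 : θ ∈ I := hI.mem_of_pow_mem 3 (by
      rw [hθ, show 4 * θ - 6 = 2 * (2 * θ - 3) by ring]
      exact I.mul_mem_right _ h2)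
    refine isPrincipal_of_mem hθ hK hI.ne_top (π := θ ^ 2 + θ - 4) (p := 2) (c := 0)
      Int.prime_two ?_ ⟨-2 + 2 * θ - θ ^ 2, ?_⟩ ⟨3 - 3 * θ + θ ^ 2, ?_⟩
    · rw [show θ ^ 2 + θ - 4 = (θ + 1) * θ - 2 * 2 by ring]
      exact I.sub_mem (I.mul_mem_left _ h3) (I.mul_mem_left _ h2)
    · push_cast
      linear_combination (θ - 1) * hθ
    · push_cast
      linear_combination (2 - θ) * hθ
  have three (h3 : 3 ∈ I) : Submodule.IsPrincipal I := by
    have h4 : θ * ((θ - 1) * (θ + 1)) ∈ I := by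
      rw [show θ * ((θ - 1) * (θ + 1)) = (θ - 2) * 3 by linear_combination hθ]
      exact I.mul_mem_left _ h3
    rcases hI.mem_or_mem h4 with h5 | h5
    · refine isPrincipal_of_mem hθ hK hI.ne_top (π := θ ^ 2 - 3 * θ + 3) (p := 3) (c := 0)
        Int.prime_three ?_ ⟨-5 + 3 * θ + 2 * θ ^ 2, ?_⟩ ⟨-4 + θ + θ ^ 2, ?_⟩
      · rw [show θ ^ 2 - 3 * θ + 3 = (θ - 3) * θ + 3 by ring]
        exact I.add_mem (I.mul_mem_left _ h5) h3
      · push_cast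
        linear_combination (3 - 2 * θ) * hθ
      · push_cast
        linear_combination (2 - θ) * hθ
    rcases hI.mem_or_mem h5 with h6 | h6
    · refine isPrincipal_of_mem hθ hK hI.ne_top (p := 3) (c := 1) Int.prime_three h6
        ⟨3 - θ - θ ^ 2, ?_⟩ (by simp)
      push_cast
      linear_combination hθ
    · refine isPrincipal_of_mem hθ hK hI.ne_top (π := 2 * θ + 5) (p := 3) (c := -1)
        Int.prime_three ?_ ⟨-9 + 10 * θ - 4 * θ ^ 2, ?_⟩ ⟨5 - 5 * θ + 2 * θ ^ 2, ?_⟩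
      · rw [show 2 * θ + 5 = 2 * (θ + 1) + 3 by ring]
        exact I.add_mem (I.mul_mem_left _ h6) h3
      · push_cast
        linear_combination 8 * hθ
      · push_cast
        linear_combination -4 * hθ
  generalize Ideal.absNorm I = N at *
  interval_cases N
  · exact (hN0 rfl).elim
  · exact (hN1 rfl).elim
  · exact two (by simpa using hmem)
  · exact three (by simpa using hmem)
  · exact two (hI.mem_of_pow_mem 2 (by norm_num at hmem ⊢; exact hmem))
  · exfalso
    have h5 : (5 : 𝓞 K) ∈ I := by simpa using hmem
    apply hI.ne_top
    rw [Ideal.eq_top_iff_one, show (1 : 𝓞 K) =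
      (-2 - 2 * θ - θ ^ 2) * (θ ^ 5 - θ) + (-13 + 6 * θ - 6 * θ ^ 2) * 5 by
        linear_combination (-(-2 - 2 * θ - θ ^ 2) * (θ ^ 2 + 4) - (-3 + 6 * θ)) * hθ]
    exact I.add_mem (I.mul_mem_left _ hfrob) (I.mul_mem_left _ h5)
  · have h6 : (2 * 3 : 𝓞 K) ∈ I := by norm_num at hmem ⊢; exact hmem
    exact (hI.mem_or_mem h6).elim two three
  · have h7 : (7 : 𝓞 K) ∈ I := by simpa using hmem
    have h8 : θ - 3 ∈ I := by
      rw [show θ - 3 = (-1 - θ ^ 2) * (θ ^ 7 - θ) + (-99 + 112 * θ - 48 * θ ^ 2) * 7 by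
        linear_combination (-(-1 - θ ^ 2) * (θ ^ 4 + 4 * θ ^ 2 - 6 * θ + 16) - (-99 + 48 * θ)) * hθ]
      exact I.add_mem (I.mul_mem_left _ hfrob) (I.mul_mem_left _ h7)
    refine isPrincipal_of_mem hθ hK hI.ne_top (π := 1 - 2 * θ - θ ^ 2) (p := 7) (c := 3)
      (by norm_num) ?_ ⟨-5 + 4 * θ - θ ^ 2, ?_⟩ ⟨3 - 3 * θ + θ ^ 2, ?_⟩
    · rw [show 1 - 2 * θ - θ ^ 2 = (-5 - θ) * (θ - 3) - 2 * 7 by ring]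
      exact I.sub_mem (I.mul_mem_left _ h8) (I.mul_mem_left _ h7)
    · push_cast
      linear_combination (2 - θ) * hθ
    · push_cast
      linear_combination (θ - 1) * hθ


theorem isPrincipalIdealRing (hθ : θ ^ 3 = 4 * θ - 6) (hK : Module.finrank ℚ K = 3) :
    IsPrincipalIdealRing (𝓞 K) := by
  refine RingOfIntegers.isPrincipalIdealRing_of_isPrincipal_of_norm_le_of_isPrime
    fun I hI hN => ?_
  refine isPrincipal_of_absNorm_lt_eight hθ hK (mem_nonZeroDivisors_iff_ne_zero.mp I.2) ?_
  have hr : InfinitePlace.nrComplexPlaces K ≤ 1 := by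
    have := InfinitePlace.card_add_two_mul_card_eq_rank K
    omega
  have hd : √|(discr K : ℝ)| ≤ 26.8 := by
    rw [Real.sqrt_le_left (by norm_num)]
    have h : (|discr K| : ℝ) ≤ 716 := by exact_mod_cast (index hθ hK).1
    exact h.trans (by norm_num)
  have hπ : 4 / Real.pi ≤ 1.28 := by
    rw [div_le_iff₀ Real.pi_pos]
    linarith [Real.pi_gt_d2]
  have hπr : (4 / Real.pi) ^ InfinitePlace.nrComplexPlaces K ≤ 1.28 :=
    (pow_le_pow_left₀ (by positivity) hπ _).trans
      ((pow_le_pow_right₀ (by norm_num) hr).trans (by norm_num))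
  rw [hK] at hN
  have h : (Ideal.absNorm (I : Ideal (𝓞 K)) : ℝ) < 8 := by
    refine hN.trans_lt (lt_of_le_of_lt (mul_le_mul hπr
      (mul_le_mul_of_nonneg_left hd (by positivity)) (by positivity) (by norm_num)) ?_)
    norm_num [Nat.factorial]
  exact_mod_cast h

end CubicField

namespace CubicField

theorem isCoprime_derivative {y z : ℤ} (hy : Odd y) (h : 6 * y ^ 2 = z ^ 3 - 4 * z + 6) :
    IsCoprime (3 * z ^ 2 - 4) y := by
  rw [Int.isCoprime_iff_gcd_eq_one]
  by_contra hg
  obtain ⟨p, hp, hpg⟩ := Nat.exists_prime_and_dvd hg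
  have hpg' : (p : ℤ) ∣ (Int.gcd (3 * z ^ 2 - 4) y : ℤ) := Int.natCast_dvd_natCast.mpr hpg
  have h1 := hpg'.trans (Int.gcd_dvd_left _ _)
  obtain ⟨v, rfl⟩ := hpg'.trans (Int.gcd_dvd_right _ _)
  have hp' : Prime (p : ℤ) := Nat.prime_iff_prime_int.mp hp
  have h2 : (p : ℤ) ∣ 2 * (4 * z - 9) := by
    rw [show 2 * (4 * z - 9) = z * (3 * z ^ 2 - 4) - p * (18 * p * v ^ 2) by
      linear_combination 3 * h]
    exact dvd_sub (h1.mul_left _) (dvd_mul_right _ _)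
  have h3 : (p : ℤ) ∣ 4 * z - 9 := by
    refine (hp'.dvd_or_dvd h2).resolve_left fun h4 => ?_
    have h5 := ((hp'.dvd_prime_iff_associated Int.prime_two).mp h4).symm.dvd
    exact Int.not_even_iff_odd.mpr hy (even_iff_two_dvd.mpr (h5.mul_right v))
  have h4 : (p : ℤ) ∣ 179 := by
    rw [show (179 : ℤ) = 16 * (3 * z ^ 2 - 4) - 3 * (4 * z + 9) * (4 * z - 9) by ring]
    exact dvd_sub (h1.mul_left _) (h3.mul_left _)
  obtain rfl : p = 179 :=
    (Nat.prime_dvd_prime_iff_eq hp (by norm_num)).mp (by exact_mod_cast h4)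
  obtain ⟨w, rfl⟩ : ∃ w, z = 47 + 179 * w := ⟨(z - 47) / 179, by push_cast at h3; omega⟩
  push_cast at h
  have h5 : (179 : ℤ) ∣ 579 :=
    ⟨6 * v ^ 2 - 37 * w - 141 * w ^ 2 - 179 * w ^ 3, by linarith⟩
  norm_num at h5

theorem mul_eq {R : Type*} [CommRing R] {θ : R} (hθ : θ ^ 3 = 4 * θ - 6) (a b c r s t : ℤ) :
    ((a : R) + b * θ + c * θ ^ 2) * (r + s * θ + t * θ ^ 2) =
      (a * r - 6 * (b * t + c * s) : ℤ) +
      (a * s + b * r + 4 * (b * t + c * s) - 6 * c * t : ℤ) * θ +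
      (a * t + b * s + c * r + 4 * c * t : ℤ) * θ ^ 2 := by
  push_cast
  linear_combination (b * t + c * s + c * t * θ) * hθ

/-- The inverse of the unit `θ ^ 2 - 5 * θ - 19`. -/
theorem isUnit_fundamental {R : Type*} [CommRing R] {θ : R} (hθ : θ ^ 3 = 4 * θ - 6) :
    IsUnit (95 - 101 * θ + 40 * θ ^ 2) :=
  IsUnit.of_mul_eq_one (θ ^ 2 - 5 * θ - 19) (by linear_combination (40 * θ - 301) * hθ)

variable {K : Type*} [Field K] [NumberField K] {θ : 𝓞 K}

theorem eq_of_add_eq_add (hθ : θ ^ 3 = 4 * θ - 6) {a b c r s t : ℤ}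
    (h : (a : 𝓞 K) + b * θ + c * θ ^ 2 = r + s * θ + t * θ ^ 2) : a = r ∧ b = s ∧ c = t := by
  have := eq_zero_of_add_eq_zero hθ (r := a - r) (s := b - s) (t := c - t) (by
    push_cast
    linear_combination h)
  simpa [sub_eq_zero] using this

/-- Coordinates of a square multiple of an element. -/
theorem exists_coord_of_eq_mul_sq (hθ : θ ^ 3 = 4 * θ - 6) (hK : Module.finrank ℚ K = 3)
    {a b c x y z : ℤ} {β : 𝓞 K}
    (h : (x : 𝓞 K) + y * θ + z * θ ^ 2 = (a + b * θ + c * θ ^ 2) * β ^ 2) :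
    ∃ r s t : ℤ,
      x = a * (r ^ 2 - 12 * s * t) -
        6 * (b * (s ^ 2 + 2 * r * t + 4 * t ^ 2) + c * (2 * r * s + 8 * s * t - 6 * t ^ 2)) ∧
      y = a * (2 * r * s + 8 * s * t - 6 * t ^ 2) + b * (r ^ 2 - 12 * s * t) +
        4 * (b * (s ^ 2 + 2 * r * t + 4 * t ^ 2) + c * (2 * r * s + 8 * s * t - 6 * t ^ 2)) -
        6 * c * (s ^ 2 + 2 * r * t + 4 * t ^ 2) ∧
      z = a * (s ^ 2 + 2 * r * t + 4 * t ^ 2) + b * (2 * r * s + 8 * s * t - 6 * t ^ 2) +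
        c * (r ^ 2 - 12 * s * t) + 4 * c * (s ^ 2 + 2 * r * t + 4 * t ^ 2) := by
  obtain ⟨r, s, t, rfl⟩ := exists_eq hθ hK β
  have h1 : ((r : 𝓞 K) + s * θ + t * θ ^ 2) ^ 2 =
      (r ^ 2 - 12 * s * t : ℤ) + (2 * r * s + 8 * s * t - 6 * t ^ 2 : ℤ) * θ +
        (s ^ 2 + 2 * r * t + 4 * t ^ 2 : ℤ) * θ ^ 2 := by
    push_cast
    linear_combination (2 * s * t + t ^ 2 * θ) * hθ
  rw [h1, mul_eq hθ] at h
  exact ⟨r, s, t, eq_of_add_eq_add hθ h⟩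

theorem zpow_mul_zpow_mul_sq {G : Type*} [CommGroup G] (u v : G) (a b c d : ℤ) :
    u ^ a * v ^ b * (u ^ c * v ^ d) ^ 2 = u ^ (a + c * 2) * v ^ (b + d * 2) := by
  rw [mul_pow, ← zpow_natCast, ← zpow_natCast, ← zpow_mul, ← zpow_mul, mul_mul_mul_comm,
    ← zpow_add, ← zpow_add]
  rfl

theorem fundamental_ne_sq (hθ : θ ^ 3 = 4 * θ - 6) (hK : Module.finrank ℚ K = 3) {σ w : 𝓞 K}
    (hσ : σ = 1 ∨ σ = -1) : 95 - 101 * θ + 40 * θ ^ 2 ≠ σ * w ^ 2 := by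
  intro h
  obtain ⟨e, rfl⟩ : ∃ e : ℤ, σ = e := by
    rcases hσ with rfl | rfl
    exacts [⟨1, by simp⟩, ⟨-1, by simp⟩]
  obtain ⟨r, s, t, -, h1, -⟩ := exists_coord_of_eq_mul_sq hθ hK (a := e) (b := 0) (c := 0)
    (x := 95) (y := -101) (z := 40) (β := w) (by push_cast; linear_combination h)
  have : (2 : ℤ) ∣ 101 := ⟨-e * (r * s + 4 * s * t - 3 * t ^ 2), by linear_combination -h1⟩
  norm_num at this

theorem exists_eq_mul_sq_of_isUnit (hθ : θ ^ 3 = 4 * θ - 6) (hK : Module.finrank ℚ K = 3)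
    (hc : Fintype.card (InfinitePlace K) ≤ 2) (φ : K →+* ℝ) (u : (𝓞 K)ˣ) :
    ∃ σ w : 𝓞 K, (σ = 1 ∨ σ = -1) ∧
      ((u : 𝓞 K) = σ * w ^ 2 ∨ (u : 𝓞 K) = σ * (95 - 101 * θ + 40 * θ ^ 2) * w ^ 2) := by
  have hinj : Function.Injective (φ.comp (algebraMap (𝓞 K) K)) :=
    φ.injective.comp RingOfIntegers.coe_injective
  obtain ⟨ε, hε⟩ := isUnit_fundamental hθ
  obtain ⟨e, h, hnd⟩ := isUnit_relation_coprime _ hinj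
    (isUnit_relation (algebraMap (𝓞 K) K) RingOfIntegers.coe_injective
      RingOfIntegers.isIntegral_coe hc ![u, ε]) Nat.prime_two
  simp only [Fin.prod_univ_two, Fin.forall_fin_two, Matrix.cons_val_zero,
    Matrix.cons_val_one] at h hnd
  set τ := u ^ e 0 * ε ^ e 1 with hτ
  have hτ1 : (τ : 𝓞 K) = 1 ∨ (τ : 𝓞 K) = -1 :=
    eq_one_or_neg_one_of_pow_eq_one _ hinj two_ne_zero (by rw [← Units.val_pow_eq_pow_val, h]; rfl)
  refine ⟨τ, ?_⟩
  rcases Int.even_or_odd' (e 0) with ⟨k, hk | hk⟩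
  · obtain ⟨l, hl⟩ : Odd (e 1) :=
      Int.not_even_iff_odd.mp fun h1 => hnd ⟨⟨k, hk⟩, h1.two_dvd⟩
    refine (fundamental_ne_sq hθ hK (w := (u ^ (-k) * ε ^ (-l) : (𝓞 K)ˣ)) hτ1 ?_).elim
    rw [← hε, ← Units.val_pow_eq_pow_val, ← Units.val_mul, Units.val_inj, hτ, hk, hl,
      zpow_mul_zpow_mul_sq]
    simp [mul_comm]
  · rcases Int.even_or_odd' (e 1) with ⟨l, hl | hl⟩
    · refine ⟨(u ^ (-k) * ε ^ (-l) : (𝓞 K)ˣ), hτ1, Or.inl ?_⟩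
      rw [← Units.val_pow_eq_pow_val, ← Units.val_mul, Units.val_inj, hτ, hk, hl,
        zpow_mul_zpow_mul_sq]
      simp [mul_comm, add_assoc]
    · refine ⟨(u ^ (-k) * ε ^ (-l - 1) : (𝓞 K)ˣ), hτ1, Or.inr ?_⟩
      rw [← hε, ← Units.val_pow_eq_pow_val, ← Units.val_mul, ← Units.val_mul, Units.val_inj, hτ,
        hk, hl, mul_assoc (u ^ _), ← zpow_add_one, zpow_mul_zpow_mul_sq]
      ring_nf
      simp

end CubicField

namespace CubicField

section Descent

variable {K : Type*} [Field K] [NumberField K] {θ : 𝓞 K}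

theorem exists_associated_sq (hθ : θ ^ 3 = 4 * θ - 6) (hK : Module.finrank ℚ K = 3) {c k y : ℤ}
    (hc : c ^ 3 = 4 * c) (hy : Odd y)
    (h : 6 * y ^ 2 = (c + 6 * k) ^ 3 - 4 * (c + 6 * k) + 6) :
    ∃ (u : (𝓞 K)ˣ) (β : 𝓞 K), ((c + 6 * k : ℤ) : 𝓞 K) - θ = (c - θ) * (u * β ^ 2) := by
  have := isPrincipalIdealRing hθ hK
  have hc' : (c : 𝓞 K) ^ 3 = 4 * c := by exact_mod_cast congrArg (Int.cast : ℤ → 𝓞 K) hc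
  have h' : 6 * (y : 𝓞 K) ^ 2 = (c + 6 * k) ^ 3 - 4 * (c + 6 * k) + 6 := by
    exact_mod_cast congrArg (Int.cast : ℤ → 𝓞 K) h
  obtain ⟨a, b, hab⟩ := (isCoprime_derivative hy h).pow_right (n := 2)
  obtain ⟨A, hA⟩ : ∃ A, A = 1 + k * (c ^ 2 + c * θ + θ ^ 2 - 4) := ⟨_, rfl⟩
  obtain ⟨B, hB⟩ : ∃ B, B = 1 + k * (c - θ) * (2 * c + 6 * k + θ) := ⟨_, rfl⟩
  have hδ : (c - θ) * (c ^ 2 + c * θ + θ ^ 2 - 4) = 6 := by linear_combination hc' - hθ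
  have hA' : c + 6 * k - θ = (c - θ) * A := by
    rw [hA]
    linear_combination -k * hδ
  have hB' : (c + 6 * k) ^ 2 + (c + 6 * k) * θ + θ ^ 2 - 4 =
      (c ^ 2 + c * θ + θ ^ 2 - 4) * B := by
    rw [hB]
    linear_combination (-k * (2 * c + 6 * k + θ)) * hδ
  have hAB : A * B = y ^ 2 := by
    refine mul_left_cancel₀ (show (6 : 𝓞 K) ≠ 0 by norm_num) ?_
    linear_combination (-(A * B)) * hδ - (c ^ 2 + c * θ + θ ^ 2 - 4) * B * hA' -
      (c + 6 * k - θ) * hB' - h' - hθ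
  have hcop : IsCoprime A B := by
    have hab' : (a : 𝓞 K) * (3 * (c + 6 * k) ^ 2 - 4) + b * y ^ 2 = 1 := by
      exact_mod_cast congrArg (Int.cast : ℤ → 𝓞 K) hab
    refine ⟨a * (c - θ) * (2 * (c + 6 * k) + θ) + b * B, a * (c ^ 2 + c * θ + θ ^ 2 - 4), ?_⟩
    linear_combination hab' + b * hAB - a * (2 * (c + 6 * k) + θ) * hA' - a * hB'
  obtain ⟨d, u, hu⟩ := exists_associated_pow_of_mul_eq_pow' hcop hAB
  exact ⟨u, d, by push_cast; rw [hA', ← hu, mul_comm (d ^ 2)]⟩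

theorem pos_of_real_root {ρ x : ℝ} (hρ : ρ ^ 3 = 4 * ρ - 6) (hx : 0 < x ^ 3 - 4 * x + 6) :
    0 < x - ρ := by
  have h1 : ρ < -2 := by
    by_contra! h
    nlinarith [mul_nonneg (neg_le_iff_add_nonneg.mp h) (sq_nonneg (ρ - 1))]
  by_contra! h
  have h2 : 0 ≤ x ^ 2 + x * ρ + ρ ^ 2 - 4 := by nlinarith
  have h3 : x ^ 3 - 4 * x + 6 = (x - ρ) * (x ^ 2 + x * ρ + ρ ^ 2 - 4) := by
    linear_combination hρ
  exact (hx.trans_le (h3.trans_le (mul_nonpos_of_nonpos_of_nonneg h h2))).false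

/-- The unit in the descent is a square. -/
theorem exists_eq_mul_sq (hθ : θ ^ 3 = 4 * θ - 6) (hK : Module.finrank ℚ K = 3)
    (hr : Fintype.card (InfinitePlace K) ≤ 2) (φ : K →+* ℝ) {c k y : ℤ}
    (hc : c ^ 3 = 4 * c) (hy : Odd y)
    (h : 6 * y ^ 2 = (c + 6 * k) ^ 3 - 4 * (c + 6 * k) + 6) :
    ∃ β : 𝓞 K, ((c + 6 * k : ℤ) : 𝓞 K) - θ = (c - θ) * β ^ 2 := by
  obtain ⟨u, β, hβ⟩ := exists_associated_sq hθ hK hc hy h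
  obtain ⟨σ, w, hσ, hu⟩ := exists_eq_mul_sq_of_isUnit hθ hK hr φ u
  rcases hu with hu | hu
  · refine ⟨w * β, ?_⟩
    rcases hσ with rfl | rfl
    · rw [hβ, hu]
      ring
    exfalso
    set ψ : 𝓞 K →+* ℝ := φ.comp (algebraMap (𝓞 K) K)
    have hρ : ψ θ ^ 3 = 4 * ψ θ - 6 := by
      simpa [map_ofNat] using congrArg ψ hθ
    have h1 := congrArg ψ hβ
    rw [hu] at h1
    simp only [map_sub, map_mul, map_pow, map_neg, map_one, map_intCast] at h1
    have hy0 : y ≠ 0 := by rintro rfl; simp at hy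
    have h2 := pos_of_real_root hρ (x := (c + 6 * k : ℤ)) (by
      have : 0 < (c + 6 * k) ^ 3 - 4 * (c + 6 * k) + 6 := by rw [← h]; positivity
      exact_mod_cast this)
    have h3 := pos_of_real_root hρ (x := c) (by
      have : (c : ℝ) ^ 3 = 4 * c := by exact_mod_cast hc
      rw [this]
      norm_num)
    nlinarith [mul_nonneg h3.le (sq_nonneg (ψ w * ψ β))]
  · exfalso
    obtain ⟨e, rfl⟩ : ∃ e : ℤ, σ = e := by
      rcases hσ with rfl | rfl
      exacts [⟨1, by simp⟩, ⟨-1, by simp⟩]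
    obtain ⟨m, rfl⟩ : Even c := by
      have : Even (c ^ 3) := ⟨2 * c, by rw [hc]; ring⟩
      exact (Int.even_pow.mp this).1
    obtain ⟨r, s, t, -, h1, h2⟩ := exists_coord_of_eq_mul_sq hθ hK
      (x := m + m + 6 * k) (y := -1) (z := 0) (a := e * (190 * m + 240))
      (b := e * (-202 * m - 255)) (c := e * (80 * m + 101)) (β := w * β) (by
        rw [hu] at hβ
        push_cast at hβ ⊢
        linear_combination hβ - 40 * e * (w * β) ^ 2 * hθ)
    have h3 : (2 : ℤ) ∣ 1 :=
      ⟨-(e * (95 * m + 120) *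
          (2 * r * s + 8 * s * t - 6 * t ^ 2 + (s ^ 2 + 2 * r * t + 4 * t ^ 2)) +
        e * (-61 * m - 77) * (r ^ 2 - 12 * s * t) +
        e * (-202 * m - 255) * (r * s + 4 * s * t - 3 * t ^ 2) +
        2 * (e * (-202 * m - 255) * (s ^ 2 + 2 * r * t + 4 * t ^ 2) +
          e * (80 * m + 101) * (2 * r * s + 8 * s * t - 6 * t ^ 2)) -
        e * (80 * m + 101) * (s ^ 2 + 2 * r * t + 4 * t ^ 2)), by linear_combination -h1 - h2⟩
    norm_num at h3

end Descent

theorem exists_real_root : ∃ ρ : ℝ, ρ ^ 3 = 4 * ρ - 6 ∧ 16 < 3 * ρ ^ 2 := by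
  have hcont : ContinuousOn (fun x : ℝ => x ^ 3 - 4 * x + 6) (Set.Icc (-3) (-5 / 2)) := by fun_prop
  obtain ⟨ρ, hρ, h⟩ := intermediate_value_Icc (by norm_num) hcont
    (show (0 : ℝ) ∈ _ by constructor <;> norm_num)
  exact ⟨ρ, by linear_combination h, by nlinarith [hρ.1, hρ.2]⟩

theorem exists_complex_root :
    ∃ z : ℂ, aeval z (X ^ 3 - 4 * X + 6 : ℚ[X]) = 0 ∧ z.im ≠ 0 := by
  obtain ⟨ρ, h1, h2⟩ := exists_real_root
  obtain ⟨d, hd, h3⟩ : ∃ d : ℝ, d ^ 2 = 3 * ρ ^ 2 - 16 ∧ 0 < d :=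
    ⟨√(3 * ρ ^ 2 - 16), Real.sq_sqrt (by linarith), Real.sqrt_pos.mpr (by linarith)⟩
  have h1' : (ρ : ℂ) ^ 3 = 4 * ρ - 6 := by exact_mod_cast congrArg Complex.ofReal h1
  have hd' : (d : ℂ) ^ 2 = 3 * ρ ^ 2 - 16 := by exact_mod_cast congrArg Complex.ofReal hd
  refine ⟨(-ρ + d * Complex.I) / 2, ?_, by simp [h3.ne']⟩
  simp only [map_add, map_sub, map_mul, map_pow, aeval_X, map_ofNat]
  linear_combination ((-ρ + d * Complex.I) / 2 - ρ : ℂ) *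
    (d ^ 2 / 4 * Complex.I_sq - hd' / 4) + h1'

/-- The descent on the curve `6 * y ^ 2 = z ^ 3 - 4 * z + 6`. -/
theorem exists_descent {c k y : ℤ} (hc : c ^ 3 = 4 * c) (hy : Odd y)
    (h : 6 * y ^ 2 = (c + 6 * k) ^ 3 - 4 * (c + 6 * k) + 6) :
    ∃ r s t : ℤ,
      c + 6 * k = c * (r ^ 2 - 12 * s * t) + 6 * (s ^ 2 + 2 * r * t + 4 * t ^ 2) ∧
      c * (2 * r * s + 8 * s * t - 6 * t ^ 2) + 1 =
        r ^ 2 - 12 * s * t + 4 * (s ^ 2 + 2 * r * t + 4 * t ^ 2) ∧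
      c * (s ^ 2 + 2 * r * t + 4 * t ^ 2) = 2 * r * s + 8 * s * t - 6 * t ^ 2 := by
  have hf : Fact (Irreducible (X ^ 3 - 4 * X + 6 : ℚ[X])) := ⟨irreducible_poly⟩
  have hK : Module.finrank ℚ (AdjoinRoot (X ^ 3 - 4 * X + 6 : ℚ[X])) = 3 := by
    rw [finrank_adjoinRoot hf.out.ne_zero]
    compute_degree!
  obtain ⟨z, hz, him⟩ := exists_complex_root
  obtain ⟨φ, hφ⟩ := exists_not_isReal_of_root hz him
  have hr := card_infinitePlace_lt_finrank φ hφ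
  obtain ⟨ρ, hρ, -⟩ := exists_real_root
  have hroot : (AdjoinRoot.root (X ^ 3 - 4 * X + 6 : ℚ[X])) ^ 3 =
      4 * AdjoinRoot.root (X ^ 3 - 4 * X + 6 : ℚ[X]) - 6 := by
    have := AdjoinRoot.eval₂_root (X ^ 3 - 4 * X + 6 : ℚ[X])
    simp only [eval₂_add, eval₂_sub, eval₂_mul, eval₂_pow, eval₂_X, eval₂_ofNat] at this
    linear_combination this
  obtain ⟨θ, hθ⟩ : ∃ θ : 𝓞 (AdjoinRoot (X ^ 3 - 4 * X + 6 : ℚ[X])), θ ^ 3 = 4 * θ - 6 := by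
    refine ⟨⟨AdjoinRoot.root _, X ^ 3 - 4 * X + 6, by monicity!, ?_⟩, ?_⟩
    · simp [hroot]
    · ext
      simp only [map_sub, map_ofNat]
      exact hroot
  obtain ⟨β, hβ⟩ := exists_eq_mul_sq hθ hK (by omega)
    (AdjoinRoot.lift (algebraMap ℚ ℝ) ρ (by simp [hρ])) hc hy h
  obtain ⟨r, s, t, h0, h1, h2⟩ := exists_coord_of_eq_mul_sq hθ hK
    (x := c + 6 * k) (y := -1) (z := 0) (a := c) (b := -1) (c := 0) (β := β) (by
      push_cast at hβ ⊢
      linear_combination hβ)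
  exact ⟨r, s, t, by linear_combination h0, by linear_combination -h1, by linear_combination -h2⟩

end CubicField

theorem Int.exists_sq_of_isCoprime {a b c : ℤ} (h : IsCoprime a b) (hc : a * b = c ^ 2) :
    ∃ e u v : ℤ, e ^ 2 = 1 ∧ a = e * u ^ 2 ∧ b = e * v ^ 2 ∧ c = u * v := by
  have key {e u v : ℤ} (he : e ^ 2 = 1) (ha : a = e * u ^ 2) (hb : b = e * v ^ 2) :
      ∃ e u v : ℤ, e ^ 2 = 1 ∧ a = e * u ^ 2 ∧ b = e * v ^ 2 ∧ c = u * v := by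
    have h1 : c ^ 2 = (u * v) ^ 2 := by
      rw [← hc, ha, hb]
      linear_combination u ^ 2 * v ^ 2 * he
    rcases sq_eq_sq_iff_eq_or_eq_neg.mp h1 with h2 | h2
    · exact ⟨e, u, v, he, ha, hb, h2⟩
    · exact ⟨e, -u, v, he, by rw [ha]; ring, hb, by rw [h2]; ring⟩
  have hpos (u v : ℤ) (h1 : u ^ 2 * v ^ 2 = -c ^ 2) : u = 0 ∨ v = 0 := by
    have h2 : (u * v) ^ 2 = 0 := by nlinarith [sq_nonneg (u * v), sq_nonneg c]
    simpa using h2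
  obtain ⟨u, hu⟩ := Int.sq_of_isCoprime h hc
  obtain ⟨v, hv⟩ := Int.sq_of_isCoprime h.symm (mul_comm a b ▸ hc)
  rcases hu with hu | hu <;> rcases hv with hv | hv
  · exact key (e := 1) (by norm_num) (by rw [hu, one_mul]) (by rw [hv, one_mul])
  · rcases hpos u v (by rw [← hc, hu, hv]; ring) with rfl | rfl
    · exact key (e := -1) (u := 0) (v := v) (by norm_num) (by simp [hu]) (by simp [hv])
    · exact key (e := 1) (u := u) (v := 0) (by norm_num) (by simp [hu]) (by simp [hv])
  · rcases hpos u v (by rw [← hc, hu, hv]; ring) with rfl | rfl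
    · exact key (e := 1) (u := 0) (v := v) (by norm_num) (by simp [hu]) (by simp [hv])
    · exact key (e := -1) (u := u) (v := 0) (by norm_num) (by simp [hu]) (by simp [hv])
  · exact key (e := -1) (u := u) (v := v) (by norm_num) (by simp [hu]) (by simp [hv])

theorem Int.exists_sq_of_isCoprime_of_prime {p a b c : ℤ} (hp : Prime p) (h : IsCoprime a b)
    (hc : a * b = p * c ^ 2) :
    ∃ e u v : ℤ, e ^ 2 = 1 ∧ c = u * v ∧
      (a = e * (p * u ^ 2) ∧ b = e * v ^ 2 ∨ a = e * u ^ 2 ∧ b = e * (p * v ^ 2)) := by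
  rcases hp.dvd_or_dvd ⟨c ^ 2, hc⟩ with ⟨d, rfl⟩ | ⟨d, rfl⟩
  · obtain ⟨e, u, v, he, rfl, rfl, hc'⟩ := Int.exists_sq_of_isCoprime (c := c)
      (IsCoprime.of_mul_left_right h) (mul_left_cancel₀ hp.ne_zero (by rw [← mul_assoc, hc]))
    exact ⟨e, u, v, he, hc', Or.inl ⟨by ring, rfl⟩⟩
  · obtain ⟨e, u, v, he, rfl, rfl, hc'⟩ := Int.exists_sq_of_isCoprime (c := c)
      (IsCoprime.of_mul_right_right h)
      (mul_left_cancel₀ hp.ne_zero (by rw [← hc]; ring))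
    exact ⟨e, u, v, he, hc', Or.inr ⟨rfl, by ring⟩⟩

namespace CubicField

theorem eq_of_zero {r s t : ℤ} (h0 : r ^ 2 - 12 * s * t + 4 * (s ^ 2 + 2 * r * t + 4 * t ^ 2) = 1)
    (h1 : 2 * r * s + 8 * s * t - 6 * t ^ 2 = 0) :
    s ^ 2 + 2 * r * t + 4 * t ^ 2 = 0 ∨ s ^ 2 + 2 * r * t + 4 * t ^ 2 = 3 ∨
      s ^ 2 + 2 * r * t + 4 * t ^ 2 = 7 := by
  obtain ⟨R, rfl⟩ : ∃ R, r = R - 4 * t := ⟨r + 4 * t, by ring⟩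
  obtain ⟨e, a, b, he, rfl, ⟨rfl, rfl⟩ | ⟨rfl, rfl⟩⟩ :=
    Int.exists_sq_of_isCoprime_of_prime Int.prime_three (a := R) (b := s) (c := t)
      ⟨R, 4 * s - 12 * t, by linear_combination h0⟩ (by linarith)
  · obtain rfl := Quartic.quarticA₂ (a := a) (b := e * b) (by
      linear_combination h0 + (-9 * a ^ 4 - 12 * e * a * b ^ 3 + 4 * e ^ 2 * b ^ 4) * he)
    right; left
    linear_combination 3 * h0 - 3 * e ^ 2 * b ^ 4 * (9 * e ^ 2 + 7) * he
  · rcases Quartic.quarticA₁ (a := a) (b := e * b) (by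
      linear_combination h0 + (-a ^ 4 - 36 * e * a * b ^ 3 + 36 * e ^ 2 * b ^ 4) * he) with h | rfl
    · left
      have hb : b = 0 := by linear_combination e * h - b * he
      simp [hb]
    · right; right
      linear_combination 7 * h0 - e ^ 2 * b ^ 4 * (7 * e ^ 2 + 5) * he

theorem eq_of_two {r s t : ℤ} (h0 : r ^ 2 - 12 * s * t = 1)
    (h1 : 2 * r * s + 8 * s * t - 6 * t ^ 2 = 2 * (s ^ 2 + 2 * r * t + 4 * t ^ 2)) :
    s ^ 2 + 2 * r * t + 4 * t ^ 2 = 0 ∨ s ^ 2 + 2 * r * t + 4 * t ^ 2 = 1 := by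
  obtain ⟨P, rfl⟩ : ∃ P, s = P + 2 * t := ⟨s - 2 * t, by ring⟩
  obtain ⟨R, rfl⟩ : ∃ R, r = R + P := ⟨r - P, by ring⟩
  have h2 : R * P = 3 * t ^ 2 := by linarith
  have h3 : R ^ 2 - 6 * R * P + P ^ 2 - 12 * t * P = 1 := by linear_combination h0 - 8 * h2
  obtain ⟨e, a, b, he, rfl, ⟨rfl, rfl⟩ | ⟨rfl, rfl⟩⟩ :=
    Int.exists_sq_of_isCoprime_of_prime Int.prime_three (a := R) (b := P) (c := t)
      ⟨R - 6 * P, P - 12 * t, by linear_combination h3⟩ h2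
  · obtain rfl := Quartic.quarticB₁ (a := a) (b := e * b) (by
      linear_combination h3 +
        (-9 * a ^ 4 - 12 * e * a * b ^ 3 + e ^ 2 * b ^ 4) * he)
    right
    linear_combination h0
  · have hb := Quartic.quarticB₂ (a := a) (b := e * b) (by
      linear_combination h3 +
        (-a ^ 4 - 36 * e * a * b ^ 3 + 9 * e ^ 2 * b ^ 4) * he)
    left
    have hb : b = 0 := by linear_combination e * hb - b * he
    simp [hb]

theorem eq_of_neg_two {r s t : ℤ} (h0 : r ^ 2 - 12 * s * t = 1)
    (h1 : 2 * r * s + 8 * s * t - 6 * t ^ 2 = -2 * (s ^ 2 + 2 * r * t + 4 * t ^ 2)) :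
    s ^ 2 + 2 * r * t + 4 * t ^ 2 = 0 ∨ s ^ 2 + 2 * r * t + 4 * t ^ 2 = 1 ∨
      s ^ 2 + 2 * r * t + 4 * t ^ 2 = 12 := by
  obtain ⟨P, rfl⟩ : ∃ P, s = P - 2 * t := ⟨s + 2 * t, by ring⟩
  obtain ⟨R, rfl⟩ : ∃ R, r = R - P := ⟨r + P, by ring⟩
  have h2 : R * P = 3 * t ^ 2 := by linarith
  have h3 : R ^ 2 + 6 * R * P + P ^ 2 - 12 * t * P = 1 := by linear_combination h0 + 8 * h2
  obtain ⟨e, a, b, he, rfl, ⟨rfl, rfl⟩ | ⟨rfl, rfl⟩⟩ :=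
    Int.exists_sq_of_isCoprime_of_prime Int.prime_three (a := R) (b := P) (c := t)
      ⟨R + 6 * P, P - 12 * t, by linear_combination h3⟩ h2
  · rcases Quartic.quarticC₂ (a := a) (b := e * b) (by
      linear_combination h3 +
        (-9 * a ^ 4 - 12 * e * a * b ^ 3 + e ^ 2 * b ^ 4) * he) with rfl | h
    · right; left
      linear_combination h0
    · right; right
      obtain rfl : b = e * (2 * a) := by linear_combination e * h - b * he
      linear_combination 12 * h3 - 16 * e ^ 2 * a ^ 4 * (11 * e ^ 2 - 4) * he
  · have hb := Quartic.quarticC₁ (a := a) (b := e * b) (by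
      linear_combination h3 +
        (-a ^ 4 - 36 * e * a * b ^ 3 + 9 * e ^ 2 * b ^ 4) * he)
    left
    have hb : b = 0 := by linear_combination e * hb - b * he
    simp [hb]

theorem eq_of_six_mul_sq_eq {x y : ℤ} (hy : Odd y) (h : 6 * y ^ 2 = 8 * x ^ 3 - 8 * x + 6) :
    x = -1 ∨ x = 0 ∨ x = 1 ∨ x = 2 ∨ x = 4 ∨ x = 9 ∨ x = 21 ∨ x = 35 := by
  obtain ⟨k, rfl | rfl | rfl⟩ : ∃ k, x = 3 * k ∨ x = 1 + 3 * k ∨ x = -1 + 3 * k :=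
    ⟨(x + 1) / 3, by omega⟩
  · obtain ⟨r, s, t, hx, h0, h1⟩ := exists_descent (c := 0) (k := k) (by norm_num) hy
      (by linear_combination h)
    have := eq_of_zero (r := r) (s := s) (t := t) (by linarith) (by linarith)
    omega
  · obtain ⟨r, s, t, hx, h0, h1⟩ := exists_descent (c := 2) (k := k) (by norm_num) hy
      (by linear_combination h)
    have := eq_of_two (r := r) (s := s) (t := t) (by linarith) (by linarith)
    have h2 : r ^ 2 - 12 * s * t = 1 := by linarith
    rw [h2] at hx
    omega
  · obtain ⟨r, s, t, hx, h0, h1⟩ := exists_descent (c := -2) (k := k) (by norm_num) hy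
      (by linear_combination h)
    have h2 : r ^ 2 - 12 * s * t = 1 := by linarith
    have := eq_of_neg_two h2 (by linarith)
    rw [h2] at hx
    omega

end CubicField

theorem Nat.six_mul_choose_three (m : ℕ) :
    6 * (m + 2).choose 3 = (m + 2) * (m + 1) * m := by
  have h := Nat.descFactorial_eq_factorial_mul_choose (m + 2) 3
  simp only [Nat.descFactorial, Nat.factorial] at h
  norm_num at h
  rw [← h]
  ring

theorem Nat.two_mul_choose_two (n : ℕ) : 2 * (n + 1).choose 2 = (n + 1) * n := by
  have h := Nat.descFactorial_eq_factorial_mul_choose (n + 1) 2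
  simp only [Nat.descFactorial, Nat.factorial] at h
  norm_num at h
  rw [← h]
  ring

theorem binom_2_3_collisions (n m : ℕ) (hn : 4 ≤ n) (hm : 6 ≤ m) :
    Nat.choose n 2 = Nat.choose m 3 ↔
      (n, m) = (16, 10) ∨ (n, m) = (56, 22) ∨ (n, m) = (120, 36) := by
  simp only [Prod.mk.injEq]
  constructor
  · intro h
    obtain ⟨a, rfl⟩ : ∃ a, n = a + 1 := ⟨n - 1, by omega⟩
    obtain ⟨b, rfl⟩ : ∃ b, m = b + 2 := ⟨m - 2, by omega⟩
    have h2 := Nat.two_mul_choose_two a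
    have h3 := Nat.six_mul_choose_three b
    have key : (3 : ℤ) * ((a + 1) * a) = (b + 2) * (b + 1) * b := by
      norm_cast
      rw [← h2, ← h3, h]
      ring
    have hx := CubicField.eq_of_six_mul_sq_eq (x := b + 1) (y := 2 * a + 1) ⟨a, rfl⟩
      (by linear_combination 8 * key)
    obtain rfl | rfl | rfl : b = 8 ∨ b = 20 ∨ b = 34 := by omega
    · have : a = 15 := by push_cast at key; nlinarith
      omega
    · have : a = 55 := by push_cast at key; nlinarith
      omega
    · have : a = 119 := by push_cast at key; nlinarith
      omega
  · rintro (⟨rfl, rfl⟩ | ⟨rfl, rfl⟩ | ⟨rfl, rfl⟩) <;> decide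
end

section
/- The only pair of natural numbers (n, m) with n ≥ 4 and m ≥ 8 satisfying C(n, 2) = C(m, 4) (where C denotes the binomial coefficient) is (n, m) = (21, 10), with common value 210. -/
open scoped NumberTheorySymbols

/-- The numbers `x` in `(2 + √3) ^ n = x + y √3`. -/
def pellX (n : ℕ) : ℕ := Pell.xn one_lt_two n

/-- The numbers `y` in `(2 + √3) ^ n = x + y √3`. -/
def pellY (n : ℕ) : ℕ := Pell.yn one_lt_two n

@[simp] lemma pellX_zero : pellX 0 = 1 := Pell.xn_zero _

@[simp] lemma pellY_zero : pellY 0 = 0 := Pell.yn_zero _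

lemma pellX_add (m n : ℕ) : pellX (m + n) = pellX m * pellX n + 3 * pellY m * pellY n :=
  Pell.xn_add _ m n

lemma pellY_add (m n : ℕ) : pellY (m + n) = pellX m * pellY n + pellY m * pellX n :=
  Pell.yn_add _ m n

lemma pellX_succ (n : ℕ) : pellX (n + 1) = 2 * pellX n + 3 * pellY n := by
  have h : pellX (n + 1) = pellX n * 2 + 3 * pellY n := Pell.xn_succ _ n
  omega

lemma pellY_succ (n : ℕ) : pellY (n + 1) = pellX n + 2 * pellY n := by
  have h : pellY (n + 1) = pellX n + pellY n * 2 := Pell.yn_succ _ n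
  omega

lemma pellX_sq (n : ℕ) : pellX n ^ 2 = 3 * pellY n ^ 2 + 1 := by
  induction n with
  | zero => simp
  | succ n ih =>
    rw [pellX_succ, pellY_succ]
    nlinarith

lemma exists_pell {x y : ℕ} (h : x ^ 2 = 3 * y ^ 2 + 1) : ∃ n, x = pellX n ∧ y = pellY n := by
  refine Pell.eq_pell one_lt_two ?_
  change x * x - 3 * y * y = 1
  rw [Nat.sub_eq_iff_eq_add (by nlinarith)]
  nlinarith

lemma pellX_two_mul (n : ℕ) : pellX (2 * n) = pellX n ^ 2 + 3 * pellY n ^ 2 := by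
  rw [two_mul, pellX_add]; ring

lemma pellY_two_mul (n : ℕ) : pellY (2 * n) = 2 * pellX n * pellY n := by
  rw [two_mul, pellY_add]; ring

lemma pellX_three_mul (n : ℕ) : pellX (3 * n) = pellX n ^ 3 + 9 * pellX n * pellY n ^ 2 := by
  rw [show 3 * n = 2 * n + n by ring, pellX_add, pellX_two_mul, pellY_two_mul]; ring

lemma pellY_three_mul (n : ℕ) :
    pellY (3 * n) = 3 * pellX n ^ 2 * pellY n + 3 * pellY n ^ 3 := by
  rw [show 3 * n = 2 * n + n by ring, pellY_add, pellX_two_mul, pellY_two_mul]; ring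

/-- The number whose squareness decides the collision problem: if `X + Y √3` is the `k`-th solution
of `X ^ 2 - 3 * Y ^ 2 = -2` then this is `4 * X + 5`. -/
def target (k : ℕ) : ℕ := 4 * (pellX k + 3 * pellY k) + 5

section ring

variable {R : Type*} [CommRing R]

lemma pell_cast_sq (n : ℕ) : (pellX n : R) ^ 2 = 3 * (pellY n : R) ^ 2 + 1 := by
  exact_mod_cast congrArg (Nat.cast : ℕ → R) (pellX_sq n)

lemma pell_cast_mul_of_one {P : ℕ} (hx : (pellX P : R) = 1) (hy : (pellY P : R) = 0) (j : ℕ) :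
    (pellX (P * j) : R) = 1 ∧ (pellY (P * j) : R) = 0 := by
  induction j with
  | zero => simp
  | succ j ih =>
    rw [mul_add, mul_one, pellX_add, pellY_add]
    push_cast
    simp [ih, hx, hy]

lemma pell_cast_period {P : ℕ} (hx : (pellX P : R) = 1) (hy : (pellY P : R) = 0) (i j : ℕ) :
    (pellX (i + P * j) : R) = pellX i ∧ (pellY (i + P * j) : R) = pellY i := by
  obtain ⟨h1, h2⟩ := pell_cast_mul_of_one hx hy j
  rw [pellX_add, pellY_add]
  push_cast
  simp [h1, h2]

lemma pell_cast_two_mul_of_zero {N : ℕ} (h : (pellX N : R) = 0) :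
    (pellX (2 * N) : R) = -1 ∧ (pellY (2 * N) : R) = 0 := by
  have := pell_cast_sq (R := R) N
  rw [pellX_two_mul, pellY_two_mul]
  push_cast
  rw [h] at this ⊢
  constructor
  · linear_combination -this
  · ring

lemma pell_cast_four_mul_of_zero {N : ℕ} (h : (pellX N : R) = 0) :
    (pellX (4 * N) : R) = 1 ∧ (pellY (4 * N) : R) = 0 := by
  obtain ⟨h1, h2⟩ := pell_cast_two_mul_of_zero h
  rw [show 4 * N = 2 * (2 * N) by ring, pellX_two_mul (2 * N), pellY_two_mul (2 * N)]
  push_cast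
  simp [h1, h2]

/-- Modulo `x_N`, a shift by an odd multiple of `2 N` is a change of sign. -/
lemma pell_cast_shift_two {N : ℕ} (h : (pellX N : R) = 0) (r j : ℕ) :
    (pellX (r + 2 * N * (2 * j + 1)) : R) = -pellX r ∧
      (pellY (r + 2 * N * (2 * j + 1)) : R) = -pellY r := by
  obtain ⟨h1, h2⟩ := pell_cast_two_mul_of_zero h
  obtain ⟨h3, h4⟩ := pell_cast_four_mul_of_zero h
  rw [show r + 2 * N * (2 * j + 1) = (r + 2 * N) + 4 * N * j by ring]
  rw [(pell_cast_period h3 h4 _ _).1, (pell_cast_period h3 h4 _ _).2, pellX_add, pellY_add]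
  push_cast
  simp [h1, h2]

/-- Modulo `x_N`, an odd multiple of `N` behaves like a fourth root of unity. -/
lemma pell_cast_odd_mul {N : ℕ} (h : (pellX N : R) = 0) (j : ℕ) :
    (pellX (N * (2 * j + 1)) : R) = 0 ∧
      ∃ ε : ℤ, (ε = 1 ∨ ε = -1) ∧ (pellY (N * (2 * j + 1)) : R) = ε * pellY N := by
  obtain ⟨h1, h2⟩ := pell_cast_two_mul_of_zero h
  induction j with
  | zero => exact ⟨by simpa using h, 1, by simp⟩
  | succ j ih =>
    obtain ⟨hx, ε, hε, hy⟩ := ih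
    rw [show N * (2 * (j + 1) + 1) = N * (2 * j + 1) + 2 * N by ring, pellX_add, pellY_add]
    push_cast
    rw [h1, h2, hx, hy]
    exact ⟨by ring, -ε, by omega, by push_cast; ring⟩

/-- If `2 * x_N = 1`, a multiple of `2 N` prime to `3` behaves like a primitive cube root of
unity. -/
lemma pell_cast_cube {N : ℕ} (h : 2 * (pellX N : R) = 1) {j : ℕ} {ε : ℤ}
    (hε : j % 3 = 1 ∧ ε = 1 ∨ j % 3 = 2 ∧ ε = -1) :
    2 * (pellX (2 * N * j) : R) = -1 ∧ (pellY (2 * N * j) : R) = ε * pellY N := by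
  have hs := pell_cast_sq (R := R) N
  have hx : 2 * (pellX (2 * N) : R) = -1 := by
    rw [pellX_two_mul]; push_cast
    linear_combination (2 * (pellX N : R) + 1) * h - 2 * hs
  have hy : (pellY (2 * N) : R) = pellY N := by
    rw [pellY_two_mul]; push_cast
    linear_combination (pellY N : R) * h
  have hs' := pell_cast_sq (R := R) (2 * N)
  have hx2 : 2 * (pellX (2 * (2 * N)) : R) = -1 := by
    rw [pellX_two_mul]; push_cast
    linear_combination (2 * (pellX (2 * N) : R) - 1) * hx - 2 * hs'
  have hy2 : (pellY (2 * (2 * N)) : R) = -pellY N := by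
    rw [pellY_two_mul]; push_cast
    rw [hy]
    linear_combination (pellY N : R) * hx
  have hx3 : (pellX (3 * (2 * N)) : R) = 1 := by
    rw [pellX_three_mul]; push_cast
    linear_combination (2 * (pellX (2 * N) : R) ^ 2 - (pellX (2 * N) : R) - 1) * hx
      - 3 * (pellX (2 * N) : R) * hs'
  have hy3 : (pellY (3 * (2 * N)) : R) = 0 := by
    rw [pellY_three_mul]; push_cast
    linear_combination (2 * (pellX (2 * N) : R) - 1) * (pellY (2 * N) : R) * hx
      - (pellY (2 * N) : R) * hs'
  rcases hε with ⟨hj, rfl⟩ | ⟨hj, rfl⟩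
  · rw [show 2 * N * j = 2 * N + 3 * (2 * N) * (j / 3) by
      conv_lhs => rw [← Nat.mod_add_div j 3, hj]
      ring]
    rw [(pell_cast_period hx3 hy3 _ _).1, (pell_cast_period hx3 hy3 _ _).2]
    exact ⟨hx, by simp [hy]⟩
  · rw [show 2 * N * j = 2 * (2 * N) + 3 * (2 * N) * (j / 3) by
      conv_lhs => rw [← Nat.mod_add_div j 3, hj]
      ring]
    rw [(pell_cast_period hx3 hy3 _ _).1, (pell_cast_period hx3 hy3 _ _).2]
    exact ⟨hx2, by simp [hy2]⟩

end ring

section jacobi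

lemma jacobiSym_natAbs {A : ℕ} (hA : A % 4 = 1) (l : ℤ) : J(l.natAbs | A) = J(l | A) := by
  have hodd : Odd A := Nat.odd_iff.2 (by omega)
  rcases Int.natAbs_eq l with h | h
  · rw [← h]
  · conv_rhs => rw [h]
    rw [jacobiSym.neg _ hodd, ZMod.χ₄_nat_one_mod_four hA, one_mul]

/-- Quadratic reciprocity for a possibly negative numerator. -/
lemma jacobiSym_flip {A : ℕ} (hA : A % 4 = 1) {l : ℤ} (hl : Odd l) :
    J(l | A) = J(A | l.natAbs) := by
  rw [← jacobiSym_natAbs hA]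
  exact jacobiSym.quadratic_reciprocity_one_mod_four' (Int.natAbs_odd.2 hl) hA

/-- The Jacobi symbol of a linear form modulo the quadratic form `a ^ 2 + d * b ^ 2`. -/
lemma jacobiSym_linear_quadratic {a b d A : ℕ} {p q l : ℤ} (hA : A = a ^ 2 + d * b ^ 2)
    (hA4 : A % 4 = 1) (hl : l = p * a + q * b) (hodd : Odd l) (hq : IsCoprime l q)
    (ha : IsCoprime l (a : ℤ)) :
    J(l | A) = J(q ^ 2 + d * p ^ 2 | l.natAbs) := by
  have cop {t : ℤ} (ht : IsCoprime l t) : t.gcd (l.natAbs : ℕ) = 1 := by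
    have := Int.isCoprime_iff_gcd_eq_one.1 ht
    rwa [Int.gcd_comm, Int.gcd, Int.natAbs_natCast]
  have h1 : J(q ^ 2 * A | l.natAbs) = J(a ^ 2 * (q ^ 2 + d * p ^ 2) | l.natAbs) := by
    apply jacobiSym.mod_left'
    apply Int.ModEq.symm
    rw [Int.modEq_iff_dvd, Int.natAbs_dvd]
    refine ⟨d * (q * b - p * a), ?_⟩
    rw [hA, hl]; push_cast; ring
  rw [jacobiSym_flip hA4 hodd]
  rwa [jacobiSym.mul_left, jacobiSym.mul_left, jacobiSym.sq_one' (cop hq),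
    jacobiSym.sq_one' (cop ha), one_mul, one_mul] at h1

end jacobi

section sequence

lemma target_ne_sq_of_shift_two {N r j z : ℕ} (h : J(10 - (target r : ℤ) | pellX N) = -1) :
    z ^ 2 ≠ target (r + 2 * N * (2 * j + 1)) := by
  intro hz
  refine ZMod.nonsquare_of_jacobiSym_eq_neg_one h ⟨(z : ZMod (pellX N)), ?_⟩
  obtain ⟨hx, hy⟩ := pell_cast_shift_two (R := ZMod (pellX N)) (ZMod.natCast_self _) r j
  have hz' := congrArg (Nat.cast : ℕ → ZMod (pellX N)) hz
  unfold target at hz' ⊢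
  push_cast at hz' ⊢
  rw [hx, hy] at hz'
  linear_combination -hz'

lemma eq_one_of_target_eq_sq {k z : ℕ} (hk : k % 4 = 1) (hz : z ^ 2 = target k) : k = 1 := by
  by_contra hne
  obtain ⟨s, m, ⟨j, rfl⟩, hm⟩ := Nat.exists_eq_two_pow_mul_odd (n := (k - 1) / 4) (by omega)
  have hk' : k = 1 + 2 * 2 ^ (s + 1) * (2 * j + 1) := by
    have : k = 1 + 4 * ((k - 1) / 4) := by omega
    rw [this, hm]; ring
  have hmod : pellX (2 ^ (s + 1)) % 60 = 7 ∨ pellX (2 ^ (s + 1)) % 60 = 37 := by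
    clear hk' hm
    induction s with
    | zero => left; decide
    | succ s ih =>
      have h := pellX_sq (2 ^ (s + 1))
      rw [pow_succ', pellX_two_mul]
      right
      have h2 : pellX (2 ^ (s + 1)) ^ 2 % 60 = 49 := by
        rcases ih with ih | ih <;> rw [Nat.pow_mod, ih]
      omega
  rw [hk'] at hz
  refine target_ne_sq_of_shift_two ?_ hz
  have ht : (10 - (target 1 : ℤ)) = -15 := by decide
  rw [ht, jacobiSym.mod_right _ (Nat.odd_iff.2 (by omega))]
  rcases hmod with h | h <;> norm_num [h]

lemma eq_two_of_target_eq_sq {k z : ℕ} (hk : k % 12 = 2) (hz : z ^ 2 = target k) : k = 2 := by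
  by_contra hne
  obtain ⟨s, m, ⟨j, rfl⟩, hm⟩ := Nat.exists_eq_two_pow_mul_odd (n := (k - 2) / 4) (by omega)
  have hk1 : k = 2 + 2 * 2 ^ (s + 1) * (2 * j + 1) := by
    have : k = 2 + 4 * ((k - 2) / 4) := by omega
    rw [this, hm]; ring
  have h3 : 3 ∣ 2 * j + 1 := by
    have : 3 ∣ 2 ^ s * (2 * j + 1) := by omega
    exact (Nat.Coprime.pow_right s (by norm_num)).dvd_of_dvd_mul_left this
  obtain ⟨i, hi⟩ : ∃ i, 2 * j + 1 = 3 * (2 * i + 1) := ⟨j / 3, by omega⟩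
  have hk2 : k = 2 + 2 * (3 * 2 ^ (s + 1)) * (2 * i + 1) := by rw [hk1, hi]; ring
  have ht : (10 - (target 2 : ℤ)) = -71 := by decide
  have hmod : pellX (2 ^ (s + 1)) % 284 ∈ ({7, 97, 73, 149} : Finset ℕ) := by
    clear hk1 hk2 hm
    induction s with
    | zero => decide
    | succ s ih =>
      have h := pellX_sq (2 ^ (s + 1))
      have h2 : pellX (2 ^ (s + 1 + 1)) = 2 * pellX (2 ^ (s + 1)) ^ 2 - 1 := by
        rw [pow_succ', pellX_two_mul]; omega
      have h4 : (pellX (2 ^ (s + 1 + 1)) + 1) % 284 = 2 * pellX (2 ^ (s + 1)) ^ 2 % 284 := by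
        congr 1; omega
      rw [Nat.mul_mod, Nat.pow_mod] at h4
      simp only [Finset.mem_insert, Finset.mem_singleton] at ih ⊢
      rcases ih with ih | ih | ih | ih <;> rw [ih] at h4 <;> omega
  have hmod3 : pellX (3 * 2 ^ (s + 1)) + 3 * pellX (2 ^ (s + 1)) = 4 * pellX (2 ^ (s + 1)) ^ 3 := by
    rw [pellX_three_mul]
    linear_combination 3 * pellX (2 ^ (s + 1)) * (pellX_sq (2 ^ (s + 1))).symm
  have hmod3' : (_ : ℕ) % 284 = _ % 284 := congrArg (· % 284) hmod3
  rw [Nat.mul_mod 4, Nat.pow_mod] at hmod3'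
  simp only [Finset.mem_insert, Finset.mem_singleton] at hmod
  obtain h | h : J(-71 | pellX (2 ^ (s + 1))) = -1 ∨ J(-71 | pellX (3 * 2 ^ (s + 1))) = -1 := by
    rcases hmod with h | h | h | h
    · left
      rw [jacobiSym.mod_right _ (Nat.odd_iff.2 (by omega))]
      norm_num [h]
    · left
      rw [jacobiSym.mod_right _ (Nat.odd_iff.2 (by omega))]
      norm_num [h]
    · right
      rw [h] at hmod3'
      have : pellX (3 * 2 ^ (s + 1)) % 284 = 97 := by omega
      rw [jacobiSym.mod_right _ (Nat.odd_iff.2 (by omega))]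
      norm_num [this]
    · left
      rw [jacobiSym.mod_right _ (Nat.odd_iff.2 (by omega))]
      norm_num [h]
  · rw [hk1] at hz
    exact target_ne_sq_of_shift_two (ht ▸ h) hz
  · rw [hk2] at hz
    exact target_ne_sq_of_shift_two (ht ▸ h) hz

lemma pell_isCoprime (n : ℕ) : IsCoprime (pellX n : ℤ) (pellY n) :=
  Nat.isCoprime_iff_coprime.2 (Pell.xy_coprime one_lt_two n)

/-- A fourth root of unity obstruction, used next to the solutions `k = 0` and `k = -1`. -/
lemma fourth_root_obstruction {n : ℕ} (hx : pellX n % 1752 = 985)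
    (hy : pellY n % 1752 = 1656 ∨ pellY n % 1752 = 96) {ε : ℤ} (hε : ε = 1 ∨ ε = -1)
    (z : ZMod (pellX (2 * n))) : z ^ 2 ≠ 12 * ε * pellY (2 * n) + 5 := by
  intro hz
  have h2 := pell_cast_sq (R := ZMod (pellX (2 * n))) n
  have hab := pell_isCoprime n
  have hA : pellX (2 * n) = pellX n ^ 2 + 3 * pellY n ^ 2 := pellX_two_mul n
  have h1 : (pellX n : ZMod (pellX (2 * n))) ^ 2 + 3 * pellY n ^ 2 = 0 := by
    have := congrArg (Nat.cast : ℕ → ZMod (pellX (2 * n))) hA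
    rw [ZMod.natCast_self] at this
    exact_mod_cast this.symm
  rw [pellY_two_mul n] at hz
  generalize pellX n = a at *
  generalize pellY n = b at *
  generalize pellX (2 * n) = A at *
  have hA8 : A % 8 = 1 := by
    have h1 : a % 8 = 1 := by omega
    have h2 : b % 8 = 0 := by omega
    rw [hA]; simp [Nat.add_mod, Nat.mul_mod, Nat.pow_mod, h1, h2]
  obtain ⟨l, hl⟩ : ∃ l : ℤ, l = 5 * a + (12 * ε) * b := ⟨_, rfl⟩
  have key : z ^ 2 = (2 * a * l : ℤ) := by
    rw [hz, hl]
    push_cast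
    linear_combination -5 * h1 - 5 * h2
  have ha12 : IsCoprime (a : ℤ) (12 * ε) := by
    have : IsCoprime (a : ℤ) (12 : ℕ) := by
      refine Nat.isCoprime_iff_coprime.2 ?_
      have : a % 12 = 1 := by omega
      rw [Nat.coprime_comm, Nat.Coprime, Nat.gcd_rec, this, Nat.gcd_one_left]
    rcases hε with rfl | rfl
    · simpa using this
    · simpa using this.neg_right
  have h5 : IsCoprime (5 : ℤ) (12 * ε) := by
    rcases hε with rfl | rfl <;> norm_num
  have hl12 : l % 12 = 5 := by
    rcases hε with rfl | rfl <;> omega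
  have hJl : J(l | A) = -1 := by
    rw [jacobiSym_linear_quadratic (p := 5) (q := 12 * ε) hA (by omega) hl
      (Int.odd_iff.2 (by omega)) (by rw [hl]; exact (h5.mul_left ha12).add_mul_left_left _)
      (by rw [hl]; exact (ha12.symm.mul_left hab.symm).mul_add_right_left _)]
    have h219 : ((12 * ε) ^ 2 + (3 : ℕ) * 5 ^ 2 : ℤ) = 3 * (73 : ℕ) := by
      rcases hε with rfl | rfl <;> norm_num
    have h3 : J(3 | l.natAbs) = -1 := by
      rw [jacobiSym.mod_right _ (Nat.odd_iff.2 (by omega))]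
      have : l.natAbs % 12 = 5 ∨ l.natAbs % 12 = 7 := by omega
      rcases this with h | h <;> norm_num [h]
    have h73 : J((73 : ℕ) | l.natAbs) = 1 := by
      rw [← jacobiSym_flip (by norm_num) (Int.odd_iff.2 (by omega)), jacobiSym.mod_left]
      have : l % (73 : ℕ) = 50 ∨ l % (73 : ℕ) = 18 := by
        rcases hε with rfl | rfl <;> omega
      rcases this with h | h <;> rw [h] <;> norm_num
    rw [h219, jacobiSym.mul_left, h3, h73, mul_one]
  have hJa : J(a | A) = 1 := by
    rw [jacobiSym.quadratic_reciprocity_one_mod_four' (Nat.odd_iff.2 (by omega)) (by omega)]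
    have : J(A | a) = J(3 * b ^ 2 | a) := by
      apply jacobiSym.mod_left'
      rw [hA, pow_two]; push_cast; simp
    rw [this, jacobiSym.mul_left, jacobiSym.sq_one' (Int.isCoprime_iff_gcd_eq_one.1 hab.symm),
      jacobiSym.mod_right _ (Nat.odd_iff.2 (by omega))]
    have : a % 12 = 1 := by omega
    norm_num [this]
  refine ZMod.nonsquare_of_jacobiSym_eq_neg_one (a := 2 * a * l) (b := A) ?_
    ⟨z, by rw [← key]; ring⟩
  rw [jacobiSym.mul_left, jacobiSym.mul_left, hJa, hJl,
    jacobiSym.at_two (Nat.odd_iff.2 (by omega)), ZMod.χ₈_nat_mod_eight, hA8]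
  decide

lemma eq_zero_of_target_eq_sq {t z : ℕ} (ht : t % 24 = 0)
    (hz : z ^ 2 + 4 * pellX t = 12 * pellY t + 5 ∨ z ^ 2 = target t) : t = 0 := by
  by_contra hne
  obtain ⟨s, m, ⟨j, rfl⟩, hm⟩ := Nat.exists_eq_two_pow_mul_odd (n := t) hne
  have hs : 3 ≤ s := by
    by_contra hs
    have : s = 0 ∨ s = 1 ∨ s = 2 := by omega
    rcases this with rfl | rfl | rfl <;> omega
  obtain ⟨s, rfl⟩ := Nat.exists_eq_add_of_le hs
  have h3 : 3 ∣ 2 * j + 1 := by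
    have : 3 ∣ 2 ^ (3 + s) * (2 * j + 1) := by omega
    exact (Nat.Coprime.pow_right _ (by norm_num)).dvd_of_dvd_mul_left this
  obtain ⟨i, hi⟩ : ∃ i, 2 * j + 1 = 3 * (2 * i + 1) := ⟨j / 3, by omega⟩
  have ht' : t = 2 * (12 * 2 ^ s) * (2 * i + 1) := by rw [hm, hi]; ring
  obtain ⟨hx, ε, hε, hy⟩ := pell_cast_odd_mul (R := ZMod (pellX (2 * (12 * 2 ^ s))))
    (ZMod.natCast_self _) i
  rw [← ht'] at hx hy
  have hmod : pellX (12 * 2 ^ s) % 1752 = 985 ∧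
      (pellY (12 * 2 ^ s) % 1752 = 1656 ∨ pellY (12 * 2 ^ s) % 1752 = 96) := by
    clear ht' hx hy hm hs
    induction s with
    | zero => decide
    | succ s ih =>
      rw [pow_succ', mul_left_comm, pellX_two_mul, pellY_two_mul]
      rcases ih with ⟨h1, h2 | h2⟩ <;> simp [Nat.add_mod, Nat.mul_mod, Nat.pow_mod, h1, h2]
  refine fourth_root_obstruction hmod.1 hmod.2 hε (z : ZMod _) ?_
  unfold target at hz
  rcases hz with hz | hz
  all_goals
    have hz' := congrArg (Nat.cast : ℕ → ZMod (pellX (2 * (12 * 2 ^ s)))) hz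
    push_cast at hz'
    rw [hx, hy] at hz'
    linear_combination hz'

/-- A cube root of unity obstruction, used next to the solution `k = 3`. -/
lemma cube_root_obstruction {n : ℕ} (hx : pellX n % 8 = 1) (hy : pellY n % 4 = 0) {ε : ℤ}
    (hε : ε = 1 ∨ ε = -1) (hJ : J(-137 * pellX n + 738 * ε * pellY n | 79285) = -1)
    {A : ℕ} (hA : A = pellX n ^ 2 + 9 * pellY n ^ 2) (z : ZMod A) :
    z ^ 2 ≠ -137 + 492 * ε * pellY (2 * n) := by
  intro hz
  have h2 := pell_cast_sq (R := ZMod A) n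
  have hsq := pellX_sq n
  have hab := pell_isCoprime n
  rw [pellY_two_mul n] at hz
  have h1 : (pellX n : ZMod A) ^ 2 + 9 * pellY n ^ 2 = 0 := by
    have := congrArg (Nat.cast : ℕ → ZMod A) hA
    rw [ZMod.natCast_self] at this
    exact_mod_cast this.symm
  generalize pellX n = a at *
  generalize pellY n = b at *
  obtain ⟨l, hl⟩ : ∃ l : ℤ, l = (-137) * a + (738 * ε) * b := ⟨_, rfl⟩
  rw [← hl] at hJ
  have hA24 : A % 24 = 1 := by
    have h8 : A % 8 = 1 := by
      have : b % 8 = 0 ∨ b % 8 = 4 := by omega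
      rcases this with h | h <;> simp [hA, Nat.add_mod, Nat.mul_mod, Nat.pow_mod, hx, h]
    omega
  have key : (3 * z) ^ 2 = (2 ^ 2 * 3 * a * l : ℤ) := by
    rw [mul_pow, hz, hl]
    push_cast
    linear_combination 1233 * h2 + 411 * h1
  have ha3 : IsCoprime (a : ℤ) 3 := ⟨a, -(b ^ 2 : ℤ), by
    have : (a : ℤ) ^ 2 = 3 * b ^ 2 + 1 := by exact_mod_cast hsq
    linear_combination this⟩
  have ha738 : IsCoprime (a : ℤ) (738 * ε) := by
    have ha2 : IsCoprime (a : ℤ) (2 : ℕ) :=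
      Nat.isCoprime_iff_coprime.2 (Nat.coprime_two_right.2 (Nat.odd_iff.2 (by omega)))
    have ha41 : IsCoprime (a : ℤ) (41 : ℕ) := by
      refine Nat.isCoprime_iff_coprime.2 (Nat.Coprime.symm ?_)
      refine (Nat.Prime.coprime_iff_not_dvd (by norm_num)).2 fun h => ?_
      have h41 := congrArg (Nat.cast : ℕ → ZMod 41) hsq
      push_cast at h41
      rw [(ZMod.natCast_eq_zero_iff a 41).2 h] at h41
      exact (by decide : ∀ x : ZMod 41, 0 ^ 2 ≠ 3 * x ^ 2 + 1) _ h41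
    have : IsCoprime (a : ℤ) (2 * 3 * 3 * 41) :=
      ((ha2.mul_right ha3).mul_right ha3).mul_right ha41
    rcases hε with rfl | rfl
    · simpa using this
    · simpa using this.neg_right
  have h137 : IsCoprime (-137 : ℤ) (738 * ε) := by
    rcases hε with rfl | rfl <;> norm_num
  have hlodd : Odd l := by
    rw [Int.odd_iff]
    rcases hε with rfl | rfl <;> omega
  have hl738 : IsCoprime l (738 * ε) := by
    rw [hl]; exact (h137.mul_left ha738).add_mul_left_left _
  have hla : IsCoprime l a := by
    rw [hl]; exact (ha738.symm.mul_left hab.symm).mul_add_right_left _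
  have hJl : J(l | A) = -1 := by
    rw [jacobiSym_linear_quadratic hA (by omega) hl hlodd hl738 hla]
    have h : ((738 * ε) ^ 2 + (9 : ℕ) * (-137) ^ 2 : ℤ) = 3 ^ 2 * (79285 : ℕ) := by
      rcases hε with rfl | rfl <;> norm_num
    have h3 : J(3 ^ 2 | l.natAbs) = 1 := by
      refine jacobiSym.sq_one' ?_
      have : IsCoprime (3 : ℤ) l :=
        (hl738.of_isCoprime_of_dvd_right ⟨246 * ε, by ring⟩).symm
      have := Int.isCoprime_iff_gcd_eq_one.1 this
      rwa [Int.gcd, Int.natAbs_natCast]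
    rw [h, jacobiSym.mul_left, h3, one_mul, ← jacobiSym_flip (by norm_num) hlodd, hJ]
  have hAodd : Odd A := Nat.odd_iff.2 (by omega)
  have hJa : J(a | A) = 1 := by
    rw [jacobiSym.quadratic_reciprocity_one_mod_four' (Nat.odd_iff.2 (by omega)) (by omega)]
    have : J(A | a) = J((3 * b) ^ 2 | a) := by
      apply jacobiSym.mod_left'
      rw [hA, pow_two a, mul_pow]; push_cast; simp
    rw [this, jacobiSym.sq_one']
    exact Int.isCoprime_iff_gcd_eq_one.1 (ha3.mul_right hab).symm
  refine ZMod.nonsquare_of_jacobiSym_eq_neg_one (a := 2 ^ 2 * 3 * a * l) (b := A) ?_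
    ⟨3 * z, by rw [← key]; ring⟩
  have hJ2 : J(2 ^ 2 | A) = 1 := by
    refine jacobiSym.sq_one' ?_
    exact Int.isCoprime_iff_gcd_eq_one.1
      (Nat.isCoprime_iff_coprime.2 (Nat.coprime_two_left.2 hAodd))
  have hJ3 : J(3 | A) = 1 := by
    rw [jacobiSym.mod_right _ hAodd]
    have : A % 12 = 1 := by omega
    norm_num [this]
  rw [jacobiSym.mul_left, jacobiSym.mul_left, jacobiSym.mul_left, hJa, hJl, hJ2, hJ3]
  rfl

lemma target_ne_sq_of_cube_root {n j z : ℕ} {ε : ℤ} (hε : j % 3 = 1 ∧ ε = 1 ∨ j % 3 = 2 ∧ ε = -1)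
    (hx : pellX n % 8 = 1) (hy : pellY n % 4 = 0)
    (hJ : J(-137 * pellX n + 738 * ε * pellY n | 79285) = -1) :
    z ^ 2 ≠ target (3 + 2 * (2 * n) * j) := by
  intro hz
  obtain ⟨A, hA⟩ : ∃ A, A = pellX n ^ 2 + 9 * pellY n ^ 2 := ⟨_, rfl⟩
  have hN : 2 * (pellX (2 * n) : ZMod A) = 1 := by
    have h : 2 * pellX (2 * n) = A + 1 := by
      rw [pellX_two_mul, hA]; linarith [pellX_sq n]
    have := congrArg (Nat.cast : ℕ → ZMod A) h
    push_cast at this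
    rw [this, ZMod.natCast_self, zero_add]
  obtain ⟨h1, h2⟩ := pell_cast_cube hN hε
  refine cube_root_obstruction hx hy (by omega) hJ hA (z : ZMod A) ?_
  have hz' := congrArg (Nat.cast : ℕ → ZMod A) hz
  have hx3 : pellX 3 = 26 := by decide
  have hy3 : pellY 3 = 15 := by decide
  unfold target at hz'
  rw [pellX_add, pellY_add, hx3, hy3] at hz'
  push_cast at hz'
  rw [h2] at hz'
  linear_combination hz' + 142 * h1

lemma mod_eq_of_two_mul {n x y : ℕ} (hx : pellX n % 634280 = x) (hy : pellY n % 634280 = y) :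
    pellX (2 * n) % 634280 = (x ^ 2 + 3 * y ^ 2) % 634280 ∧
      pellY (2 * n) % 634280 = (2 * x * y) % 634280 := by
  subst hx hy
  rw [pellX_two_mul, pellY_two_mul]
  simp [Nat.add_mod, Nat.mul_mod, Nat.pow_mod]

lemma eq_three_of_target_eq_sq {k z : ℕ} (hk : k % 3264 = 3) (hz : z ^ 2 = target k) : k = 3 := by
  by_contra hne
  obtain ⟨s, t, ht, hs⟩ := Nat.exists_eq_pow_mul_and_not_dvd (n := (k - 3) / 3264) (by omega) 3
    (by norm_num)
  have hk' : k = 3 + 3264 * (3 ^ s * t) := by omega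
  have hres : (pellX (204 * 3 ^ s) % 634280 = 298961 ∧ pellY (204 * 3 ^ s) % 634280 = 500960) ∨
      (pellX (204 * 3 ^ s) % 634280 = 529241 ∧ pellY (204 * 3 ^ s) % 634280 = 391880) ∨
      (pellX (204 * 3 ^ s) % 634280 = 610041 ∧ pellY (204 * 3 ^ s) % 634280 = 222200) := by
    clear hk' hs
    induction s with
    | zero => left; decide +kernel
    | succ s ih =>
      rw [pow_succ', mul_left_comm, pellX_three_mul, pellY_three_mul]
      rcases ih with ⟨h1, h2⟩ | ⟨h1, h2⟩ | ⟨h1, h2⟩ <;>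
        simp [Nat.add_mod, Nat.mul_mod, Nat.pow_mod, h1, h2]
  obtain ⟨ε, hε⟩ : ∃ ε : ℤ, t % 3 = 1 ∧ ε = 1 ∨ t % 3 = 2 ∧ ε = -1 := by
    have : t % 3 = 1 ∨ t % 3 = 2 := by omega
    rcases this with h | h
    · exact ⟨1, by omega⟩
    · exact ⟨-1, by omega⟩
  have hk1 : k = 3 + 2 * (2 * (204 * 3 ^ s)) * (4 * t) := by rw [hk']; ring
  have hk2 : k = 3 + 2 * (2 * (2 * (2 * (204 * 3 ^ s)))) * t := by rw [hk']; ring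
  have hε4 : 4 * t % 3 = 1 ∧ ε = 1 ∨ 4 * t % 3 = 2 ∧ ε = -1 := by omega
  generalize 204 * 3 ^ s = n at *
  have hbase (hn : pellX n % 8 = 1) (hn' : pellY n % 4 = 0) :
      J(-137 * pellX n + 738 * ε * pellY n | 79285) ≠ -1 := fun hJ => by
    rw [hk1] at hz
    exact target_ne_sq_of_cube_root hε4 hn hn' hJ hz
  have hquad (hn : pellX (2 * (2 * n)) % 8 = 1) (hn' : pellY (2 * (2 * n)) % 4 = 0) :
      J(-137 * pellX (2 * (2 * n)) + 738 * ε * pellY (2 * (2 * n)) | 79285) ≠ -1 := fun hJ => by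
    rw [hk2] at hz
    exact target_ne_sq_of_cube_root hε hn hn' hJ hz
  have hsymbol {x y : ℤ} {a b : ℕ} (hx : (a : ℤ) % 634280 = x) (hy : (b : ℤ) % 634280 = y) :
      J(-137 * a + 738 * ε * b | 79285) = J((-137 * x + 738 * ε * y) % 79285 | 79285) := by
    rw [jacobiSym.mod_left]
    congr 1
    push_cast
    rcases hε with ⟨-, rfl⟩ | ⟨-, rfl⟩ <;> omega
  rcases hres with ⟨h1, h2⟩ | ⟨h1, h2⟩ | ⟨h1, h2⟩
  · rcases hε with ⟨-, rfl⟩ | ⟨-, rfl⟩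
    · obtain ⟨h3, h4⟩ := mod_eq_of_two_mul h1 h2
      obtain ⟨h5, h6⟩ := mod_eq_of_two_mul h3 h4
      norm_num at h5 h6
      refine hquad (by omega) (by omega) ?_
      rw [hsymbol (x := 610041) (y := 412080) (by omega) (by omega)]
      norm_num
    · refine hbase (by omega) (by omega) ?_
      rw [hsymbol (x := 298961) (y := 500960) (by omega) (by omega)]
      norm_num
  · refine hbase (by omega) (by omega) ?_
    rw [hsymbol (x := 529241) (y := 391880) (by omega) (by omega)]
    rcases hε with ⟨-, rfl⟩ | ⟨-, rfl⟩ <;> norm_num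
  · obtain ⟨h3, h4⟩ := mod_eq_of_two_mul h1 h2
    obtain ⟨h5, h6⟩ := mod_eq_of_two_mul h3 h4
    norm_num at h5 h6
    refine hquad (by omega) (by omega) ?_
    rw [hsymbol (x := 529241) (y := 242400) (by omega) (by omega)]
    rcases hε with ⟨-, rfl⟩ | ⟨-, rfl⟩ <;> norm_num

end sequence

section sieve

/-- The bit mask `M` records the residues modulo `o` of those `k` for which `target k` can be a
square modulo the prime `p`. -/
lemma testBit_of_target_eq_sq {p o M : ℕ} (hp : p.Prime) (hp2 : p % 2 = 1) (ho0 : 0 < o)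
    (ho : pellX o % p = 1 % p ∧ pellY o % p = 0 % p)
    (hM : ∀ i < o, M.testBit i = true ∨ 1 < (target i % p) ^ (p / 2) % p) {k z : ℕ}
    (hz : z ^ 2 = target k) : M.testBit (k % o) = true := by
  have : Fact p.Prime := ⟨hp⟩
  refine (hM _ (Nat.mod_lt k ho0)).resolve_right fun h => ?_
  have hx : (pellX o : ZMod p) = 1 := by
    exact_mod_cast (ZMod.natCast_eq_natCast_iff' _ _ p).2 ho.1
  have hy : (pellY o : ZMod p) = 0 := by
    exact_mod_cast (ZMod.natCast_eq_natCast_iff' _ _ p).2 ho.2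
  have hk : (target k : ZMod p) = target (k % o) := by
    conv_lhs => rw [← Nat.mod_add_div k o]
    unfold target
    push_cast
    rw [(pell_cast_period hx hy _ _).1, (pell_cast_period hx hy _ _).2]
  have hpow : ((target (k % o) % p) ^ (p / 2) % p : ℕ) = (z : ZMod p) ^ (p - 1) := by
    rw [show p - 1 = 2 * (p / 2) by omega, pow_mul]
    have := congrArg (Nat.cast : ℕ → ZMod p) hz
    push_cast at this ⊢
    simp [this, hk]
  have key : (z : ZMod p) ^ (p - 1) = (0 : ℕ) ∨ (z : ZMod p) ^ (p - 1) = (1 : ℕ) := by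
    by_cases h0 : (z : ZMod p) = 0
    · left
      rw [h0, zero_pow (by have := hp.two_le; omega), Nat.cast_zero]
    · right
      rw [ZMod.pow_card_sub_one_eq_one h0, Nat.cast_one]
  rw [← hpow, ZMod.natCast_eq_natCast_iff', ZMod.natCast_eq_natCast_iff', Nat.mod_mod,
    Nat.zero_mod, Nat.mod_eq_of_lt hp.one_lt] at key
  omega

/-- Triples `(p, o, M)` as in `testBit_of_target_eq_sq`. -/
def squareMasks : List (ℕ × ℕ × ℕ) :=
  [(7, 8, 159),
    (13, 12, 2175),
    (509, 17, 88975),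
    (193, 24, 9478143),
    (31, 32, 3528192399),
    (443, 34, 14232840495),
    (127, 128, 189224625489946080407588618269226231391),
    (3943, 136, 57576914695579281210530940784411295694063),
    (769, 192, 5333284758751643487327701247826720524190232456392653816975),
    (409, 204, 23064428916222605284070716458757403180270121477785241829885023)]

lemma testBit_of_mem_squareMasks {k z : ℕ} (hz : z ^ 2 = target k) {c : ℕ × ℕ × ℕ}
    (hc : c ∈ squareMasks) : c.2.2.testBit (k % c.2.1) = true := by
  have hprime : c.1.Prime := by
    revert c
    simp only [squareMasks, List.forall_mem_cons]
    norm_num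
  have hperiod : ∀ c ∈ squareMasks, c.1 % 2 = 1 ∧ 0 < c.2.1 ∧
      (pellX c.2.1 % c.1 = 1 % c.1 ∧ pellY c.2.1 % c.1 = 0 % c.1) ∧
      ∀ i < c.2.1, c.2.2.testBit i = true ∨ 1 < (target i % c.1) ^ (c.1 / 2) % c.1 := by
    decide +kernel
  obtain ⟨h1, h2, h3, h4⟩ := hperiod c hc
  exact testBit_of_target_eq_sq hprime h1 h2 h3 h4 hz

lemma mod_of_target_eq_sq {k z : ℕ} (hz : z ^ 2 = target k) :
    k % 24 = 0 ∨ k % 24 = 23 ∨ k % 12 = 2 ∨ k % 4 = 1 ∨ k % 3264 = 3 := by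
  have hsieve : ∀ i < 68, ∀ j < 96, (96 * i + j) % 24 = 0 ∨ (96 * i + j) % 24 = 23 ∨
      (96 * i + j) % 12 = 2 ∨ (96 * i + j) % 4 = 1 ∨ (96 * i + j) % 3264 = 3 ∨
      ∃ c ∈ squareMasks, c.2.2.testBit ((96 * i + j) % c.2.1) = false := by
    decide +kernel
  have hperiod : ∀ c ∈ squareMasks, c.2.1 ∣ 6528 := by decide +kernel
  have hk := hsieve (k % 6528 / 96) (by omega) (k % 6528 % 96) (by omega)
  rw [Nat.div_add_mod] at hk
  rcases hk with h | h | h | h | h | ⟨c, hc, h⟩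
  iterate 5 omega
  rw [Nat.mod_mod_of_dvd k (hperiod c hc), testBit_of_mem_squareMasks hz hc] at h
  exact absurd h (by decide)

end sieve

lemma le_three_of_target_eq_sq {k z : ℕ} (hz : z ^ 2 = target k) : k ≤ 3 := by
  rcases mod_of_target_eq_sq hz with h | h | h | h | h
  · have := eq_zero_of_target_eq_sq h (.inr hz)
    omega
  · have hz' : z ^ 2 + 4 * pellX (k + 1) = 12 * pellY (k + 1) + 5 := by
      rw [hz, target, pellX_succ, pellY_succ]; ring
    have := eq_zero_of_target_eq_sq (t := k + 1) (by omega) (.inl hz')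
    omega
  · have := eq_two_of_target_eq_sq h hz
    omega
  · have := eq_one_of_target_eq_sq h hz
    omega
  · exact (eq_three_of_target_eq_sq h hz).le

/-- The only solution of `X ^ 2 + 2 = 3 * Y ^ 2` with `4 * X + 5` a square and `X ≥ 41`. -/
lemma eq_of_sq_add_two {X Y z : ℕ} (hX : 41 ≤ X) (h : X ^ 2 + 2 = 3 * Y ^ 2)
    (hz : z ^ 2 = 4 * X + 5) : X = 71 ∧ Y = 41 := by
  have hYX : Y ≤ X := by nlinarith
  have hXY : X ≤ 3 * Y := by nlinarith
  have hpar : X % 2 = Y % 2 := by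
    have := congrArg (· % 2) h
    rcases Nat.mod_two_eq_zero_or_one X with h1 | h1 <;>
      rcases Nat.mod_two_eq_zero_or_one Y with h2 | h2 <;>
      simp [Nat.mul_mod, Nat.pow_mod, h1, h2] at this ⊢
  obtain ⟨b, hb⟩ : ∃ b, X = Y + 2 * b := ⟨(X - Y) / 2, by omega⟩
  obtain ⟨a, ha⟩ : ∃ a, 3 * Y = X + 2 * a := ⟨(3 * Y - X) / 2, by omega⟩
  obtain rfl : Y = a + b := by omega
  obtain rfl : X = a + 3 * b := by omega
  obtain ⟨k, rfl, rfl⟩ := exists_pell (x := a) (y := b) (by nlinarith)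
  have hk := le_three_of_target_eq_sq hz
  interval_cases k <;> revert hX <;> decide

lemma choose_four_mul (l : ℕ) :
    24 * (l + 4).choose 4 = (l + 4) * (l + 3) * (l + 2) * (l + 1) := by
  have := Nat.descFactorial_eq_factorial_mul_choose (l + 4) 4
  simp [Nat.descFactorial, Nat.factorial] at this
  rw [← this]; ring

theorem binom_2_4_collisions (n m : ℕ) (hn : 4 ≤ n) (hm : 8 ≤ m) :
    Nat.choose n 2 = Nat.choose m 4 ↔ (n, m) = (21, 10) := by
  constructor
  · intro h
    obtain ⟨l, rfl⟩ := Nat.exists_eq_add_of_le' (show 4 ≤ m by omega)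
    obtain ⟨r, rfl⟩ := Nat.exists_eq_add_of_le' (show 1 ≤ n by omega)
    have h2 : 2 * (r + 1).choose 2 = (r + 1) * r := by
      rw [Nat.choose_two_right, Nat.mul_div_cancel' (Nat.even_mul_pred_self _).two_dvd]
      rfl
    have h4 := choose_four_mul l
    rw [← h] at h4
    have hX : 41 ≤ l ^ 2 + 5 * l + 5 := by nlinarith
    obtain ⟨hX, hY⟩ := eq_of_sq_add_two (X := l ^ 2 + 5 * l + 5) (Y := 2 * r + 1) (z := 2 * l + 5)
      hX (by linear_combination 12 * h2 - h4) (by ring)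
    obtain rfl : r = 20 := by omega
    obtain rfl : l = 6 := by nlinarith
    rfl
  · rintro ⟨⟩
    decide
end
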